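/- arXiv:1704.05224 — 12 statements merged into one kernel-verified Lean document; each statement's English description precedes it below -/
import Mathlib

section
/- Let N ≥ 1, ν ≥ 0, κ ≥ 0 be integers, M = N+ν, and let α > 0. Let δ_1,…,δ_N > 0 be pairwise distinct and q_1,…,q_M > 0 pairwise distinct with α q_i − δ_k > 0 for all i,k. Let A be the M×M complex matrix with entries A_{i,k} = (α q_i)^{k−1} for 1 ≤ k ≤ ν and A_{i,ν+k} = δ_k^{κ/2} / (2 α^κ (α q_i − δ_k)) for 1 ≤ k ≤ N. Then A is invertible, and for all real numbers c_1, c_2 and R_1, R_2 > 0 satisfying: |δ_k − c_1| < R_1 and |δ_k − c_2| > R_2 for all k; |α q_j − c_2| < R_2 and |α q_j − c_1| > R_1 for all j; c_2 − R_2 > 0; and |c_1 − c_2| > R_1 + R_2, and for all y_1, y_2 > 0, one has Σ_{k=1}^N Σ_{j=1}^M δ_k^{κ/2} E_κ(δ_k, y_1) (A^{−1})_{ν+k, j} (2 α^κ)^{−1} F_κ(y_2, α q_j) = (2πi)^{−2} ∮_{|η−c_1|=R_1} ∮_{|ζ−c_2|=R_2} [E_κ(η, y_1) F_κ(y_2,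 ζ) / (η − ζ)] · ∏_{l=1}^N (ζ − δ_l)/(η − δ_l) · ∏_{m=1}^M (η − α q_m)/(ζ − α q_m) dζ dη. -/
open MeasureTheory Matrix Finset

noncomputable section

/-- `E_κ(δ, y) = Σ_{n≥0} δ^n y^{n+κ} / (n! (n+κ)!)` (real parameters). -/
def Ebes (κ : ℕ) (δ y : ℝ) : ℝ :=
  ∑' n : ℕ, δ ^ n * y ^ (n + κ) / ((n.factorial : ℝ) * ((n + κ).factorial : ℝ))

/-- `E_κ(δ, y)` for a complex parameter `δ`. -/
def EbesC (κ : ℕ) (δ : ℂ) (y : ℝ) : ℂ :=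
  ∑' n : ℕ, δ ^ n * (y : ℂ) ^ (n + κ) / ((n.factorial : ℝ) * ((n + κ).factorial : ℝ))

/-- `F_κ(a, ζ) = ∫_0^∞ t^{-κ-1} exp(-a/t - ζ t) dt` (real `ζ`). -/
def Fbes (κ : ℕ) (a ζ : ℝ) : ℝ :=
  ∫ t in Set.Ioi (0 : ℝ), t ^ (-(κ : ℤ) - 1) * Real.exp (-a / t - ζ * t)

/-- `F_κ(a, ζ)` for a complex parameter `ζ`. -/
def FbesC (κ : ℕ) (a : ℝ) (ζ : ℂ) : ℂ :=
  ∫ t in Set.Ioi (0 : ℝ), (t : ℂ) ^ (-(κ : ℤ) - 1) * Complex.exp (-(a : ℂ) / t - ζ * t)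

namespace CoupledKernel

open Polynomial in
theorem mul_prod_erase_eq_sum_of_eval_add_sum_div_eq {K ι σ : Type*} [Field K] [Fintype ι]
    [DecidableEq ι] [Fintype σ] [DecidableEq σ] {x : ι → K} {d : σ → K} {ν : ℕ}
    (hx : Function.Injective x) (hxd : ∀ i k, x i ≠ d k)
    (hcard : Fintype.card ι = Fintype.card σ + ν) {p : K[X]} (hp : p.degree < ν)
    {b : σ → K} {w : ι → K} (h : ∀ i, p.eval (x i) + ∑ k, b k / (x i - d k) = w i) :
    p * Lagrange.nodal univ d + ∑ k, C (b k) * Lagrange.nodal (univ.erase k) d =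
      Lagrange.interpolate univ x fun i => w i * ∏ l, (x i - d l) := by
  apply Lagrange.eq_interpolate_of_eval_eq _ hx.injOn
  · rw [card_univ, hcard, Nat.cast_add, add_comm (Fintype.card σ : WithBot ℕ)]
    refine (degree_add_le _ _).trans_lt (max_lt ?_ ?_)
    · rcases eq_or_ne p 0 with rfl | hp0
      · simp only [zero_mul, degree_zero]
        exact_mod_cast WithBot.bot_lt_coe (ν + Fintype.card σ)
      · rw [degree_mul, Lagrange.degree_nodal, card_univ]
        exact WithBot.add_lt_add_right (by simp) hp
    · refine (degree_sum_le _ _).trans_lt ?_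
      rw [Finset.sup_lt_iff (by exact_mod_cast WithBot.bot_lt_coe (ν + Fintype.card σ))]
      intro k _
      refine (degree_mul_le _ _).trans_lt ?_
      refine (add_le_add_left degree_C_le _).trans_lt ?_
      rw [zero_add, Lagrange.degree_nodal, card_erase_of_mem (mem_univ k), card_univ]
      have : 0 < Fintype.card σ := Fintype.card_pos_iff.mpr ⟨k⟩
      exact_mod_cast (by omega : Fintype.card σ - 1 < ν + Fintype.card σ)
  · intro i _
    rw [← h i, eval_add, eval_mul, eval_finsetSum, Lagrange.eval_nodal, add_mul, sum_mul]
    congr 1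
    refine sum_congr rfl fun k _ => ?_
    rw [eval_mul, eval_C, Lagrange.eval_nodal, ← mul_prod_erase univ _ (mem_univ k), ← mul_assoc,
      div_mul_cancel₀ _ (sub_ne_zero.mpr (hxd i k))]

theorem circleIntegral_div_prod {ι : Type*} [Fintype ι] [DecidableEq ι] [Nonempty ι] {z : ι → ℂ}
    (hz : Function.Injective z) {c : ℂ} {R : ℝ} {f : ℂ → ℂ}
    (hf : DifferentiableOn ℂ f (Metric.closedBall c R)) (hmem : ∀ i, z i ∈ Metric.ball c R) :
    (∮ w in C(c, R), f w / ∏ i, (w - z i)) =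
      2 * Real.pi * Complex.I * ∑ i, f (z i) * Lagrange.nodalWeight univ z i := by
  have hR : 0 < R := dist_nonneg.trans_lt (hmem (Classical.arbitrary ι))
  have hne : ∀ w ∈ Metric.sphere c R, ∀ i, w - z i ≠ 0 := by
    intro w hw i h0
    rw [sub_eq_zero] at h0
    have h1 := hmem i
    rw [← h0, Metric.mem_ball, Metric.mem_sphere.mp hw] at h1
    exact lt_irrefl _ h1
  have key : Set.EqOn (fun w => f w / ∏ i, (w - z i))
      (fun w => ∑ i, Lagrange.nodalWeight univ z i * ((w - z i)⁻¹ • f w))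
      (Metric.sphere c R) := by
    intro w hw
    have hw' : ∀ i ∈ univ, w ≠ z i := fun i _ => sub_ne_zero.mp (hne w hw i)
    have h1 := Lagrange.eval_interpolate_not_at_node 1 hw'
    rw [Lagrange.interpolate_one hz.injOn univ_nonempty, Polynomial.eval_one,
      Lagrange.eval_nodal] at h1
    simp only [Pi.one_apply, mul_one] at h1
    have h2 : ∏ i, (w - z i) ≠ 0 := prod_ne_zero_iff.mpr fun i _ => hne w hw i
    simp only [smul_eq_mul, ← mul_assoc, ← sum_mul]
    rw [div_eq_iff h2, mul_right_comm, mul_comm (∑ i, _), ← h1, one_mul]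
  rw [circleIntegral.integral_congr hR.le key, circleIntegral.integral_fun_sum, mul_sum]
  · refine sum_congr rfl fun i _ => ?_
    rw [circleIntegral.integral_const_mul, hf.circleIntegral_sub_inv_smul (hmem i), smul_eq_mul]
    ring
  · intro i _
    refine ContinuousOn.circleIntegrable hR.le ?_
    refine continuousOn_const.mul (ContinuousOn.fun_smul ?_ ?_)
    · exact (continuousOn_id.sub continuousOn_const).inv₀ fun w hw => hne w hw i
    · exact hf.continuousOn.mono Metric.sphere_subset_closedBall

theorem differentiable_EbesC (κ : ℕ) (y : ℝ) : Differentiable ℂ fun δ => EbesC κ δ y := by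
  intro δ₀
  set R : ℝ := ‖δ₀‖ + 1
  refine DifferentiableOn.differentiableAt (s := Metric.ball 0 R) ?_
    (Metric.isOpen_ball.mem_nhds (by simp [R]))
  refine Complex.differentiableOn_tsum_of_summable_norm
    (u := fun n : ℕ => |y| ^ κ * ((R * |y|) ^ n / n.factorial))
    ((Real.summable_pow_div_factorial _).mul_left _) (fun n => by fun_prop) Metric.isOpen_ball ?_
  intro n w hw
  have hw' : ‖w‖ ≤ R := (mem_ball_zero_iff.mp hw).le
  have h1 : (1 : ℝ) ≤ ((n + κ).factorial : ℝ) := by exact_mod_cast Nat.factorial_pos _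
  have h2 : (0 : ℝ) < (n.factorial : ℝ) := by exact_mod_cast Nat.factorial_pos _
  rw [norm_div, norm_mul, norm_mul, norm_pow, norm_pow]
  simp only [Complex.norm_real, Real.norm_eq_abs, Complex.norm_natCast,
    Complex.ofReal_natCast]
  calc ‖w‖ ^ n * |y| ^ (n + κ) / (n.factorial * (n + κ).factorial)
      ≤ R ^ n * |y| ^ (n + κ) / (n.factorial * 1) := by gcongr
    _ = |y| ^ κ * ((R * |y|) ^ n / n.factorial) := by rw [mul_one, mul_pow, pow_add]; ring

theorem EbesC_ofReal (κ : ℕ) (δ y : ℝ) : EbesC κ (δ : ℂ) y = (Ebes κ δ y : ℂ) := by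
  rw [EbesC, Ebes, Complex.ofReal_tsum]
  push_cast
  rfl

theorem FbesC_ofReal (κ : ℕ) (a ζ : ℝ) : FbesC κ a (ζ : ℂ) = (Fbes κ a ζ : ℂ) := by
  rw [FbesC, Fbes, ← integral_complex_ofReal]
  push_cast
  rfl

theorem inv_pow_mul_exp_neg_div_le (n : ℕ) {a t : ℝ} (ha : 0 < a) (ht : 0 < t) :
    (t ^ n)⁻¹ * Real.exp (-a / t) ≤ n.factorial / a ^ n := by
  have h := Real.pow_div_factorial_le_exp (a / t) (by positivity) n
  rw [neg_div, Real.exp_neg, ← mul_inv, inv_le_comm₀ (by positivity) (by positivity), inv_div]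
  calc a ^ n / n.factorial = t ^ n * ((a / t) ^ n / n.factorial) := by
        rw [div_pow]
        field_simp
    _ ≤ t ^ n * Real.exp (a / t) := by gcongr

theorem norm_zpow_mul_exp_le (n : ℕ) {a t ε : ℝ} {ζ : ℂ} (ha : 0 < a) (ht : 0 < t)
    (hε : ε ≤ ζ.re) :
    ‖(t : ℂ) ^ (-(n : ℤ)) * Complex.exp (-(a : ℂ) / t - ζ * t)‖ ≤
      n.factorial / a ^ n * Real.exp (-ε * t) := by
  have hre : (-(a : ℂ) / t - ζ * t).re = -a / t + -ζ.re * t := by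
    rw [← Complex.ofReal_neg, ← Complex.ofReal_div]
    simp
    ring
  rw [norm_mul, Complex.norm_exp, hre, Real.exp_add, _root_.zpow_neg, zpow_natCast, norm_inv, norm_pow,
    Complex.norm_real, Real.norm_eq_abs, abs_of_pos ht, ← mul_assoc]
  gcongr
  exact inv_pow_mul_exp_neg_div_le n ha ht

theorem aestronglyMeasurable_zpow_mul_exp (m : ℤ) (a : ℝ) (ζ : ℂ) :
    AEStronglyMeasurable (fun t : ℝ => (t : ℂ) ^ m * Complex.exp (-(a : ℂ) / t - ζ * t))
      (volume.restrict (Set.Ioi 0)) := by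
  refine ContinuousOn.aestronglyMeasurable (fun t ht => ?_) measurableSet_Ioi
  have h0 : (t : ℂ) ≠ 0 := Complex.ofReal_ne_zero.mpr (ne_of_gt ht)
  refine ContinuousAt.continuousWithinAt ?_
  have hc : ContinuousAt (fun t : ℝ => (t : ℂ)) t := Complex.continuous_ofReal.continuousAt
  refine (hc.zpow₀ m (Or.inl h0)).mul (ContinuousAt.cexp ?_)
  exact (continuousAt_const.div hc h0).sub (continuousAt_const.mul hc)

theorem differentiableAt_FbesC (κ : ℕ) {a : ℝ} (ha : 0 < a) {ζ : ℂ} (hζ : 0 < ζ.re) :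
    DifferentiableAt ℂ (FbesC κ a) ζ := by
  set ε : ℝ := ζ.re / 2
  have hε : 0 < ε := half_pos hζ
  have hs : {z : ℂ | ε < z.re} ∈ nhds ζ :=
    (isOpen_lt continuous_const Complex.continuous_re).mem_nhds (half_lt_self hζ)
  have hexp : (-(κ : ℤ) - 1) = -((κ + 1 : ℕ) : ℤ) := by push_cast; ring
  have hint : ∀ C : ℝ, Integrable (fun t : ℝ => C * Real.exp (-ε * t))
      (volume.restrict (Set.Ioi 0)) := fun C => (exp_neg_integrableOn_Ioi 0 hε).const_mul C
  unfold FbesC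
  refine (hasDerivAt_integral_of_dominated_loc_of_deriv_le (μ := volume.restrict (Set.Ioi 0))
    (bound := fun t : ℝ => κ.factorial / a ^ κ * Real.exp (-ε * t))
    (F := fun ζ t => (t : ℂ) ^ (-(κ : ℤ) - 1) * Complex.exp (-(a : ℂ) / t - ζ * t))
    (F' := fun ζ t => -((t : ℂ) ^ (-(κ : ℤ)) * Complex.exp (-(a : ℂ) / t - ζ * t)))
    hs ?_ ?_ ?_ ?_ (hint _) ?_).2.differentiableAt
  · exact Filter.Eventually.of_forall fun z => aestronglyMeasurable_zpow_mul_exp _ _ _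
  · refine (hint ((κ + 1).factorial / a ^ (κ + 1))).mono'
      (aestronglyMeasurable_zpow_mul_exp _ _ _) ?_
    refine (ae_restrict_iff' measurableSet_Ioi).mpr (Filter.Eventually.of_forall fun t ht => ?_)
    rw [hexp]
    exact norm_zpow_mul_exp_le (κ + 1) ha ht (half_le_self hζ.le)
  · exact (aestronglyMeasurable_zpow_mul_exp _ _ _).neg
  · refine (ae_restrict_iff' measurableSet_Ioi).mpr
      (Filter.Eventually.of_forall fun t ht z hz => ?_)
    rw [norm_neg]
    exact norm_zpow_mul_exp_le κ ha ht (le_of_lt hz)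
  · refine (ae_restrict_iff' measurableSet_Ioi).mpr
      (Filter.Eventually.of_forall fun t ht z _ => ?_)
    have h0 : (t : ℂ) ≠ 0 := Complex.ofReal_ne_zero.mpr (ne_of_gt ht)
    have h1 := ((((hasDerivAt_id z).mul_const (t : ℂ)).const_sub
      (-(a : ℂ) / t)).cexp).const_mul ((t : ℂ) ^ (-(κ : ℤ) - 1))
    refine h1.congr_deriv ?_
    rw [zpow_sub_one₀ h0]
    simp only [id]
    field_simp

theorem coeff_eq_nodalWeight_mul_sum {K ι σ : Type*} [Field K] [Fintype ι]
    [DecidableEq ι] [Fintype σ] [DecidableEq σ] {x : ι → K} {d : σ → K} {ν : ℕ}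
    (hx : Function.Injective x) (hd : Function.Injective d) (hxd : ∀ i k, x i ≠ d k)
    (hcard : Fintype.card ι = Fintype.card σ + ν) {p : Polynomial K} (hp : p.degree < ν)
    {b : σ → K} {w : ι → K} (h : ∀ i, p.eval (x i) + ∑ k, b k / (x i - d k) = w i) (k : σ) :
    b k = Lagrange.nodalWeight univ d k * ∑ i, w i * (∏ l, (x i - d l)) *
      (Lagrange.nodalWeight univ x i * ∏ m ∈ univ.erase i, (d k - x m)) := by
  have h1 := congrArg (Polynomial.eval (d k))
    (mul_prod_erase_eq_sum_of_eval_add_sum_div_eq hx hxd hcard hp h)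
  rw [Polynomial.eval_add, Polynomial.eval_mul, Lagrange.eval_nodal_at_node (mem_univ k), mul_zero,
    zero_add, Polynomial.eval_finsetSum, sum_eq_single k, Polynomial.eval_mul, Polynomial.eval_C,
    Lagrange.interpolate_apply, Polynomial.eval_finsetSum] at h1
  · have h2 : Lagrange.nodalWeight univ d k ≠ 0 :=
      Lagrange.nodalWeight_ne_zero hd.injOn (mem_univ k)
    rw [← inv_mul_eq_iff_eq_mul₀ h2, mul_comm, Lagrange.nodalWeight_eq_eval_nodal_erase_inv,
      inv_inv, h1]
    refine sum_congr rfl fun i _ => ?_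
    rw [Polynomial.eval_mul, Polynomial.eval_C,
      Lagrange.eval_basis_not_at_node (mem_univ i) (hxd i k).symm, Lagrange.eval_nodal,
      ← mul_prod_erase univ _ (mem_univ i)]
    have h3 : d k - x i ≠ 0 := sub_ne_zero.mpr (hxd i k).symm
    field_simp
  · intro l _ hl
    rw [Polynomial.eval_mul, Lagrange.eval_nodal_at_node (mem_erase.mpr ⟨hl.symm, mem_univ k⟩),
      mul_zero]
  · exact fun hk => absurd (mem_univ k) hk

theorem sum_fin_add_comm {M : Type*} [AddCommMonoid M] {N ν : ℕ} (f : Fin (N + ν) → M) :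
    ∑ c, f c = ∑ c : Fin ν, f ⟨c, by omega⟩ + ∑ k : Fin N, f ⟨ν + k, by omega⟩ := by
  rw [← (finCongr (add_comm ν N)).sum_comp f, Fin.sum_univ_add]
  rfl

section CauchyVandermonde

variable {K : Type*} [Field K] {N ν : ℕ} {x : Fin (N + ν) → K} {d s : Fin N → K}
  {A : Matrix (Fin (N + ν)) (Fin (N + ν)) K}

theorem mulVec_cauchyVandermonde
    (hA₁ : ∀ i (c : Fin ν), A i ⟨c, by omega⟩ = x i ^ (c : ℕ))
    (hA₂ : ∀ i (k : Fin N), A i ⟨ν + k, by omega⟩ = s k / (x i - d k))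
    (v : Fin (N + ν) → K) (i : Fin (N + ν)) :
    (∑ c : Fin ν, Polynomial.C (v ⟨c, by omega⟩) * Polynomial.X ^ (c : ℕ)).eval (x i) +
      ∑ k : Fin N, s k * v ⟨ν + k, by omega⟩ / (x i - d k) = (A *ᵥ v) i := by
  rw [mulVec, dotProduct, sum_fin_add_comm, Polynomial.eval_finsetSum]
  congr 1
  · refine sum_congr rfl fun c _ => ?_
    rw [hA₁, Polynomial.eval_mul, Polynomial.eval_C, Polynomial.eval_pow, Polynomial.eval_X,
      mul_comm]
  · refine sum_congr rfl fun k _ => ?_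
    rw [hA₂, div_mul_eq_mul_div]

theorem isUnit_det_cauchyVandermonde
    (hx : Function.Injective x) (hd : Function.Injective d) (hxd : ∀ i k, x i ≠ d k)
    (hs : ∀ k, s k ≠ 0)
    (hA₁ : ∀ i (c : Fin ν), A i ⟨c, by omega⟩ = x i ^ (c : ℕ))
    (hA₂ : ∀ i (k : Fin N), A i ⟨ν + k, by omega⟩ = s k / (x i - d k)) :
    IsUnit A.det := by
  rw [isUnit_iff_ne_zero]
  intro hdet
  obtain ⟨v, hv0, hv⟩ := Matrix.exists_mulVec_eq_zero_iff.mpr hdet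
  have hcard : Fintype.card (Fin (N + ν)) = Fintype.card (Fin N) + ν := by simp
  have hp := Polynomial.degree_sum_fin_lt fun c : Fin ν => v ⟨c, by omega⟩
  have h := fun i => (mulVec_cauchyVandermonde hA₁ hA₂ v i).trans (congrFun hv i)
  have hb : ∀ k : Fin N, s k * v ⟨ν + k, by omega⟩ = 0 := fun k => by
    rw [coeff_eq_nodalWeight_mul_sum hx hd hxd hcard hp h k]
    simp
  have hP := mul_prod_erase_eq_sum_of_eval_add_sum_div_eq hx hxd hcard hp h
  simp only [hb, map_zero, zero_mul, sum_const_zero, add_zero, Pi.zero_apply] at hP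
  have hp0 := (mul_eq_zero.mp (hP.trans (map_zero (Lagrange.interpolate univ x)))).resolve_right
    Lagrange.nodal_ne_zero
  refine hv0 (funext fun c => ?_)
  rcases lt_or_ge (c : ℕ) ν with hc | hc
  · have h1 := congrArg (fun p => Polynomial.coeff p c) hp0
    simp only [Polynomial.finsetSum_coeff, Polynomial.coeff_C_mul, Polynomial.coeff_X_pow,
      Polynomial.coeff_zero] at h1
    rw [sum_eq_single ⟨c, hc⟩ (fun a _ ha => by
      rw [if_neg fun hca => ha (Fin.ext hca.symm), mul_zero]) (by simp)] at h1
    simpa using h1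
  · have h1 := (mul_eq_zero.mp (hb ⟨c - ν, by omega⟩)).resolve_left (hs _)
    exact (congrArg v (Fin.ext (Nat.add_sub_cancel' hc).symm)).trans h1

theorem inv_cauchyVandermonde_apply
    (hx : Function.Injective x) (hd : Function.Injective d) (hxd : ∀ i k, x i ≠ d k)
    (hs : ∀ k, s k ≠ 0)
    (hA₁ : ∀ i (c : Fin ν), A i ⟨c, by omega⟩ = x i ^ (c : ℕ))
    (hA₂ : ∀ i (k : Fin N), A i ⟨ν + k, by omega⟩ = s k / (x i - d k))
    (k : Fin N) (j : Fin (N + ν)) :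
    s k * A⁻¹ ⟨ν + k, by omega⟩ j = Lagrange.nodalWeight univ d k *
      ((∏ l, (x j - d l)) * (Lagrange.nodalWeight univ x j * ∏ m ∈ univ.erase j, (d k - x m))) := by
  have hcard : Fintype.card (Fin (N + ν)) = Fintype.card (Fin N) + ν := by simp
  have hp := Polynomial.degree_sum_fin_lt fun c : Fin ν => A⁻¹ ⟨c, by omega⟩ j
  have hcol : A *ᵥ (fun c => A⁻¹ c j) = fun i => (1 : Matrix _ _ K) i j := by
    rw [← A.mul_nonsing_inv (isUnit_det_cauchyVandermonde hx hd hxd hs hA₁ hA₂)]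
    rfl
  have h := fun i =>
    (mulVec_cauchyVandermonde hA₁ hA₂ (fun c => A⁻¹ c j) i).trans (congrFun hcol i)
  rw [coeff_eq_nodalWeight_mul_sum hx hd hxd hcard hp h k, sum_eq_single j]
  · rw [one_apply_eq, one_mul]
  · intro i _ hij
    rw [one_apply_ne hij, zero_mul, zero_mul]
  · exact fun hj => absurd (mem_univ j) hj

end CauchyVandermonde

theorem circleIntegral_circleIntegral_div_prod {ι σ : Type*} [Fintype ι] [DecidableEq ι]
    [Nonempty ι] [Fintype σ] [DecidableEq σ] [Nonempty σ] {x : ι → ℂ} {d : σ → ℂ}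
    (hx : Function.Injective x) (hd : Function.Injective d) {c₁ c₂ : ℂ} {R₁ R₂ : ℝ}
    {f g : ℂ → ℂ} (hf : DifferentiableOn ℂ f (Metric.closedBall c₁ R₁))
    (hg : DifferentiableOn ℂ g (Metric.closedBall c₂ R₂))
    (hd₁ : ∀ k, d k ∈ Metric.ball c₁ R₁) (hx₂ : ∀ j, x j ∈ Metric.ball c₂ R₂)
    (hdisj : Disjoint (Metric.closedBall c₁ R₁) (Metric.closedBall c₂ R₂)) :
    (∮ η in C(c₁, R₁), ∮ ζ in C(c₂, R₂), f η * g ζ / (η - ζ) *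
      (∏ l, (ζ - d l) / (η - d l)) * ∏ m, (η - x m) / (ζ - x m)) =
    (2 * Real.pi * Complex.I) ^ 2 * ∑ k, ∑ j, f (d k) * g (x j) *
      (Lagrange.nodalWeight univ d k * ((∏ l, (x j - d l)) *
        (Lagrange.nodalWeight univ x j * ∏ m ∈ univ.erase j, (d k - x m)))) := by
  have hR₁ : 0 < R₁ := dist_nonneg.trans_lt (hd₁ (Classical.arbitrary σ))
  have hne : ∀ η ∈ Metric.closedBall c₁ R₁, ∀ ζ ∈ Metric.closedBall c₂ R₂, η - ζ ≠ 0 :=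
    fun η hη ζ hζ => sub_ne_zero.mpr (Set.disjoint_left.mp hdisj hη <| · ▸ hζ)
  have hinner : Set.EqOn
      (fun η => ∮ ζ in C(c₂, R₂), f η * g ζ / (η - ζ) *
        (∏ l, (ζ - d l) / (η - d l)) * ∏ m, (η - x m) / (ζ - x m))
      (fun η => 2 * Real.pi * Complex.I * ((f η * ∑ j, g (x j) * ((∏ l, (x j - d l)) *
        (Lagrange.nodalWeight univ x j * ∏ m ∈ univ.erase j, (η - x m)))) / ∏ l, (η - d l)))
      (Metric.sphere c₁ R₁) := by
    intro η hη
    have hη' := Metric.sphere_subset_closedBall hη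
    have hsplit : ∀ ζ, f η * g ζ / (η - ζ) * (∏ l, (ζ - d l) / (η - d l)) *
        ∏ m, (η - x m) / (ζ - x m) = f η * (∏ m, (η - x m)) / (∏ l, (η - d l)) *
        (g ζ / (η - ζ) * (∏ l, (ζ - d l)) / ∏ m, (ζ - x m)) := fun ζ => by
      rw [prod_div_distrib, prod_div_distrib]
      ring
    simp only [hsplit]
    rw [circleIntegral.integral_const_mul, circleIntegral_div_prod hx _ hx₂]
    · rw [mul_left_comm, mul_div_right_comm (f η), mul_div_right_comm (f η), mul_assoc (f η / _),
        mul_sum]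
      congr 2
      refine sum_congr rfl fun j _ => ?_
      have h1 := hne η hη' (x j) (Metric.ball_subset_closedBall (hx₂ j))
      rw [← mul_prod_erase univ _ (mem_univ j)]
      field_simp
    · refine DifferentiableOn.mul (hg.div (by fun_prop) fun ζ hζ => hne η hη' ζ hζ) ?_
      fun_prop
  rw [circleIntegral.integral_congr hR₁.le hinner, circleIntegral.integral_const_mul,
    circleIntegral_div_prod hd _ hd₁]
  · rw [← mul_assoc, ← sq]
    congr 1
    refine sum_congr rfl fun k _ => ?_
    rw [mul_sum, sum_mul]
    refine sum_congr rfl fun j _ => ?_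
    ring
  · refine hf.mul ?_
    fun_prop

end CoupledKernel

/-- Theorem 1.3: double contour integral representation of the finite-`N` correlation
kernel of the ensemble of two correlated coupled matrices. -/
theorem statement2
    (N ν κ : ℕ) (hN : 1 ≤ N) (α : ℝ) (hα : 0 < α)
    (δ : Fin N → ℝ) (hδ0 : ∀ k, 0 < δ k) (hδinj : Function.Injective δ)
    (q : Fin (N + ν) → ℝ) (hq0 : ∀ i, 0 < q i) (hqinj : Function.Injective q)
    (hcond : ∀ i k, 0 < α * q i - δ k)
    (A : Matrix (Fin (N + ν)) (Fin (N + ν)) ℝ)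
    (hA : ∀ i c, A i c =
      if h : (c : ℕ) < ν then (α * q i) ^ (c : ℕ)
      else Real.sqrt (δ ⟨(c : ℕ) - ν, by have := c.isLt; omega⟩) ^ κ
            / (2 * α ^ κ * (α * q i - δ ⟨(c : ℕ) - ν, by have := c.isLt; omega⟩))) :
    IsUnit A.det ∧
    ∀ c₁ c₂ R₁ R₂ : ℝ, 0 < R₁ → 0 < R₂ →
      (∀ k, |δ k - c₁| < R₁) → (∀ k, R₂ < |δ k - c₂|) →
      (∀ j, |α * q j - c₂| < R₂) → (∀ j, R₁ < |α * q j - c₁|) →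
      0 < c₂ - R₂ → R₁ + R₂ < |c₁ - c₂| →
      ∀ y₁ y₂ : ℝ, 0 < y₁ → 0 < y₂ →
      ((∑ k : Fin N, ∑ j : Fin (N + ν),
          Real.sqrt (δ k) ^ κ * Ebes κ (δ k) y₁
            * A⁻¹ ⟨ν + (k : ℕ), by have := k.isLt; omega⟩ j
            * (2 * α ^ κ)⁻¹ * Fbes κ y₂ (α * q j) : ℝ) : ℂ)
      = ((2 * (Real.pi : ℂ) * Complex.I) ^ 2)⁻¹ *
          (∮ η in C((c₁ : ℂ), R₁), ∮ ζ in C((c₂ : ℂ), R₂),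
            EbesC κ η y₁ * FbesC κ y₂ ζ / (η - ζ)
              * (∏ l : Fin N, (ζ - (δ l : ℂ)) / (η - (δ l : ℂ)))
              * ∏ m : Fin (N + ν),
                  (η - ((α * q m : ℝ) : ℂ)) / (ζ - ((α * q m : ℝ) : ℂ))) := by

  have hx : Function.Injective fun i => α * q i := (mul_right_injective₀ hα.ne').comp hqinj
  have hxd : ∀ i k, α * q i ≠ δ k := fun i k => (sub_pos.mp (hcond i k)).ne'
  have hs : ∀ k, Real.sqrt (δ k) ^ κ / (2 * α ^ κ) ≠ 0 := fun k => by
    have := Real.sqrt_pos.mpr (hδ0 k)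
    positivity
  have hA₁ : ∀ i (c : Fin ν), A i ⟨c, by omega⟩ = (α * q i) ^ (c : ℕ) := fun i c => by
    rw [hA, dif_pos c.isLt]
  have hA₂ : ∀ i (k : Fin N), A i ⟨ν + k, by omega⟩ =
      Real.sqrt (δ k) ^ κ / (2 * α ^ κ) / (α * q i - δ k) := fun i k => by
    rw [hA, dif_neg (by simp), div_div]
    simp
  refine ⟨CoupledKernel.isUnit_det_cauchyVandermonde hx hδinj hxd hs hA₁ hA₂, ?_⟩
  intro c₁ c₂ R₁ R₂ _ _ hδ₁ _ hq₂ _ hpos hdist y₁ y₂ _ hy₂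
  have : NeZero N := ⟨by omega⟩
  have hinv := CoupledKernel.inv_cauchyVandermonde_apply hx hδinj hxd hs hA₁ hA₂
  have hmem : ∀ {a c R : ℝ}, |a - c| < R → (a : ℂ) ∈ Metric.ball (c : ℂ) R := fun h => by
    rwa [Metric.mem_ball, Complex.dist_eq, ← Complex.ofReal_sub, Complex.norm_real,
      Real.norm_eq_abs]
  have hg : DifferentiableOn ℂ (FbesC κ y₂) (Metric.closedBall (c₂ : ℂ) R₂) := fun ζ hζ => by
    refine (CoupledKernel.differentiableAt_FbesC κ hy₂ ?_).differentiableWithinAt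
    have h1 := (Complex.abs_re_le_norm (ζ - c₂)).trans (mem_closedBall_iff_norm.mp hζ)
    rw [Complex.sub_re, Complex.ofReal_re] at h1
    linarith [(abs_le.mp h1).1]
  rw [CoupledKernel.circleIntegral_circleIntegral_div_prod
    (x := fun j => ((α * q j : ℝ) : ℂ)) (d := fun k => (δ k : ℂ))
    (f := fun η => EbesC κ η y₁) (g := FbesC κ y₂)
    (Complex.ofReal_injective.comp hx) (Complex.ofReal_injective.comp hδinj)
    (CoupledKernel.differentiable_EbesC κ y₁).differentiableOn hg
    (fun k => hmem (hδ₁ k)) (fun j => hmem (hq₂ j))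
    (Metric.closedBall_disjoint_closedBall (by
      rwa [Complex.dist_eq, ← Complex.ofReal_sub, Complex.norm_real, Real.norm_eq_abs])),
    inv_mul_cancel_left₀ (pow_ne_zero 2 Complex.two_pi_I_ne_zero), Complex.ofReal_sum]
  refine sum_congr rfl fun k _ => ?_
  rw [Complex.ofReal_sum]
  refine sum_congr rfl fun j _ => ?_
  rw [show Real.sqrt (δ k) ^ κ * Ebes κ (δ k) y₁ * A⁻¹ ⟨ν + (k : ℕ), by omega⟩ j *
      (2 * α ^ κ)⁻¹ * Fbes κ y₂ (α * q j) = Ebes κ (δ k) y₁ * Fbes κ y₂ (α * q j) *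
      (Real.sqrt (δ k) ^ κ / (2 * α ^ κ) * A⁻¹ ⟨ν + (k : ℕ), by omega⟩ j) by ring, hinv,
    CoupledKernel.EbesC_ofReal, CoupledKernel.FbesC_ofReal]
  simp only [Lagrange.nodalWeight]
  push_cast
  rfl
end
end

section
/- Let N ≥ 1 and ν ≥ 0 be integers and M = N+ν. Let q_1,…,q_M be real numbers, let ψ_1,…,ψ_N and φ_1,…,φ_M be measurable real-valued functions on (0,∞) such that t ↦ φ_i(t)ψ_m(t) is integrable on (0,∞) for all i,m. Let A be the M×M matrix with entries A_{i,k} = q_i^{k−1} for 1 ≤ k ≤ ν and A_{i,ν+m} = ∫_0^∞ φ_i(t) ψ_m(t) dt for 1 ≤ m ≤ N, and assume det A ≠ 0; set C = A^{−1}. Define the kernel K_N(x,y) = Σ_{m=1}^N Σ_{j=1}^M ψ_m(x) C_{ν+m, j} φ_j(y), and define P : (0,∞)^N → ℝ by P(y_1,…,y_N) = (N!·det A)^{−1} · det[ψ_i(y_j)]_{i,j=1}^N · det[D(y)], where D(y) is the M×M matrix whose i-th row is (1, q_i, …, q_i^{ν−1}, φ_i(y_1), …, φ_i(y_N)). Then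 for every 1 ≤ k ≤ N and all y_1,…,y_k > 0, (N!/(N−k)!) · ∫_{(0,∞)^{N−k}} P(y_1,…,y_N) dy_{k+1} ⋯ dy_N = det[K_N(y_i, y_j)]_{i,j=1}^k. In particular (k = N), N!·P(y_1,…,y_N) = det[K_N(y_i,y_j)]_{i,j=1}^N. -/
open MeasureTheory Matrix Finset

noncomputable section

section DeterminantalKernel

variable {X κ : Type*} [Fintype κ]

/-- The determinant of a finite-rank kernel `∑ a, ψ a x * χ a y` evaluated at points `w`. -/
def kernelDet {ι : Type*} [Fintype ι] [DecidableEq ι] (ψ χ : κ → X → ℝ) (w : ι → X) : ℝ :=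
  (Matrix.of fun i j : ι => ∑ a, ψ a (w i) * χ a (w j)).det

lemma kernelDet_comp_bijective {ι ι' : Type*} [Fintype ι] [DecidableEq ι] [Fintype ι']
    [DecidableEq ι'] (ψ χ : κ → X → ℝ) (w : ι → X) (e : ι' → ι) (he : Function.Bijective e) :
    kernelDet ψ χ (w ∘ e) = kernelDet ψ χ w :=
  Matrix.det_submatrix_equiv_self (Equiv.ofBijective e he)
    (Matrix.of fun i j : ι => ∑ a, ψ a (w i) * χ a (w j))

lemma kernelDet_eq_sum {ι : Type*} [Fintype ι] [DecidableEq ι] [DecidableEq κ]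
    (ψ χ : κ → X → ℝ) (w : ι → X) :
    kernelDet ψ χ w = ∑ f : ι → κ, (∏ i, ψ (f i) (w i)) *
      (Matrix.of fun i j => χ (f i) (w j)).det := by
  have h := (Matrix.detRowAlternating (R := ℝ) (n := ι)).toMultilinearMap.map_sum
    (fun i (a : κ) => (fun j => ψ a (w i) * χ a (w j)))
  have h1 : kernelDet ψ χ w = (Matrix.detRowAlternating (R := ℝ) (n := ι)).toMultilinearMap
      (fun i => ∑ a : κ, (fun j => ψ a (w i) * χ a (w j))) := by
    unfold kernelDet
    change Matrix.det _ = Matrix.det _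
    congr 1
    ext i j
    simp
  rw [h1, h]
  refine Finset.sum_congr rfl fun f _ => ?_
  exact Matrix.det_mul_column (fun i => ψ (f i) (w i)) (Matrix.of fun i j => χ (f i) (w j))

variable [MeasurableSpace X] (μ : Measure X)

lemma integrable_kernelDet_sumElim [SigmaFinite μ] {ι ι' : Type*} [Fintype ι] [DecidableEq ι]
    [Fintype ι'] [DecidableEq ι'] (ψ χ : κ → X → ℝ) (hint : ∀ a b, Integrable (fun t => ψ a t * χ b t) μ)
    (y : ι → X) :
    Integrable (fun z : ι' → X => kernelDet ψ χ (Sum.elim y z)) (Measure.pi fun _ => μ) := by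
  classical
  simp only [kernelDet_eq_sum]
  refine integrable_finsetSum _ fun f _ => ?_
  simp only [Matrix.det_apply', Finset.mul_sum]
  refine integrable_finsetSum _ fun σ _ => ?_
  have h : (fun z : ι' → X => (∏ i, ψ (f i) (Sum.elim y z i)) *
      (((Equiv.Perm.sign σ : ℤ) : ℝ) *
        ∏ i, (Matrix.of fun i j => χ (f i) (Sum.elim y z j)) (σ i) i)) =
      fun z => (((Equiv.Perm.sign σ : ℤ) : ℝ) *
        ∏ i, (ψ (f (.inl i)) (y i) * χ (f (σ (.inl i))) (y i))) *
        ∏ i, (ψ (f (.inr i)) (z i) * χ (f (σ (.inr i))) (z i)) := by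
    funext z
    simp only [Fintype.prod_sum_type, Matrix.of_apply, Sum.elim_inl, Sum.elim_inr,
      Finset.prod_mul_distrib]
    ring
  rw [h]
  exact (Integrable.fintype_prod fun i => hint _ _).const_mul _

lemma sum_det_bordered [DecidableEq κ] {k : ℕ} (g : Fin k → κ) (M : κ → Fin k → ℝ) :
    ∑ a, (Matrix.of fun i j : Fin (k + 1) =>
      (Fin.cons (if a = (Fin.cons a g : Fin (k + 1) → κ) i then 1 else 0)
        (M ((Fin.cons a g : Fin (k + 1) → κ) i)) : Fin (k + 1) → ℝ) j).det =
      ((Fintype.card κ : ℝ) - k) * (Matrix.of fun i j => M (g i) j).det := by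
  by_cases hg : Function.Injective g
  · have h : ∀ a, (Matrix.of fun i j : Fin (k + 1) =>
        (Fin.cons (if a = (Fin.cons a g : Fin (k + 1) → κ) i then 1 else 0)
          (M ((Fin.cons a g : Fin (k + 1) → κ) i)) : Fin (k + 1) → ℝ) j).det =
        (Matrix.of fun i j => M (g i) j).det -
          if a ∈ univ.image g then (Matrix.of fun i j => M (g i) j).det else 0 := by
      intro a
      split_ifs with ha
      · obtain ⟨i, -, rfl⟩ := Finset.mem_image.1 ha
        rw [sub_self]
        refine Matrix.det_zero_of_row_eq (i := 0) (j := i.succ) (Fin.succ_ne_zero i).symm ?_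
        ext j
        simp
      · have hne : ∀ i, a ≠ g i := fun i h => ha (by simp [h])
        rw [Matrix.det_succ_column_zero, Fin.sum_univ_succ]
        simp [hne]
        rfl
    simp only [h, Finset.sum_sub_distrib, Finset.sum_ite_mem, Finset.univ_inter,
      Finset.sum_const, Finset.card_image_of_injective _ hg, Finset.card_univ,
      Fintype.card_fin, nsmul_eq_mul]
    ring
  · simp only [Function.Injective, not_forall] at hg
    obtain ⟨i, i', h, hne⟩ := hg
    rw [Matrix.det_zero_of_row_eq hne (by ext j; simp [h]), mul_zero]
    refine Finset.sum_eq_zero fun a _ => ?_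
    refine Matrix.det_zero_of_row_eq (i := i.succ) (j := i'.succ)
      (fun hh => hne (Fin.succ_injective _ hh)) ?_
    ext j
    simp [h]

lemma integral_kernelDet_cons [DecidableEq κ] (ψ χ : κ → X → ℝ)
    (hint : ∀ a b, Integrable (fun t => ψ a t * χ b t) μ)
    (horth : ∀ a b, ∫ t, ψ a t * χ b t ∂μ = if a = b then 1 else 0)
    {k : ℕ} (y : Fin k → X) :
    ∫ t, kernelDet ψ χ (Fin.cons t y : Fin (k + 1) → X) ∂μ =
      ((Fintype.card κ : ℝ) - k) * kernelDet ψ χ y := by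
  have h : ∀ t, kernelDet ψ χ (Fin.cons t y : Fin (k + 1) → X) =
      ∑ f : Fin (k + 1) → κ, ∑ i : Fin (k + 1), ((∏ i, ψ (f (Fin.succ i)) (y i)) *
        ((-1) ^ (i : ℕ) * (Matrix.of fun i' j => χ (f (i.succAbove i')) (y j)).det)) *
          (ψ (f 0) t * χ (f i) t) := by
    intro t
    rw [kernelDet_eq_sum]
    refine Finset.sum_congr rfl fun f _ => ?_
    rw [Matrix.det_succ_column_zero, Fin.prod_univ_succ, Finset.mul_sum]
    refine Finset.sum_congr rfl fun i _ => ?_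
    have hs : ((Matrix.of fun i j => χ (f i) ((Fin.cons t y : Fin (k + 1) → X) j)).submatrix
        i.succAbove Fin.succ) = Matrix.of fun i' j => χ (f (i.succAbove i')) (y j) := by
      ext i' j
      simp
    rw [hs]
    simp only [Fin.cons_zero, Fin.cons_succ, Matrix.of_apply]
    ring
  simp only [h]
  rw [integral_finsetSum _ fun f _ => integrable_finsetSum _ fun i _ =>
    (hint _ _).const_mul _]
  have h2 : ∀ f : Fin (k + 1) → κ, ∫ t, ∑ i : Fin (k + 1), ((∏ i, ψ (f (Fin.succ i)) (y i)) *
        ((-1) ^ (i : ℕ) * (Matrix.of fun i' j => χ (f (i.succAbove i')) (y j)).det)) *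
          (ψ (f 0) t * χ (f i) t) ∂μ = (∏ i, ψ (f (Fin.succ i)) (y i)) *
      (Matrix.of fun i j : Fin (k + 1) => (Fin.cons (if f 0 = f i then 1 else 0)
        (fun j => χ (f i) (y j)) : Fin (k + 1) → ℝ) j).det := by
    intro f
    rw [integral_finsetSum _ fun i _ => (hint _ _).const_mul _, Matrix.det_succ_column_zero,
      Finset.mul_sum]
    refine Finset.sum_congr rfl fun i _ => ?_
    rw [integral_const_mul, horth]
    have hs : ((Matrix.of fun i j : Fin (k + 1) => (Fin.cons (if f 0 = f i then 1 else 0)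
        (fun j => χ (f i) (y j)) : Fin (k + 1) → ℝ) j).submatrix
        i.succAbove Fin.succ) = Matrix.of fun i' j => χ (f (i.succAbove i')) (y j) := by
      ext i' j
      simp
    rw [hs]
    simp only [Fin.cons_zero, Matrix.of_apply]
    ring
  simp only [h2]
  rw [← (Fin.consEquiv fun _ : Fin (k + 1) => κ).sum_comp, Fintype.sum_prod_type_right,
    kernelDet_eq_sum, Finset.mul_sum]
  refine Finset.sum_congr rfl fun g _ => ?_
  have h3 := sum_det_bordered g (fun a j => χ a (y j))
  simp only [Fin.consEquiv_apply, Fin.cons_succ, Fin.cons_zero]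
  rw [← Finset.mul_sum, h3]
  ring

lemma integral_kernelDet_sumElim [SigmaFinite μ] [DecidableEq κ] (ψ χ : κ → X → ℝ)
    (hint : ∀ a b, Integrable (fun t => ψ a t * χ b t) μ)
    (horth : ∀ a b, ∫ t, ψ a t * χ b t ∂μ = if a = b then 1 else 0)
    (n : ℕ) : ∀ (k : ℕ) (_ : k + n = Fintype.card κ) (y : Fin k → X),
    ∫ z : Fin n → X, kernelDet ψ χ (Sum.elim y z) ∂(Measure.pi fun _ => μ) =
      (n.factorial : ℝ) * kernelDet ψ χ y := by
  induction n with
  | zero =>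
    intro k _ y
    have h : ∀ z : Fin 0 → X, kernelDet ψ χ (Sum.elim y z) = kernelDet ψ χ y := by
      intro z
      have hb : Function.Bijective (Sum.inl : Fin k → Fin k ⊕ Fin 0) :=
        (Equiv.sumEmpty (Fin k) (Fin 0)).symm.bijective
      exact (kernelDet_comp_bijective ψ χ (Sum.elim y z) Sum.inl hb).symm
    simp [h, Measure.real]
  | succ n ih =>
    intro k hk y
    have hmp := (measurePreserving_piFinSuccAbove (fun _ : Fin (n + 1) => μ) 0).symm
    have hcons : ∀ p : X × (Fin n → X), kernelDet ψ χ (Sum.elim y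
        ((MeasurableEquiv.piFinSuccAbove (fun _ : Fin (n + 1) => X) 0).symm p)) =
        kernelDet ψ χ (Sum.elim (Fin.cons p.1 y : Fin (k + 1) → X) p.2) := by
      rintro ⟨t, z⟩
      let e : Fin (k + 1) ⊕ Fin n → Fin k ⊕ Fin (n + 1) :=
        Sum.elim (Fin.cons (Sum.inr 0) Sum.inl) (Sum.inr ∘ Fin.succ)
      have he : Function.Bijective e := by
        rw [Fintype.bijective_iff_surjective_and_card]
        constructor
        · rintro (i | i)
          · exact ⟨.inl i.succ, by simp [e]⟩
          · refine Fin.cases ⟨.inl 0, by simp [e]⟩ (fun j => ⟨.inr j, by simp [e]⟩) i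
        · simp
          ring
      rw [← kernelDet_comp_bijective ψ χ _ e he]
      congr 1
      funext i
      rcases i with i | i
      · refine Fin.cases ?_ (fun j => ?_) i <;> simp [e, MeasurableEquiv.piFinSuccAbove]
      · simp [e, MeasurableEquiv.piFinSuccAbove]
    have hI := (hmp.integrable_comp_emb (MeasurableEquiv.measurableEmbedding _)).2
      (integrable_kernelDet_sumElim (ι' := Fin (n + 1)) μ ψ χ hint y)
    rw [← hmp.integral_comp (MeasurableEquiv.measurableEmbedding _)]
    simp only [Function.comp_def, hcons] at hI ⊢
    rw [integral_prod _ hI]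
    simp only [ih (k + 1) (by omega)]
    rw [integral_const_mul, integral_kernelDet_cons μ ψ χ hint horth, ← hk]
    push_cast [Nat.factorial_succ]
    ring

end DeterminantalKernel

/-- The splitting of `Fin (N + ν)` into its first `ν` and last `N` indices. -/
def finTailEquiv (N ν : ℕ) : Fin ν ⊕ Fin N ≃ Fin (N + ν) :=
  finSumFinEquiv.trans (finCongr (Nat.add_comm ν N))

lemma finTailEquiv_inl (N ν : ℕ) (i : Fin ν) : (finTailEquiv N ν (.inl i) : ℕ) = i := by
  simp [finTailEquiv]

lemma finTailEquiv_inr (N ν : ℕ) (i : Fin N) : (finTailEquiv N ν (.inr i) : ℕ) = ν + i := by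
  simp [finTailEquiv, Nat.add_comm]

/-- If `A` and `D` share their first `ν` columns, then `det D / det A` is the determinant of the
lower right block of `A⁻¹ * D`. -/
lemma inv_det_mul_det_of_shared_columns {N ν : ℕ} (A D : Matrix (Fin (N + ν)) (Fin (N + ν)) ℝ)
    (hdet : A.det ≠ 0)
    (h : ∀ i (c : Fin ν), D i (finTailEquiv N ν (.inl c)) = A i (finTailEquiv N ν (.inl c))) :
    A.det⁻¹ * D.det = (Matrix.of fun m l : Fin N =>
      (A⁻¹ * D) (finTailEquiv N ν (.inr m)) (finTailEquiv N ν (.inr l))).det := by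
  have hu : IsUnit A.det := hdet.isUnit
  have hcol : ∀ r (c : Fin ν), (A⁻¹ * D) r (finTailEquiv N ν (.inl c)) =
      (1 : Matrix (Fin (N + ν)) (Fin (N + ν)) ℝ) r (finTailEquiv N ν (.inl c)) := by
    intro r c
    rw [← Matrix.nonsing_inv_mul A hu]
    simp only [Matrix.mul_apply, h]
  have hb : (A⁻¹ * D).submatrix (finTailEquiv N ν) (finTailEquiv N ν) =
      Matrix.fromBlocks 1 (Matrix.of fun m l =>
        (A⁻¹ * D) (finTailEquiv N ν (.inl m)) (finTailEquiv N ν (.inr l))) 0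
        (Matrix.of fun m l =>
          (A⁻¹ * D) (finTailEquiv N ν (.inr m)) (finTailEquiv N ν (.inr l))) := by
    ext r c
    rcases r with r | r <;> rcases c with c | c <;>
      simp [hcol, Matrix.one_apply]
  have hd := Matrix.det_submatrix_equiv_self (finTailEquiv N ν) (A⁻¹ * D)
  rw [hb, Matrix.det_fromBlocks_zero₂₁, Matrix.det_one, one_mul] at hd
  rw [hd, Matrix.det_mul, Matrix.det_nonsing_inv, Ring.inverse_eq_inv']

/-- Proposition 3.1: the biorthogonal-type joint density forms a determinantal point
process; its `k`-point correlation functions are `k×k` determinants of the kernel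
built from the inverse of the Gram-type matrix `A`. -/
theorem statement6
    (N ν : ℕ) (hN : 1 ≤ N)
    (q : Fin (N + ν) → ℝ)
    (ψ : Fin N → ℝ → ℝ) (φ : Fin (N + ν) → ℝ → ℝ)
    (hψ : ∀ m, Measurable (ψ m)) (hφ : ∀ i, Measurable (φ i))
    (hint : ∀ i m, IntegrableOn (fun t => φ i t * ψ m t) (Set.Ioi 0))
    (A : Matrix (Fin (N + ν)) (Fin (N + ν)) ℝ)
    (hA : ∀ i c, A i c =
      if h : (c : ℕ) < ν then q i ^ (c : ℕ)
      else ∫ t in Set.Ioi (0 : ℝ),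
        φ i t * ψ ⟨(c : ℕ) - ν, by have := c.isLt; omega⟩ t)
    (hdet : A.det ≠ 0)
    (K : ℝ → ℝ → ℝ)
    (hK : ∀ x y, K x y = ∑ m : Fin N, ∑ j : Fin (N + ν),
      ψ m x * A⁻¹ ⟨ν + (m : ℕ), by have := m.isLt; omega⟩ j * φ j y)
    (P : (Fin N → ℝ) → ℝ)
    (hP : ∀ y, P y = ((N.factorial : ℝ) * A.det)⁻¹
      * (Matrix.of fun i j : Fin N => ψ i (y j)).det
      * (Matrix.of fun i c : Fin (N + ν) =>
          if h : (c : ℕ) < ν then q i ^ (c : ℕ)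
          else φ i (y ⟨(c : ℕ) - ν, by have := c.isLt; omega⟩)).det) :
    ∀ k : ℕ, 1 ≤ k → ∀ hk : k ≤ N, ∀ y : Fin k → ℝ, (∀ i, 0 < y i) →
      ((N.factorial : ℝ) / ((N - k).factorial : ℝ))
        * ∫ z in (Set.univ.pi fun _ : Fin (N - k) => Set.Ioi (0 : ℝ)),
            P (fun i => if h : (i : ℕ) < k then y ⟨(i : ℕ), h⟩
                        else z ⟨(i : ℕ) - k, by have := i.isLt; omega⟩)
      = (Matrix.of fun i j : Fin k => K (y i) (y j)).det := by
  intro k _ hk y _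
  let χ : Fin N → ℝ → ℝ := fun m t => ∑ j, A⁻¹ (finTailEquiv N ν (.inr m)) j * φ j t
  have hidx : ∀ m : Fin N, (⟨ν + (m : ℕ), by have := m.isLt; omega⟩ : Fin (N + ν)) =
      finTailEquiv N ν (.inr m) := fun m => Fin.ext (finTailEquiv_inr N ν m).symm
  have hKχ : ∀ x y, K x y = ∑ m, ψ m x * χ m y := by
    intro x y
    rw [hK]
    simp only [χ, Finset.mul_sum, hidx, mul_assoc]
  have hPK : ∀ w, P w = (N.factorial : ℝ)⁻¹ * kernelDet ψ χ w := by
    intro w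
    have h := inv_det_mul_det_of_shared_columns A (Matrix.of fun i c : Fin (N + ν) =>
          if h : (c : ℕ) < ν then q i ^ (c : ℕ)
          else φ i (w ⟨(c : ℕ) - ν, by have := c.isLt; omega⟩)) hdet (by
        intro i c
        have hc : (finTailEquiv N ν (.inl c) : ℕ) < ν := by
          rw [finTailEquiv_inl]; exact c.isLt
        rw [hA, Matrix.of_apply, dif_pos hc, dif_pos hc])
    have hblock : (Matrix.of fun m l : Fin N => (A⁻¹ * Matrix.of fun i c : Fin (N + ν) =>
          if h : (c : ℕ) < ν then q i ^ (c : ℕ)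
          else φ i (w ⟨(c : ℕ) - ν, by have := c.isLt; omega⟩))
          (finTailEquiv N ν (.inr m)) (finTailEquiv N ν (.inr l))) =
        Matrix.of fun m l => χ m (w l) := by
      ext m l
      simp [Matrix.mul_apply, χ, finTailEquiv_inr]
    rw [hblock] at h
    rw [hP, mul_inv, mul_assoc, mul_assoc, mul_left_comm A.det⁻¹, h,
      ← Matrix.det_transpose (Matrix.of fun i j : Fin N => ψ i (w j)), ← Matrix.det_mul]
    rfl
  have hprod : ∀ a b t, ψ a t * χ b t =
      ∑ j, A⁻¹ (finTailEquiv N ν (.inr b)) j * (φ j t * ψ a t) := by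
    intro a b t
    simp only [χ, Finset.mul_sum]
    exact Finset.sum_congr rfl fun j _ => by ring
  have hintχ : ∀ a b, Integrable (fun t => ψ a t * χ b t) (volume.restrict (Set.Ioi 0)) := by
    intro a b
    simp only [hprod]
    exact integrable_finsetSum _ fun j _ => Integrable.const_mul (hint j a) _
  have horth : ∀ a b, ∫ t, ψ a t * χ b t ∂(volume.restrict (Set.Ioi 0)) =
      if a = b then 1 else 0 := by
    intro a b
    simp only [hprod]
    rw [integral_finsetSum _ fun j _ => Integrable.const_mul (hint j a) _]
    have hAa : ∀ j, ∫ t in Set.Ioi (0 : ℝ), φ j t * ψ a t =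
        A j (finTailEquiv N ν (.inr a)) := by
      intro j
      simp [hA, finTailEquiv_inr]
    simp only [integral_const_mul, hAa]
    rw [← Matrix.mul_apply, Matrix.nonsing_inv_mul A hdet.isUnit, Matrix.one_apply]
    simp [eq_comm]
  have hw : ∀ z : Fin (N - k) → ℝ, kernelDet ψ χ (fun i : Fin N =>
      if h : (i : ℕ) < k then y ⟨(i : ℕ), h⟩
      else z ⟨(i : ℕ) - k, by have := i.isLt; omega⟩) = kernelDet ψ χ (Sum.elim y z) := by
    intro z
    let e : Fin k ⊕ Fin (N - k) ≃ Fin N :=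
      finSumFinEquiv.trans (finCongr (Nat.add_sub_cancel' hk))
    rw [← kernelDet_comp_bijective ψ χ _ e e.bijective]
    congr 1
    funext i
    rcases i with i | i <;> simp [e]
  simp only [hPK, hw]
  rw [integral_const_mul, volume_pi, Measure.restrict_pi_pi,
    integral_kernelDet_sumElim _ ψ χ hintχ horth (N - k) k
      (by rw [Fintype.card_fin]; omega) y]
  have h1 : (N.factorial : ℝ) ≠ 0 := by positivity
  have h2 : ((N - k).factorial : ℝ) ≠ 0 := by positivity
  simp only [kernelDet, hKχ]
  field_simp
end
end

section
/- Let N ≥ 1 and ν ≥ 0 be integers, M = N+ν. Let σ_1,…,σ_N be pairwise distinct real numbers and q_1,…,q_M pairwise distinct real numbers with q_i + σ_j > 0 for all i,j. Let A be the M×M matrix with entries A_{i,k} = q_i^{k−1} for 1 ≤ k ≤ ν and A_{i,ν+m} = 1/(q_i + σ_m) for 1 ≤ m ≤ N. Then A is invertible, and for all real numbers c_1, c_2 and R_1, R_2 > 0 satisfying: |−σ_m − c_1| < R_1 and |−σ_m − c_2| > R_2 for all m; |q_j − c_2| < R_2 and |q_j − c_1| > R_1 for all j; and |c_1 − c_2|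 > R_1 + R_2, and for all x, y > 0, one has Σ_{m=1}^N Σ_{j=1}^M e^{−σ_m x} (A^{−1})_{ν+m, j} e^{−q_j y} = (2πi)^{−2} ∮_{|η−c_1|=R_1} ∮_{|ζ−c_2|=R_2} [e^{xη − yζ} / (η − ζ)] · ∏_{l=1}^N (ζ + σ_l)/(η + σ_l) · ∏_{k=1}^M (η − q_k)/(ζ − q_k) dζ dη. -/
open MeasureTheory Matrix Finset

noncomputable section

/-- Lagrange interpolation in first barycentric form, for a polynomial of degree below the number
of nodes. -/
lemma Polynomial.eval_nodal_mul_sum_nodalWeight {K ι : Type*} [Field K] [Fintype ι]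
    [DecidableEq ι] {v : ι → K} (hv : Function.Injective v) {P : Polynomial K}
    (hP : P.degree < Fintype.card ι) {x : K} (hx : ∀ i, x ≠ v i) :
    (Lagrange.nodal univ v).eval x *
      ∑ i, Lagrange.nodalWeight univ v i * (x - v i)⁻¹ * P.eval (v i) = P.eval x := by
  rw [← Lagrange.eval_interpolate_not_at_node _ (fun i _ => hx i),
    ← Lagrange.eq_interpolate hv.injOn (by simpa using hP)]

/-- Residue theorem on a disk for a holomorphic function divided by a product of distinct linear
factors. -/
lemma circleIntegral_div_prod_sub {ι : Type*} [Fintype ι] [DecidableEq ι] [Nonempty ι]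
    {p : ι → ℂ} (hp : Function.Injective p) {c : ℂ} {R : ℝ}
    (hpR : ∀ i, p i ∈ Metric.ball c R) {h : ℂ → ℂ}
    (hh : DifferentiableOn ℂ h (Metric.closedBall c R)) :
    (∮ z in C(c, R), h z / ∏ i, (z - p i)) =
      2 * Real.pi * Complex.I * ∑ i, Lagrange.nodalWeight univ p i * h (p i) := by
  have hR : 0 < R := Metric.pos_of_mem_ball (hpR (Classical.arbitrary ι))
  have hne : ∀ z ∈ Metric.sphere c R, ∀ i, z - p i ≠ 0 := by
    intro z hz i h0
    have h1 := hpR i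
    rw [← sub_eq_zero.1 h0, Metric.mem_ball, Metric.mem_sphere.1 hz] at h1
    exact lt_irrefl _ h1
  have hsplit : Set.EqOn (fun z => h z / ∏ i, (z - p i))
      (fun z => ∑ i, Lagrange.nodalWeight univ p i * ((z - p i)⁻¹ • h z))
      (Metric.sphere c R) := by
    intro z hz
    have key := Polynomial.eval_nodal_mul_sum_nodalWeight hp (P := 1)
      (by rw [Polynomial.degree_one]; exact_mod_cast Fintype.card_pos)
      (fun i => sub_ne_zero.1 (hne z hz i))
    simp only [Lagrange.eval_nodal, Polynomial.eval_one, mul_one] at key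
    have hprod : ∏ i, (z - p i) ≠ 0 := prod_ne_zero_iff.2 fun i _ => hne z hz i
    have hinv : ∑ i, Lagrange.nodalWeight univ p i * (z - p i)⁻¹ = (∏ i, (z - p i))⁻¹ :=
      eq_inv_of_mul_eq_one_right key
    simp only [div_eq_mul_inv, ← hinv, mul_sum, smul_eq_mul]
    exact sum_congr rfl fun i _ => by ring
  rw [circleIntegral.integral_congr hR.le hsplit, circleIntegral.integral_fun_sum, mul_sum]
  · refine sum_congr rfl fun i _ => ?_
    rw [circleIntegral.integral_const_mul, hh.circleIntegral_sub_inv_smul (hpR i), smul_eq_mul]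
    ring
  · intro i _
    refine ContinuousOn.circleIntegrable hR.le ?_
    refine continuousOn_const.mul (ContinuousOn.smul
      (ContinuousOn.inv₀ (f := fun z => z - p i) (by fun_prop) ?_)
      (hh.continuousOn.mono Metric.sphere_subset_closedBall))
    exact fun z hz => hne z hz i

/-- The candidate for row `ν + m` of the inverse of the Gram matrix: a Cauchy-type row. -/
def cauchyRow {N M : ℕ} (σ : Fin N → ℝ) (q : Fin M → ℝ) (m : Fin N) (j : Fin M) : ℝ :=
  Lagrange.nodalWeight univ (fun l => -σ l) m * (∏ k, (-σ m - q k)) *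
    (Lagrange.nodalWeight univ q j * (-σ m - q j)⁻¹ * ∏ l, (q j + σ l))

lemma sum_cauchyRow_mul {N M : ℕ} {σ : Fin N → ℝ} {q : Fin M → ℝ}
    (hq : Function.Injective q) (hcond : ∀ i j, 0 < q i + σ j) (m : Fin N)
    {a : Fin M → ℝ} {P : Polynomial ℝ} (hP : P.degree < M)
    (ha : ∀ j, (∏ l, (q j + σ l)) * a j = P.eval (q j)) :
    ∑ j, cauchyRow σ q m j * a j =
      Lagrange.nodalWeight univ (fun l => -σ l) m * P.eval (-σ m) := by
  rw [← Polynomial.eval_nodal_mul_sum_nodalWeight hq (by simpa using hP)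
    (fun i h => by linarith [hcond i m]), Lagrange.eval_nodal, mul_sum, mul_sum]
  refine sum_congr rfl fun j _ => ?_
  rw [← ha, cauchyRow]
  ring

lemma exists_eq_add_of_not_lt {N ν : ℕ} (c : Fin (N + ν)) (hc : ¬ (c : ℕ) < ν) :
    ∃ m : Fin N, (c : ℕ) = ν + m :=
  ⟨⟨c - ν, by omega⟩, by simp only; omega⟩

lemma cauchyRow_vecMul {N ν : ℕ} {σ : Fin N → ℝ} (hσ : Function.Injective σ)
    {q : Fin (N + ν) → ℝ} (hq : Function.Injective q) (hcond : ∀ i j, 0 < q i + σ j)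
    {A : Matrix (Fin (N + ν)) (Fin (N + ν)) ℝ}
    (hpow : ∀ (i c : Fin (N + ν)), (c : ℕ) < ν → A i c = q i ^ (c : ℕ))
    (hinv : ∀ (i c : Fin (N + ν)) (m : Fin N), (c : ℕ) = ν + m → A i c = (q i + σ m)⁻¹)
    (m : Fin N) (d : Fin (N + ν)) (hd : (d : ℕ) = ν + m) :
    cauchyRow σ q m ᵥ* A = Pi.single d 1 := by
  funext c
  have hinj : Function.Injective fun l => -σ l := neg_injective.comp hσ
  rw [Matrix.vecMul, dotProduct]
  by_cases hc : (c : ℕ) < ν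
  · rw [sum_cauchyRow_mul hq hcond m
      (P := Lagrange.nodal univ (fun l => -σ l) * Polynomial.X ^ (c : ℕ)),
      Polynomial.eval_mul, Lagrange.eval_nodal_at_node (v := fun l => -σ l) (mem_univ m),
      Pi.single_eq_of_ne]
    · ring
    · rintro rfl
      omega
    · rw [Polynomial.degree_mul, Lagrange.degree_nodal, Polynomial.degree_X_pow, card_univ,
        Fintype.card_fin]
      exact_mod_cast Nat.add_lt_add_left hc N
    · intro j
      simp [hpow j c hc, Lagrange.eval_nodal]
  · obtain ⟨m', hm'⟩ := exists_eq_add_of_not_lt c hc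
    rw [sum_cauchyRow_mul hq hcond m (P := Lagrange.nodal (univ.erase m') (fun l => -σ l))]
    · by_cases hmm : m = m'
      · have hcd : c = d := Fin.ext (by rw [hm', hd, hmm])
        rw [← hcd, Pi.single_eq_same, ← hmm, Lagrange.nodalWeight_eq_eval_nodal_erase_inv]
        refine inv_mul_cancel₀ (Lagrange.eval_nodal_not_at_node fun i hi h => ?_)
        exact (mem_erase.1 hi).1 (hinj h).symm
      · rw [Lagrange.eval_nodal_at_node (v := fun l => -σ l) (mem_erase.2 ⟨hmm, mem_univ m⟩),
          Pi.single_eq_of_ne, mul_zero]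
        rintro rfl
        exact hmm (Fin.ext (by omega))
    · rw [Lagrange.degree_nodal, card_erase_of_mem (mem_univ _), card_univ, Fintype.card_fin]
      have := m.isLt
      exact_mod_cast (by omega : N - 1 < N + ν)
    · intro j
      rw [hinv j c m' hm', Lagrange.eval_nodal, ← mul_prod_erase _ _ (mem_univ m'), mul_right_comm,
        mul_inv_cancel₀ (hcond j m').ne', one_mul]
      simp

lemma det_ne_zero_of_cauchy_vandermonde {N ν : ℕ} {σ : Fin N → ℝ} (hσ : Function.Injective σ)
    {q : Fin (N + ν) → ℝ} (hq : Function.Injective q) (hcond : ∀ i j, 0 < q i + σ j)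
    {A : Matrix (Fin (N + ν)) (Fin (N + ν)) ℝ}
    (hpow : ∀ (i c : Fin (N + ν)), (c : ℕ) < ν → A i c = q i ^ (c : ℕ))
    (hinv : ∀ (i c : Fin (N + ν)) (m : Fin N), (c : ℕ) = ν + m → A i c = (q i + σ m)⁻¹) :
    A.det ≠ 0 := by
  intro hdet
  obtain ⟨v, hv0, hv⟩ := Matrix.exists_mulVec_eq_zero_iff.2 hdet
  have hlast : ∀ c : Fin (N + ν), ¬ (c : ℕ) < ν → v c = 0 := by
    intro c hc
    obtain ⟨m, hm⟩ := exists_eq_add_of_not_lt c hc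
    have h1 : cauchyRow σ q m ⬝ᵥ (A *ᵥ v) = 0 := by
      rw [hv, dotProduct_zero]
    rw [Matrix.dotProduct_mulVec, cauchyRow_vecMul hσ hq hcond hpow hinv m c hm,
      single_one_dotProduct] at h1
    exact h1
  have hle : ν ≤ N + ν := Nat.le_add_left ν N
  have hfirst : (fun k : Fin ν => v (Fin.castLE hle k)) = 0 := by
    refine Matrix.eq_zero_of_forall_index_sum_pow_mul_eq_zero
      (f := fun k : Fin ν => q (Fin.castLE hle k))
      (hq.comp (Fin.castLE_injective hle)) fun j => ?_
    have h2 : ∑ c, A (Fin.castLE hle j) c * v c = 0 := congrFun hv (Fin.castLE hle j)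
    rw [← h2]
    refine sum_of_injOn (Fin.castLE hle) (Fin.castLE_injective hle).injOn (by simp) ?_ ?_
    · intro c _ hc
      rw [hlast c, mul_zero]
      intro hlt
      exact hc ⟨⟨c, hlt⟩, by simp, Fin.ext rfl⟩
    · intro k _
      simp [hpow]
  refine hv0 (funext fun c => ?_)
  by_cases hc : (c : ℕ) < ν
  · exact congrFun hfirst ⟨c, hc⟩
  · exact hlast c hc

/-- Theorem 3.3: double contour integral representation of the finite-`N` correlation
kernel `K_N^{(1)}(x,y)` of the generalised Wishart ensemble. -/
theorem statement8
    (N ν : ℕ) (hN : 1 ≤ N)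
    (σ : Fin N → ℝ) (hσinj : Function.Injective σ)
    (q : Fin (N + ν) → ℝ) (hqinj : Function.Injective q)
    (hcond : ∀ i j, 0 < q i + σ j)
    (A : Matrix (Fin (N + ν)) (Fin (N + ν)) ℝ)
    (hA : ∀ i c, A i c =
      if h : (c : ℕ) < ν then q i ^ (c : ℕ)
      else (q i + σ ⟨(c : ℕ) - ν, by have := c.isLt; omega⟩)⁻¹) :
    IsUnit A.det ∧
    ∀ c₁ c₂ R₁ R₂ : ℝ, 0 < R₁ → 0 < R₂ →
      (∀ m, |(-σ m) - c₁| < R₁) → (∀ m, R₂ < |(-σ m) - c₂|) →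
      (∀ j, |q j - c₂| < R₂) → (∀ j, R₁ < |q j - c₁|) →
      R₁ + R₂ < |c₁ - c₂| →
      ∀ x y : ℝ, 0 < x → 0 < y →
      ((∑ m : Fin N, ∑ j : Fin (N + ν),
          Real.exp (-σ m * x)
            * A⁻¹ ⟨ν + (m : ℕ), by have := m.isLt; omega⟩ j
            * Real.exp (-q j * y) : ℝ) : ℂ)
      = ((2 * (Real.pi : ℂ) * Complex.I) ^ 2)⁻¹ *
          (∮ η in C((c₁ : ℂ), R₁), ∮ ζ in C((c₂ : ℂ), R₂),
            Complex.exp ((x : ℂ) * η - (y : ℂ) * ζ) / (η - ζ)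
              * (∏ l : Fin N, (ζ + (σ l : ℂ)) / (η + (σ l : ℂ)))
              * ∏ k : Fin (N + ν), (η - (q k : ℂ)) / (ζ - (q k : ℂ))) := by
  have hpow : ∀ (i c : Fin (N + ν)), (c : ℕ) < ν → A i c = q i ^ (c : ℕ) :=
    fun i c hc => by rw [hA, dif_pos hc]
  have hcau : ∀ (i c : Fin (N + ν)) (m : Fin N), (c : ℕ) = ν + m → A i c = (q i + σ m)⁻¹ := by
    intro i c m hm
    rw [hA, dif_neg (by omega)]
    congr
    omega
  have hdet : IsUnit A.det :=
    isUnit_iff_ne_zero.2 (det_ne_zero_of_cauchy_vandermonde hσinj hqinj hcond hpow hcau)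
  refine ⟨hdet, ?_⟩
  intro c₁ c₂ R₁ R₂ hR₁ hR₂ hσ₁ _ hq₂ hq₁ hdisj x y _ _
  have hinv : ∀ (m : Fin N) (j : Fin (N + ν)),
      A⁻¹ ⟨ν + (m : ℕ), by have := m.isLt; omega⟩ j = cauchyRow σ q m j := by
    intro m j
    have h := congrArg (· ᵥ* A⁻¹) (cauchyRow_vecMul hσinj hqinj hcond hpow hcau m
      ⟨ν + (m : ℕ), by have := m.isLt; omega⟩ rfl)
    simp only [Matrix.vecMul_vecMul, Matrix.mul_nonsing_inv A hdet, Matrix.vecMul_one,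
      Matrix.single_one_vecMul] at h
    exact (congrFun h j).symm
  have : Nonempty (Fin N) := ⟨⟨0, hN⟩⟩
  have : Nonempty (Fin (N + ν)) := ⟨⟨0, by omega⟩⟩
  have hdist : ∀ a b : ℝ, dist (a : ℂ) b = |a - b| := fun a b => by
    rw [Complex.dist_of_im_eq (by simp)]; simp [Real.dist_eq]
  have hqC : Function.Injective fun k => (q k : ℂ) := Complex.ofReal_injective.comp hqinj
  have hσC : Function.Injective fun l => -(σ l : ℂ) :=
    neg_injective.comp (Complex.ofReal_injective.comp hσinj)
  have hqball : ∀ k, (q k : ℂ) ∈ Metric.ball (c₂ : ℂ) R₂ := fun k => by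
    rw [Metric.mem_ball, hdist]; exact hq₂ k
  have hσball : ∀ l, -(σ l : ℂ) ∈ Metric.ball (c₁ : ℂ) R₁ := fun l => by
    rw [Metric.mem_ball, ← Complex.ofReal_neg, hdist]; exact hσ₁ l
  have hinner : Set.EqOn
      (fun η : ℂ => ∮ ζ in C((c₂ : ℂ), R₂),
        Complex.exp ((x : ℂ) * η - (y : ℂ) * ζ) / (η - ζ)
          * (∏ l : Fin N, (ζ + (σ l : ℂ)) / (η + (σ l : ℂ)))
          * ∏ k : Fin (N + ν), (η - (q k : ℂ)) / (ζ - (q k : ℂ)))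
      (fun η : ℂ => 2 * Real.pi * Complex.I *
        ((∑ j, Lagrange.nodalWeight univ (fun k => (q k : ℂ)) j *
          (Complex.exp ((x : ℂ) * η - (y : ℂ) * q j) / (η - q j)
            * (∏ l, ((q j : ℂ) + σ l)) * ∏ k, (η - q k))) / ∏ l, (η - -(σ l : ℂ))))
      (Metric.sphere (c₁ : ℂ) R₁) := by
    intro η hη
    have hηζ : ∀ ζ ∈ Metric.closedBall (c₂ : ℂ) R₂, η - ζ ≠ 0 := by
      intro ζ hζ h0
      rw [← sub_eq_zero.1 h0, Metric.mem_closedBall] at hζ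
      have h1 := dist_triangle_left (c₁ : ℂ) c₂ η
      rw [hdist, Metric.mem_sphere.1 hη] at h1
      linarith
    have hh : DifferentiableOn ℂ (fun ζ : ℂ =>
        Complex.exp ((x : ℂ) * η - (y : ℂ) * ζ) / (η - ζ)
          * (∏ l, (ζ + (σ l : ℂ))) * ((∏ k, (η - (q k : ℂ))) / ∏ l, (η - -(σ l : ℂ))))
        (Metric.closedBall (c₂ : ℂ) R₂) := by
      refine DifferentiableOn.mul (DifferentiableOn.mul (DifferentiableOn.div ?_ ?_ hηζ) ?_) ?_
      all_goals fun_prop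
    have hres := circleIntegral_div_prod_sub hqC hqball hh
    refine Eq.trans ?_ (hres.trans ?_)
    · refine circleIntegral.integral_congr hR₂.le fun ζ _ => ?_
      simp only [prod_div_distrib, sub_neg_eq_add]
      ring
    · simp only [sum_div]
      exact congrArg _ (sum_congr rfl fun j _ => by ring)
  have hηq : ∀ k, ∀ η ∈ Metric.closedBall (c₁ : ℂ) R₁, η - q k ≠ 0 := by
    intro k η hη h0
    rw [sub_eq_zero.1 h0, Metric.mem_closedBall, hdist] at hη
    linarith [hq₁ k]
  have hh : DifferentiableOn ℂ (fun η : ℂ =>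
      ∑ j, Lagrange.nodalWeight univ (fun k => (q k : ℂ)) j *
        (Complex.exp ((x : ℂ) * η - (y : ℂ) * q j) / (η - q j)
          * (∏ l, ((q j : ℂ) + σ l)) * ∏ k, (η - q k))) (Metric.closedBall (c₁ : ℂ) R₁) := by
    refine DifferentiableOn.fun_sum fun j _ => DifferentiableOn.mul (by fun_prop)
      (DifferentiableOn.mul (DifferentiableOn.mul (DifferentiableOn.div ?_ ?_ (hηq j)) ?_) ?_)
    all_goals fun_prop
  rw [circleIntegral.integral_congr hR₁.le hinner, circleIntegral.integral_const_mul,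
    circleIntegral_div_prod_sub hσC hσball hh, ← mul_assoc, ← mul_assoc, mul_assoc _ _ (2 * _ * _),
    ← pow_two, inv_mul_cancel₀ (pow_ne_zero 2 Complex.two_pi_I_ne_zero), one_mul]
  push_cast
  refine sum_congr rfl fun m _ => ?_
  rw [mul_sum]
  refine sum_congr rfl fun j _ => ?_
  have hexp : Complex.exp ((x : ℂ) * -(σ m : ℂ) - (y : ℂ) * q j) =
      Complex.exp (-(σ m : ℂ) * x) * Complex.exp (-(q j : ℂ) * y) := by
    rw [← Complex.exp_add]
    congr 1
    ring
  rw [hinv, cauchyRow, hexp]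
  simp only [Lagrange.nodalWeight]
  push_cast
  ring
end
end

section
/- Let N ≥ 1, ν ≥ 0, κ ≥ 0 be integers, M = N+ν, α > 0, and let q_1,…,q_M > 0 be pairwise distinct. Let A be the M×M matrix with entries A_{i,k} = (α q_i)^{k−1} for 1 ≤ k ≤ ν and A_{i,ν+m} = (κ+m−1)!·(m−1)! / (2 α^{κ+m} q_i^m) for 1 ≤ m ≤ N. Then A is invertible, and for all real numbers c_1, c_2 and R_1, R_2 > 0 satisfying: |c_1| < R_1 (the first circle encloses the origin); |α q_j − c_1| > R_1 and |α q_j − c_2| < R_2 for all j; c_2 − R_2 > 0; and |c_1 − c_2| > R_1 + R_2, and for all x, y > 0, one has Σ_{m=1}^N Σ_{j=1}^M x^{κ+m−1} (A^{−1})_{ν+m, j} (2 α^κ)^{−1} F_κ(y, α q_j) = (2πi)^{−2} ∮_{|η−c_1|=R_1} ∮_{|ζ−c_2|=R_2} (ζ/η)^N · [E_κ(η, x) F_κ(y, ζ) / (η − ζ)] · ∏_{l=1}^M (η − α q_l)/(ζ − α q_l) dζ dη. -/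
open MeasureTheory Matrix Finset

noncomputable section

/-- The Lagrange basis is compatible with field homomorphisms. -/
lemma map_lagrange_basis {K L ι : Type*} [Field K] [Field L] [DecidableEq ι] (f : K →+* L)
    (s : Finset ι) (v : ι → K) (i : ι) :
    (Lagrange.basis s v i).map f = Lagrange.basis s (fun j => f (v j)) i := by
  simp [Lagrange.basis, Lagrange.basisDivisor, Polynomial.map_prod]

lemma FbesC_ofReal (κ : ℕ) (a ζ : ℝ) : FbesC κ a ζ = Fbes κ a ζ := by
  unfold FbesC Fbes
  refine Eq.trans ?_ integral_ofReal
  refine integral_congr_ae (Filter.Eventually.of_forall fun t => ?_)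
  simp

/-- The factor `t ^ (-n) * exp (-a / t)` is bounded on the positive half-line. -/
lemma exists_zpow_mul_exp_neg_div_le (n : ℕ) {a : ℝ} (ha : 0 < a) :
    ∃ C : ℝ, ∀ t : ℝ, 0 < t → t ^ (-(n : ℤ)) * Real.exp (-a / t) ≤ C := by
  refine ⟨n.factorial / a ^ n, fun t ht => ?_⟩
  have h := Real.pow_div_factorial_le_exp (a / t) (by positivity) n
  rw [neg_div, Real.exp_neg, _root_.zpow_neg, zpow_natCast, ← mul_inv]
  rw [div_pow, div_div, div_le_iff₀ (by positivity)] at h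
  rw [inv_le_comm₀ (by positivity) (by positivity), inv_div, div_le_iff₀ (by positivity)]
  linarith

lemma FbesC_differentiableAt (κ : ℕ) {a : ℝ} (ha : 0 < a) {ζ : ℂ} (hζ : 0 < ζ.re) :
    DifferentiableAt ℂ (FbesC κ a) ζ := by
  obtain ⟨C₀, hC₀⟩ := exists_zpow_mul_exp_neg_div_le (κ + 1) ha
  obtain ⟨C₁, hC₁⟩ := exists_zpow_mul_exp_neg_div_le κ ha
  have hε : 0 < ζ.re / 2 := by positivity
  have hmeas : ∀ z : ℂ, AEStronglyMeasurable
      (fun t : ℝ => (t : ℂ) ^ (-(κ : ℤ) - 1) * Complex.exp (-(a : ℂ) / t - z * t))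
      (volume.restrict (Set.Ioi 0)) := fun z => by
    refine ContinuousOn.aestronglyMeasurable (fun t ht => ContinuousAt.continuousWithinAt ?_)
      measurableSet_Ioi
    have ht' : (t : ℂ) ≠ 0 := by exact_mod_cast (ne_of_gt ht)
    fun_prop (disch := first | assumption | exact Or.inl ht')
  have hnorm : ∀ z : ℂ, ∀ t : ℝ, 0 < t →
      ‖(t : ℂ) ^ (-(κ : ℤ) - 1) * Complex.exp (-(a : ℂ) / t - z * t)‖ =
        t ^ (-((κ + 1 : ℕ) : ℤ)) * Real.exp (-a / t) * Real.exp (-z.re * t) := fun z t ht => by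
    have h1 : (-(a : ℂ) / t - z * t).re = -a / t + -z.re * t := by
      have : (-(a : ℂ) / t) = ((-a / t : ℝ) : ℂ) := by push_cast; rfl
      rw [this]
      simp
      ring
    rw [norm_mul, Complex.norm_exp, h1, Real.exp_add, norm_zpow, Complex.norm_real,
      Real.norm_of_nonneg ht.le, mul_assoc]
    congr 2
    push_cast
    ring
  have hexp : ∀ z : ℂ, ζ.re / 2 < z.re → ∀ t : ℝ, 0 < t →
      Real.exp (-z.re * t) ≤ Real.exp (-(ζ.re / 2) * t) := fun z hz t ht => by
    rw [Real.exp_le_exp]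
    nlinarith
  have hint : ∀ C : ℝ, Integrable (fun t : ℝ => C * Real.exp (-(ζ.re / 2) * t))
      (volume.restrict (Set.Ioi 0)) := fun C =>
    (exp_neg_integrableOn_Ioi 0 hε).const_mul C
  have key := hasDerivAt_integral_of_dominated_loc_of_deriv_le
    (μ := volume.restrict (Set.Ioi (0 : ℝ))) (x₀ := ζ) (s := {z : ℂ | ζ.re / 2 < z.re})
    (F := fun z t => (t : ℂ) ^ (-(κ : ℤ) - 1) * Complex.exp (-(a : ℂ) / t - z * t))
    (F' := fun z t => -(t : ℂ) * ((t : ℂ) ^ (-(κ : ℤ) - 1) * Complex.exp (-(a : ℂ) / t - z * t)))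
    (bound := fun t => C₁ * Real.exp (-(ζ.re / 2) * t))
    ((isOpen_lt continuous_const Complex.continuous_re).mem_nhds (half_lt_self hζ))
    (Filter.Eventually.of_forall hmeas) ?_ ?_ ?_ (hint C₁) ?_
  · exact key.2.differentiableAt
  · refine (hint C₀).mono' (hmeas ζ) ?_
    filter_upwards [ae_restrict_mem measurableSet_Ioi] with t ht
    rw [hnorm ζ t ht]
    exact mul_le_mul (hC₀ t ht) (hexp ζ (half_lt_self hζ) t ht) (Real.exp_nonneg _)
      (le_trans (by have := ht.out; positivity) (hC₀ t ht))
  · exact (Complex.continuous_ofReal.neg.aestronglyMeasurable).mul (hmeas ζ)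
  · filter_upwards [ae_restrict_mem measurableSet_Ioi] with t ht z hz
    have ht0 : 0 < t := ht
    rw [norm_mul, hnorm z t ht, norm_neg, Complex.norm_real, Real.norm_of_nonneg ht0.le,
      ← mul_assoc, ← mul_assoc]
    have h2 : t * t ^ (-((κ + 1 : ℕ) : ℤ)) = t ^ (-(κ : ℤ)) := by
      rw [← zpow_one_add₀ ht0.ne']
      congr 1
      push_cast
      ring
    rw [h2]
    exact mul_le_mul (hC₁ t ht) (hexp z hz t ht) (Real.exp_nonneg _)
      (le_trans (by positivity) (hC₁ t ht))
  · filter_upwards with t z _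
    have h := ((((hasDerivAt_id z).mul_const (t : ℂ)).const_sub (-(a : ℂ) / t)).cexp).const_mul
      ((t : ℂ) ^ (-(κ : ℤ) - 1))
    refine h.congr_deriv ?_
    simp only [id]
    ring

/-- The Taylor coefficients of `EbesC κ · y` at the origin. -/
def EbesCoeff (κ : ℕ) (y : ℝ) (n : ℕ) : ℂ :=
  (y : ℂ) ^ (n + κ) / ((n.factorial : ℝ) * ((n + κ).factorial : ℝ))

lemma norm_pow_mul_EbesCoeff_le (κ N n : ℕ) (y : ℝ) {r : ℝ} {δ : ℂ} (h : ‖δ‖ ≤ r) :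
    ‖δ ^ n * EbesCoeff κ y (n + N)‖ ≤ |y| ^ (N + κ) * ((r * |y|) ^ n / n.factorial) := by
  have hr : 0 ≤ r := (norm_nonneg δ).trans h
  have h1 : (n.factorial : ℝ) ≤ (n + N).factorial * (n + N + κ).factorial := by
    have h2 : n.factorial ≤ (n + N).factorial := Nat.factorial_le (by omega)
    have h3 : 1 ≤ (n + N + κ).factorial := Nat.factorial_pos _
    exact_mod_cast (Nat.mul_le_mul h2 h3).trans' (by simp)
  have h4 : ‖δ ^ n * EbesCoeff κ y (n + N)‖ =
      ‖δ‖ ^ n * |y| ^ (n + N + κ) / ((n + N).factorial * (n + N + κ).factorial) := by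
    simp [EbesCoeff, mul_div_assoc]
  rw [h4]
  calc _ ≤ r ^ n * |y| ^ (n + N + κ) / n.factorial := by gcongr
    _ = _ := by ring

lemma summable_pow_mul_EbesCoeff (κ N : ℕ) (y : ℝ) (δ : ℂ) :
    Summable fun n => δ ^ n * EbesCoeff κ y (n + N) :=
  Summable.of_norm_bounded ((Real.summable_pow_div_factorial _).mul_left _)
    fun n => norm_pow_mul_EbesCoeff_le κ N n y le_rfl

lemma EbesC_eq_sum_add (κ N : ℕ) (y : ℝ) (δ : ℂ) :
    EbesC κ δ y = ∑ n ∈ range N, EbesCoeff κ y n * δ ^ n +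
      δ ^ N * ∑' n : ℕ, δ ^ n * EbesCoeff κ y (n + N) := by
  have h := (summable_pow_mul_EbesCoeff κ 0 y δ).sum_add_tsum_nat_add N
  have h' : EbesC κ δ y = ∑' n : ℕ, δ ^ n * EbesCoeff κ y (n + 0) := by
    simp [EbesC, EbesCoeff, mul_div_assoc]
  rw [h', ← h, ← tsum_mul_left]
  congr 1
  · exact sum_congr rfl fun n _ => mul_comm _ _
  · exact tsum_congr fun n => by rw [add_zero, pow_add]; ring

lemma differentiable_tsum_EbesCoeff (κ N : ℕ) (y : ℝ) :
    Differentiable ℂ fun δ : ℂ => ∑' n : ℕ, δ ^ n * EbesCoeff κ y (n + N) := by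
  intro δ
  have h := Complex.differentiableOn_tsum_of_summable_norm (U := Metric.ball (0 : ℂ) (‖δ‖ + 1))
    (F := fun n δ => δ ^ n * EbesCoeff κ y (n + N))
    (((Real.summable_pow_div_factorial ((‖δ‖ + 1) * |y|))).mul_left (|y| ^ (N + κ)))
    (fun n => by fun_prop) Metric.isOpen_ball
    fun n w hw => norm_pow_mul_EbesCoeff_le κ N n y (mem_ball_zero_iff.1 hw).le
  exact h.differentiableAt (Metric.isOpen_ball.mem_nhds (by simp))

lemma circleIntegral_zpow {c : ℂ} {R : ℝ} (h0 : (0 : ℂ) ∈ Metric.ball c R) (n : ℤ) :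
    ∮ η in C(c, R), η ^ n = if n = -1 then 2 * Real.pi * Complex.I else 0 := by
  split_ifs with h
  · subst h
    simpa using circleIntegral.integral_sub_inv_of_mem_ball h0
  · simpa using circleIntegral.integral_sub_zpow_of_ne h c 0 R

/-- Extraction of the coefficient of `η ^ (N - 1)` from the product of a polynomial with a function
known modulo `η ^ N`. -/
lemma circleIntegral_inv_pow_mul_eval (N : ℕ) {c : ℂ} {R : ℝ} (h0 : (0 : ℂ) ∈ Metric.ball c R)
    (e : ℕ → ℂ) {G : ℂ → ℂ} (hG : Differentiable ℂ G) (P : Polynomial ℂ) :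
    ∮ η in C(c, R), (η ^ N)⁻¹ * (∑ n ∈ range N, e n * η ^ n + η ^ N * G η) * P.eval η =
      2 * Real.pi * Complex.I * ∑ n ∈ range N, e n * P.coeff (N - 1 - n) := by
  have hR : 0 < R := Metric.pos_of_mem_ball h0
  have hne : ∀ η ∈ Metric.sphere c R, η ≠ 0 := fun η hη h => by
    rw [h] at hη
    exact (Metric.mem_ball.1 h0).ne (Metric.mem_sphere.1 hη)
  have hGP : Differentiable ℂ fun η => G η * P.eval η := hG.mul P.differentiable
  have hcong : Set.EqOn
      (fun η => (η ^ N)⁻¹ * (∑ n ∈ range N, e n * η ^ n + η ^ N * G η) * P.eval η)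
      (fun η => ∑ n ∈ range N, ∑ k ∈ range (N + (P.natDegree + 1)),
        e n * P.coeff k * η ^ ((n : ℤ) + k - N) + G η * P.eval η) (Metric.sphere c R) := by
    intro η hη
    have hη0 := hne η hη
    simp only
    have h1 : (η ^ N)⁻¹ * (∑ n ∈ range N, e n * η ^ n + η ^ N * G η) * P.eval η =
        (η ^ N)⁻¹ * ((∑ n ∈ range N, e n * η ^ n) * P.eval η) + G η * P.eval η := by
      field_simp
    rw [h1, Polynomial.eval_eq_sum_range' (show P.natDegree < N + (P.natDegree + 1) by omega),
      sum_mul_sum, mul_sum]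
    congr 1
    refine sum_congr rfl fun n _ => ?_
    rw [mul_sum]
    refine sum_congr rfl fun k _ => ?_
    rw [zpow_sub₀ hη0, zpow_add₀ hη0]
    simp only [zpow_natCast]
    ring
  have hci : ∀ n k, CircleIntegrable (fun η => e n * P.coeff k * η ^ ((n : ℤ) + k - N)) c R :=
    fun n k => ContinuousOn.circleIntegrable hR.le
      (continuousOn_const.mul fun η hη =>
        (continuousAt_zpow₀ η _ (Or.inl (hne η hη))).continuousWithinAt)
  have hcs : ∀ n, CircleIntegrable (fun η => ∑ k ∈ range (N + (P.natDegree + 1)),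
      e n * P.coeff k * η ^ ((n : ℤ) + k - N)) c R :=
    fun n => CircleIntegrable.fun_sum _ fun k _ => hci n k
  rw [circleIntegral.integral_congr hR.le hcong, circleIntegral.integral_add
    (CircleIntegrable.fun_sum _ fun n _ => hcs n)
    (hGP.continuous.continuousOn.circleIntegrable hR.le),
    hGP.diffContOnCl.circleIntegral_eq_zero hR.le, add_zero,
    circleIntegral.integral_fun_sum fun n _ => hcs n, mul_sum]
  refine sum_congr rfl fun n hn => ?_
  have hn' := mem_range.1 hn
  rw [circleIntegral.integral_fun_sum fun k _ => hci n k]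
  simp only [circleIntegral.integral_const_mul, circleIntegral_zpow h0]
  rw [sum_eq_single (N - 1 - n)]
  · rw [if_pos (by omega)]
    ring
  · intro k _ hk
    rw [if_neg (by omega), mul_zero]
  · intro h
    exact absurd (mem_range.2 (by omega)) h

/-- The Lagrange basis polynomials provide the inverse of a Vandermonde matrix whose columns are
ordered as in a matrix with `ν` nonnegative powers followed by weighted negative powers. -/
lemma mul_lagrange_coeff_eq_one {K : Type*} [Field K] (N ν : ℕ) (p : Fin (N + ν) → K)
    (hp0 : ∀ i, p i ≠ 0) (hp : Function.Injective p) (d : ℕ → K) (hd : ∀ m, d m ≠ 0)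
    (A : Matrix (Fin (N + ν)) (Fin (N + ν)) K)
    (hA : ∀ i c, A i c = if (c : ℕ) < ν then p i ^ (c : ℕ)
      else d ((c : ℕ) - ν) / p i ^ ((c : ℕ) - ν + 1)) :
    A * Matrix.of (fun c j : Fin (N + ν) => p j ^ N *
      if (c : ℕ) < ν then (Lagrange.basis univ p j).coeff (N + c)
      else (d ((c : ℕ) - ν))⁻¹ * (Lagrange.basis univ p j).coeff (N - 1 - ((c : ℕ) - ν))) = 1 := by
  ext i j
  have hN : 0 < N + ν := Fin.pos i
  have hdeg : (Lagrange.basis univ p j).natDegree < N + ν := by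
    rw [Polynomial.natDegree_lt_iff_degree_lt (Lagrange.basis_ne_zero hp.injOn (mem_univ j)),
      Lagrange.degree_basis hp.injOn (mem_univ j), card_univ, Fintype.card_fin]
    exact_mod_cast Nat.sub_lt hN one_pos
  have heval : (Lagrange.basis univ p j).eval (p i) = if i = j then 1 else 0 := by
    split_ifs with h
    · rw [h, Lagrange.eval_basis_self hp.injOn (mem_univ j)]
    · exact Lagrange.eval_basis_of_ne (Ne.symm h) (mem_univ i)
  have hsum : (A * Matrix.of (fun c j : Fin (N + ν) => p j ^ N *
      if (c : ℕ) < ν then (Lagrange.basis univ p j).coeff (N + c)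
      else (d ((c : ℕ) - ν))⁻¹ * (Lagrange.basis univ p j).coeff (N - 1 - ((c : ℕ) - ν)))) i j =
      p j ^ N / p i ^ N * (Lagrange.basis univ p j).eval (p i) := by
    rw [Matrix.mul_apply, Polynomial.eval_eq_sum_range' hdeg, sum_range_add,
      ← sum_range_reflect _ N]
    simp only [hA, Matrix.of_apply]
    rw [Fin.sum_univ_eq_sum_range (fun c => (if c < ν then p i ^ c
      else d (c - ν) / p i ^ (c - ν + 1)) * (p j ^ N *
      if c < ν then (Lagrange.basis univ p j).coeff (N + c)
      else (d (c - ν))⁻¹ * (Lagrange.basis univ p j).coeff (N - 1 - (c - ν)))),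
      show range (N + ν) = range (ν + N) by rw [add_comm],
      sum_range_add, add_comm, mul_add, mul_sum, mul_sum]
    congr 1
    · refine sum_congr rfl fun m hm => ?_
      have hm := mem_range.1 hm
      have hpw : p i ^ N = p i ^ (N - 1 - m) * p i ^ (m + 1) := by
        rw [← pow_add]
        congr 1
        omega
      have h1 := hp0 i
      have h2 := hd m
      rw [if_neg (by omega), if_neg (by omega), Nat.add_sub_cancel_left, hpw]
      field_simp
    · refine sum_congr rfl fun m hm => ?_
      have hm := mem_range.1 hm
      have h1 := hp0 i
      rw [if_pos hm, if_pos hm, pow_add]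
      field_simp
  rw [hsum, heval, Matrix.one_apply]
  split_ifs with h
  · rw [h, mul_one, div_self (pow_ne_zero _ (hp0 j))]
  · rw [mul_zero]

/-- Residue evaluation: the Lagrange interpolant of a holomorphic function as a contour integral. -/
lemma circleIntegral_lagrange {ι : Type*} [Fintype ι] [DecidableEq ι] [Nonempty ι] {p : ι → ℂ}
    (hp : Function.Injective p) {c η : ℂ} {R : ℝ} (hR : 0 < R) (hpc : ∀ j, p j ∈ Metric.ball c R)
    (hη : η ∉ Metric.closedBall c R) {f : ℂ → ℂ}
    (hf : DifferentiableOn ℂ f (Metric.closedBall c R)) :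
    ∮ ζ in C(c, R), f ζ / (η - ζ) * ∏ l, (η - p l) / (ζ - p l) =
      2 * Real.pi * Complex.I * ∑ j, f (p j) * (Lagrange.basis univ p j).eval η := by
  have hη' : ∀ ζ ∈ Metric.closedBall c R, η - ζ ≠ 0 := fun ζ hζ h =>
    hη (by rwa [sub_eq_zero.1 h])
  have hd : ∀ j, DifferentiableOn ℂ
      (fun ζ => f ζ / (η - ζ) * (Lagrange.nodal univ p).eval η * Lagrange.nodalWeight univ p j)
      (Metric.closedBall c R) := fun j =>
    ((hf.div (by fun_prop) hη').mul_const _).mul_const _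
  have hne : ∀ ζ ∈ Metric.sphere c R, ∀ j, ζ - p j ≠ 0 := fun ζ hζ j h => by
    have h1 := hpc j
    rw [← sub_eq_zero.1 h, Metric.mem_ball] at h1
    exact h1.ne hζ
  have hcong : Set.EqOn (fun ζ => f ζ / (η - ζ) * ∏ l, (η - p l) / (ζ - p l))
      (fun ζ => ∑ j, (ζ - p j)⁻¹ • (f ζ / (η - ζ) * (Lagrange.nodal univ p).eval η *
        Lagrange.nodalWeight univ p j)) (Metric.sphere c R) := by
    intro ζ hζ
    have h := Lagrange.eval_interpolate_not_at_node (s := univ) (v := p) (1 : ι → ℂ)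
      (fun i _ => sub_ne_zero.1 (hne ζ hζ i))
    rw [Lagrange.interpolate_one hp.injOn univ_nonempty, Polynomial.eval_one] at h
    have h' : (∏ l, (ζ - p l))⁻¹ = ∑ j, Lagrange.nodalWeight univ p j * (ζ - p j)⁻¹ := by
      rw [Lagrange.eval_nodal] at h
      rw [inv_eq_of_mul_eq_one_right h.symm]
      simp
    simp only
    rw [prod_div_distrib, div_eq_mul_inv (∏ l, (η - p l)), h', Lagrange.eval_nodal, ← mul_assoc,
      mul_sum]
    refine sum_congr rfl fun j _ => ?_
    rw [smul_eq_mul]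
    ring
  rw [circleIntegral.integral_congr hR.le hcong, circleIntegral.integral_fun_sum, mul_sum]
  · refine sum_congr rfl fun j _ => ?_
    rw [DifferentiableOn.circleIntegral_sub_inv_smul (hd j) (hpc j), smul_eq_mul,
      Lagrange.eval_basis_not_at_node (mem_univ j)
        (sub_ne_zero.1 (hη' _ (Metric.ball_subset_closedBall (hpc j))))]
    ring
  · intro j _
    refine ContinuousOn.circleIntegrable hR.le (ContinuousOn.fun_smul ?_
      ((hd j).continuousOn.mono Metric.sphere_subset_closedBall))
    exact ContinuousOn.inv₀ (by fun_prop) fun ζ hζ => hne ζ hζ j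

/-- Theorem 3.7: double contour integral representation of the finite-`N` correlation
kernel `K_N^{(2)}(x,y)` of the product of two independent matrices with one matrix
correlated. -/
theorem statement9
    (N ν κ : ℕ) (hN : 1 ≤ N) (α : ℝ) (hα : 0 < α)
    (q : Fin (N + ν) → ℝ) (hq0 : ∀ i, 0 < q i) (hqinj : Function.Injective q)
    (A : Matrix (Fin (N + ν)) (Fin (N + ν)) ℝ)
    (hA : ∀ i c, A i c =
      if h : (c : ℕ) < ν then (α * q i) ^ (c : ℕ)
      else ((κ + ((c : ℕ) - ν)).factorial : ℝ) * (((c : ℕ) - ν).factorial : ℝ)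
            / (2 * α ^ (κ + ((c : ℕ) - ν) + 1) * q i ^ (((c : ℕ) - ν) + 1))) :
    IsUnit A.det ∧
    ∀ c₁ c₂ R₁ R₂ : ℝ, 0 < R₁ → 0 < R₂ →
      |c₁| < R₁ →
      (∀ j, R₁ < |α * q j - c₁|) → (∀ j, |α * q j - c₂| < R₂) →
      0 < c₂ - R₂ → R₁ + R₂ < |c₁ - c₂| →
      ∀ x y : ℝ, 0 < x → 0 < y →
      ((∑ m : Fin N, ∑ j : Fin (N + ν),
          x ^ (κ + (m : ℕ))
            * A⁻¹ ⟨ν + (m : ℕ), by have := m.isLt; omega⟩ j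
            * (2 * α ^ κ)⁻¹ * Fbes κ y (α * q j) : ℝ) : ℂ)
      = ((2 * (Real.pi : ℂ) * Complex.I) ^ 2)⁻¹ *
          (∮ η in C((c₁ : ℂ), R₁), ∮ ζ in C((c₂ : ℂ), R₂),
            (ζ / η) ^ N * EbesC κ η x * FbesC κ y ζ / (η - ζ)
              * ∏ l : Fin (N + ν),
                  (η - ((α * q l : ℝ) : ℂ)) / (ζ - ((α * q l : ℝ) : ℂ))) := by
  have hp0 : ∀ i, 0 < α * q i := fun i => mul_pos hα (hq0 i)
  have hpinj : Function.Injective fun i => α * q i := fun i j h =>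
    hqinj (mul_left_cancel₀ hα.ne' h)
  have hAB := mul_lagrange_coeff_eq_one N ν (fun i => α * q i) (fun i => (hp0 i).ne') hpinj
    (fun m => ((κ + m).factorial : ℝ) * m.factorial / (2 * α ^ κ)) (fun m => by positivity) A
    (fun i c => by
      rw [hA]
      split_ifs
      · rfl
      · have := hq0 i
        rw [mul_pow]
        field_simp
        ring)
  refine ⟨Matrix.isUnit_det_of_right_inverse hAB, ?_⟩
  intro c₁ c₂ R₁ R₂ hR₁ hR₂ h0 _ hq₂ hpos hdisj x y _ hy
  have : Nonempty (Fin (N + ν)) := ⟨⟨0, by omega⟩⟩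
  let P : Fin (N + ν) → Polynomial ℂ :=
    Lagrange.basis univ fun j => ((α * q j : ℝ) : ℂ)
  have hpC : Function.Injective fun j => ((α * q j : ℝ) : ℂ) :=
    Complex.ofReal_injective.comp hpinj
  have hpc : ∀ j, ((α * q j : ℝ) : ℂ) ∈ Metric.ball (c₂ : ℂ) R₂ := fun j => by
    rw [Metric.mem_ball, Complex.dist_eq, ← Complex.ofReal_sub, Complex.norm_real]
    exact hq₂ j
  have h0mem : (0 : ℂ) ∈ Metric.ball (c₁ : ℂ) R₁ := by
    simpa [Complex.dist_eq] using h0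
  have hsep : ∀ η ∈ Metric.sphere (c₁ : ℂ) R₁, η ∉ Metric.closedBall (c₂ : ℂ) R₂ := by
    intro η hη hη'
    have h1 := dist_triangle (c₁ : ℂ) η c₂
    rw [dist_comm (c₁ : ℂ) η, Metric.mem_sphere.1 hη, Complex.dist_eq, ← Complex.ofReal_sub,
      Complex.norm_real, Real.norm_eq_abs] at h1
    have h2 := Metric.mem_closedBall.1 hη'
    linarith
  have hF : DifferentiableOn ℂ (fun ζ => ζ ^ N * FbesC κ y ζ) (Metric.closedBall (c₂ : ℂ) R₂) := by
    intro ζ hζ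
    refine ((differentiableAt_id.pow N).mul
      (FbesC_differentiableAt κ hy ?_)).differentiableWithinAt
    have h1 := (Complex.abs_re_le_norm (ζ - c₂)).trans (mem_closedBall_iff_norm.1 hζ)
    rw [Complex.sub_re, Complex.ofReal_re] at h1
    linarith [(abs_le.1 h1).1]
  have hinner : Set.EqOn
      (fun η => ∮ ζ in C((c₂ : ℂ), R₂), (ζ / η) ^ N * EbesC κ η x * FbesC κ y ζ / (η - ζ)
        * ∏ l : Fin (N + ν), (η - ((α * q l : ℝ) : ℂ)) / (ζ - ((α * q l : ℝ) : ℂ)))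
      (fun η => 2 * Real.pi * Complex.I * ((η ^ N)⁻¹ *
        (∑ n ∈ range N, EbesCoeff κ x n * η ^ n +
          η ^ N * ∑' n : ℕ, η ^ n * EbesCoeff κ x (n + N)) *
        (∑ j, Polynomial.C (((α * q j : ℝ) : ℂ) ^ N * FbesC κ y (α * q j : ℝ)) * P j).eval η))
      (Metric.sphere (c₁ : ℂ) R₁) := by
    intro η hη
    have h := circleIntegral_lagrange hpC hR₂ hpc (hsep η hη) hF
    simp only
    rw [← EbesC_eq_sum_add, Polynomial.eval_finsetSum]
    simp only [Polynomial.eval_mul, Polynomial.eval_C]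
    rw [mul_left_comm, ← h, ← circleIntegral.integral_const_mul]
    congr 1
    ext ζ
    rw [div_pow]
    ring
  rw [circleIntegral.integral_congr hR₁.le hinner, circleIntegral.integral_const_mul,
    circleIntegral_inv_pow_mul_eval N h0mem _ (differentiable_tsum_EbesCoeff κ N x),
    ← mul_assoc (2 * (Real.pi : ℂ) * Complex.I), ← sq, ← mul_assoc,
    inv_mul_cancel₀ (pow_ne_zero _ Complex.two_pi_I_ne_zero), one_mul,
    ← Fin.sum_univ_eq_sum_range (fun n => EbesCoeff κ x n * (∑ j, Polynomial.C
      (((α * q j : ℝ) : ℂ) ^ N * FbesC κ y (α * q j : ℝ)) * P j).coeff (N - 1 - n)),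
    Complex.ofReal_sum]
  refine sum_congr rfl fun m _ => ?_
  rw [Complex.ofReal_sum, Polynomial.finsetSum_coeff, mul_sum]
  refine sum_congr rfl fun j _ => ?_
  have hcoeff : (P j).coeff (N - 1 - m) =
      (((Lagrange.basis univ (fun i => α * q i) j).coeff (N - 1 - m) : ℝ) : ℂ) := by
    exact (congrArg (Polynomial.coeff · (N - 1 - m))
      (map_lagrange_basis Complex.ofRealHom univ (fun i => α * q i) j).symm).trans
      (Polynomial.coeff_map _ _)
  rw [Polynomial.coeff_C_mul, hcoeff, FbesC_ofReal, Matrix.inv_eq_right_inv hAB, Matrix.of_apply,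
    if_neg (by simp), Nat.add_sub_cancel_left, EbesCoeff, add_comm κ]
  have hα' : (α : ℂ) ≠ 0 := by exact_mod_cast hα.ne'
  have h1 : ((m : ℕ).factorial : ℂ) ≠ 0 := by exact_mod_cast (m : ℕ).factorial_ne_zero
  have h2 : (((m : ℕ) + κ).factorial : ℂ) ≠ 0 := by exact_mod_cast ((m : ℕ) + κ).factorial_ne_zero
  push_cast
  field_simp
end
end

section
/- Let N, k, l ≥ 0 be integers with N ≥ 1. Let ψ_1,…,ψ_{N+k} and φ_1,…,φ_{N+l} be measurable complex-valued functions on (0,∞) such that t ↦ ψ_a(t) φ_b(t) is integrable on (0,∞) for every a and b, let R be a complex k×(N+k) matrix and S a complex (N+l)×l matrix. For x ∈ (0,∞)^N let M_1(x) be the (N+k)×(N+k) matrix whose first k rows equal R and whose remaining N rows are (M_1(x))_{k+a, b} = ψ_b(x_a) for 1 ≤ a ≤ N, and let M_2(x) be the (N+l)×(N+l) matrix whose first l columns equal S and whose remaining N columns are (M_2(x))_{b, l+a} = φ_b(x_a) for 1 ≤ a ≤ N. Then ∫_{(0,∞)^N} det M_1(x) · det M_2(x) dx_1 ⋯ dx_N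 = (−1)^{kl} · N! · det B, where B is the (k+N+l)×(k+N+l) block matrix B = [[0_{k×l}, R], [S, G]] with G the (N+l)×(N+k) matrix G_{b,a} = ∫_0^∞ φ_b(t) ψ_a(t) dt. -/
open MeasureTheory Matrix Finset

noncomputable section

section BorderedMatrix

variable {κ ι ν A : Type*} [DecidableEq κ] [DecidableEq ι] [DecidableEq ν] [CommRing A]

/-- The block matrix `[[0, R], [S, G]]` with its first block row moved below the rows of `S` and
`G` indexed by `ι`, so that rows and columns have the same index type. -/
def bordered (R : Matrix κ (κ ⊕ ν) A) (S : Matrix (ι ⊕ ν) ι A)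
    (G : Matrix (ι ⊕ ν) (κ ⊕ ν) A) : Matrix (ι ⊕ (κ ⊕ ν)) (ι ⊕ (κ ⊕ ν)) A :=
  fromBlocks (S.submatrix Sum.inl id) (G.submatrix Sum.inl id)
    (fromRows 0 (S.submatrix Sum.inr id)) (fromRows R (G.submatrix Sum.inr id))

/-- The matrix whose column `c` is the standard basis vector at `f c`. -/
def basisColumns (f : ι → ι ⊕ ν) : Matrix (ι ⊕ ν) ι A :=
  of fun b c => if b = f c then 1 else 0

variable [Fintype κ] [Fintype ι] [Fintype ν]

theorem det_bordered_eq_sum (R : Matrix κ (κ ⊕ ν) A) (S : Matrix (ι ⊕ ν) ι A)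
    (G : Matrix (ι ⊕ ν) (κ ⊕ ν) A) :
    (bordered R S G).det =
      ∑ f : ι → ι ⊕ ν, (∏ c, S (f c) c) * (bordered R (basisColumns f) G).det := by
  let e : ι ⊕ ν → ι ⊕ (κ ⊕ ν) → A := fun b => Pi.single (Sum.map id Sum.inr b) 1
  let D := (detRowAlternating (n := ι ⊕ (κ ⊕ ν)) (R := A)).toMultilinearMap.currySum
  have key : ∀ S : Matrix (ι ⊕ ν) ι A, (bordered R S G).det =
      D (fun c => ∑ b, S b c • e b) (fun j i => bordered R 0 G i (Sum.inr j)) := by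
    intro S
    rw [← det_transpose]
    change _ = det (Sum.elim (fun c => ∑ b, S b c • e b)
      (fun j i => bordered R 0 G i (Sum.inr j)) : Matrix _ _ A)
    congr 1
    ext (c | j) (i | i | i)
    all_goals simp [bordered, e, Finset.sum_apply, Pi.single_apply]
  rw [key, MultilinearMap.map_sum, _root_.sum_apply]
  refine Finset.sum_congr rfl fun f _ => ?_
  rw [MultilinearMap.map_smul_univ, key, _root_.smul_apply, smul_eq_mul]
  congr 3
  funext c
  simp only [basisColumns, of_apply, ite_smul, one_smul, zero_smul, Finset.sum_ite_eq',
    Finset.mem_univ, if_true]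

theorem det_bordered_basisColumns_eq_zero (R : Matrix κ (κ ⊕ ν) A)
    (G : Matrix (ι ⊕ ν) (κ ⊕ ν) A) {f : ι → ι ⊕ ν} (hf : ¬ Function.Injective f) :
    (bordered R (basisColumns f) G).det = 0 := by
  obtain ⟨c, c', h, hne⟩ := Function.not_injective_iff.mp hf
  refine det_zero_of_column_eq (i := Sum.inl c) (j := Sum.inl c') (by simpa using hne) ?_
  rintro (i | i | i) <;> simp [bordered, basisColumns, h]

theorem det_bordered_basisColumns_perm (R : Matrix κ (κ ⊕ ν) A)
    (G : Matrix (ι ⊕ ν) (κ ⊕ ν) A) (σ : Equiv.Perm (ι ⊕ ν)) :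
    (bordered R (basisColumns (σ ∘ Sum.inl)) G).det =
      (Equiv.Perm.sign σ : A) * (fromRows R (G.submatrix (σ ∘ Sum.inr) id)).det := by
  let s : κ ⊕ (ι ⊕ ν) ≃ ι ⊕ (κ ⊕ ν) :=
    { toFun := Sum.elim (Sum.inr ∘ Sum.inl) (Sum.map id Sum.inr)
      invFun := Sum.elim (Sum.inr ∘ Sum.inl) (Sum.map id Sum.inr)
      left_inv := by rintro (i | i | i) <;> rfl
      right_inv := by rintro (i | i | i) <;> rfl }
  let τ : Equiv.Perm (ι ⊕ (κ ⊕ ν)) := s.permCongr (Equiv.Perm.sumCongr 1 σ)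
  have hsign : Equiv.Perm.sign τ = Equiv.Perm.sign σ := by
    simp [τ, Equiv.Perm.sign_permCongr, Equiv.Perm.sign_sumCongr]
  have hs : ∀ b, s (Sum.inr b) = Sum.map id Sum.inr b := fun b => rfl
  have hrow : ∀ b j, bordered R (basisColumns (σ ∘ Sum.inl)) G (Sum.map id Sum.inr b) j =
      Sum.elim (basisColumns (σ ∘ Sum.inl) b) (G b) j := by
    rintro (b | b) (j | j) <;> rfl
  have hsub : (bordered R (basisColumns (σ ∘ Sum.inl)) G).submatrix τ id =
      fromBlocks 1 (G.submatrix (σ ∘ Sum.inl) id) 0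
        (fromRows R (G.submatrix (σ ∘ Sum.inr) id)) := by
    ext (i | i | i) j
    · have : τ (Sum.inl i) = Sum.map id Sum.inr (σ (Sum.inl i)) := rfl
      rw [submatrix_apply, this, hrow]
      rcases j with j | j <;> simp [basisColumns, one_apply]
    · have : τ (Sum.inr (Sum.inl i)) = Sum.inr (Sum.inl i) := rfl
      rw [submatrix_apply, this]
      rcases j with j | j <;> simp [bordered]
    · have : τ (Sum.inr (Sum.inr i)) = Sum.map id Sum.inr (σ (Sum.inr i)) := rfl
      rw [submatrix_apply, this, hrow]
      rcases j with j | j <;> simp [basisColumns]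
  have hdet := det_permute τ (bordered R (basisColumns (σ ∘ Sum.inl)) G)
  rw [hsub, det_fromBlocks_zero₂₁, det_one, one_mul, hsign] at hdet
  rw [hdet, ← mul_assoc, ← Int.cast_mul, ← Units.val_mul, Int.units_mul_self]
  simp

theorem card_perm_extending {f : ι → ι ⊕ ν} (hf : Function.Injective f) :
    #{σ : Equiv.Perm (ι ⊕ ν) | σ ∘ Sum.inl = f} = (Fintype.card ν).factorial := by
  obtain ⟨σ₀, hσ₀⟩ := Equiv.Perm.exists_extending_pair (Sum.inl : ι → ι ⊕ ν) f
    Sum.inl_injective hf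
  rw [← Fintype.card_perm, ← Finset.card_univ]
  symm
  refine Finset.card_bij (fun τ _ => σ₀ * Equiv.Perm.sumCongr 1 τ) ?_ ?_ ?_
  · intro τ _
    simpa [funext_iff] using hσ₀
  · intro τ _ τ' _ h
    ext a
    simpa using Equiv.congr_fun (mul_left_cancel h) (Sum.inr a)
  · intro σ hσ
    have hfix : ∀ i, (σ₀⁻¹ * σ) (Sum.inl i) = Sum.inl i := fun i => by
      rw [Equiv.Perm.mul_apply, Equiv.Perm.inv_eq_iff_eq, hσ₀]
      exact congrFun (Finset.mem_filter.mp hσ).2 i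
    obtain ⟨⟨τ₁, τ₂⟩, hτ⟩ := Equiv.Perm.mem_sumCongrHom_range_of_perm_mapsTo_inl
      (σ := σ₀⁻¹ * σ) (by rintro _ ⟨i, rfl⟩; exact ⟨i, (hfix i).symm⟩)
    rw [Equiv.Perm.sumCongrHom_apply] at hτ
    have h₁ : τ₁ = 1 := by
      ext i
      have := Equiv.congr_fun hτ (Sum.inl i)
      rw [hfix] at this
      simpa using this
    refine ⟨τ₂, Finset.mem_univ _, ?_⟩
    rw [← h₁]
    exact mul_eq_of_eq_inv_mul hτ

theorem sum_perm_comp_inl (F : (ι → ι ⊕ ν) → A) (hF : ∀ f, ¬ Function.Injective f → F f = 0) :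
    ∑ σ : Equiv.Perm (ι ⊕ ν), F (σ ∘ Sum.inl) =
      ((Fintype.card ν).factorial : A) * ∑ f, F f := by
  rw [← Finset.sum_fiberwise_of_maps_to (s := Finset.univ) (t := Finset.univ)
    (g := fun σ : Equiv.Perm (ι ⊕ ν) => (σ ∘ Sum.inl : ι → ι ⊕ ν)) (fun _ _ => Finset.mem_univ _),
    Finset.mul_sum]
  refine Finset.sum_congr rfl fun f _ => ?_
  rw [Finset.sum_congr rfl fun σ hσ => by rw [(Finset.mem_filter.mp hσ).2]]
  by_cases hf : Function.Injective f
  · rw [Finset.sum_const, card_perm_extending hf, nsmul_eq_mul]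
  · simp [hF f hf]

theorem sum_sign_mul_det_fromRows (R : Matrix κ (κ ⊕ ν) A) (S : Matrix (ι ⊕ ν) ι A)
    (G : Matrix (ι ⊕ ν) (κ ⊕ ν) A) :
    ∑ σ : Equiv.Perm (ι ⊕ ν), (Equiv.Perm.sign σ : A) * (∏ c, S (σ (Sum.inl c)) c) *
        (fromRows R (G.submatrix (σ ∘ Sum.inr) id)).det =
      ((Fintype.card ν).factorial : A) * (bordered R S G).det := by
  rw [det_bordered_eq_sum, ← sum_perm_comp_inl
    (fun f => (∏ c, S (f c) c) * (bordered R (basisColumns f) G).det)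
    (fun f hf => by simp [det_bordered_basisColumns_eq_zero R G hf])]
  refine Finset.sum_congr rfl fun σ _ => ?_
  rw [det_bordered_basisColumns_perm]
  simp only [Function.comp_apply]
  ring

end BorderedMatrix

section Integral

variable {κ ι ν X : Type*} [DecidableEq κ] [DecidableEq ι] [DecidableEq ν]
  [Fintype κ] [Fintype ι] [Fintype ν] [MeasurableSpace X] (μ : Measure X) [SigmaFinite μ]

theorem det_fromRows_eq_sum (R : Matrix κ (κ ⊕ ν) ℂ) (Q : Matrix ν (κ ⊕ ν) ℂ) :
    (fromRows R Q).det = ∑ τ : Equiv.Perm (κ ⊕ ν), (Equiv.Perm.sign τ : ℂ) *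
      ((∏ i, R i (τ (Sum.inl i))) * ∏ a, Q a (τ (Sum.inr a))) := by
  rw [← det_transpose, det_apply']
  simp [Fintype.prod_sum_type]

theorem det_fromCols_eq_sum (S : Matrix (ι ⊕ ν) ι ℂ) (Q : Matrix (ι ⊕ ν) ν ℂ) :
    (fromCols S Q).det = ∑ σ : Equiv.Perm (ι ⊕ ν), (Equiv.Perm.sign σ : ℂ) *
      ((∏ c, S (σ (Sum.inl c)) c) * ∏ a, Q (σ (Sum.inr a)) a) := by
  rw [det_apply']
  simp [Fintype.prod_sum_type]

/-- The generalised Andréief formula for an arbitrary σ-finite measure. -/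
theorem integral_det_fromRows_mul_det_fromCols
    (ψ : κ ⊕ ν → X → ℂ) (φ : ι ⊕ ν → X → ℂ)
    (hint : ∀ a b, Integrable (fun t => φ b t * ψ a t) μ)
    (R : Matrix κ (κ ⊕ ν) ℂ) (S : Matrix (ι ⊕ ν) ι ℂ) :
    ∫ x : ν → X, (fromRows R (of fun a b => ψ b (x a))).det *
        (fromCols S (of fun b a => φ b (x a))).det ∂(Measure.pi fun _ => μ) =
      ((Fintype.card ν).factorial : ℂ) *
        (bordered R S (of fun b a => ∫ t, φ b t * ψ a t ∂μ)).det := by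
  have hI : ∀ (σ : Equiv.Perm (ι ⊕ ν)) (τ : Equiv.Perm (κ ⊕ ν)),
      Integrable (fun x : ν → X => ∏ a, φ (σ (Sum.inr a)) (x a) * ψ (τ (Sum.inr a)) (x a))
        (Measure.pi fun _ => μ) := fun σ τ =>
    Integrable.fintype_prod (f := fun a t => φ (σ (Sum.inr a)) t * ψ (τ (Sum.inr a)) t)
      (μ := fun _ => μ) fun a => hint _ _
  have hexp : ∀ x : ν → X, (fromRows R (of fun a b => ψ b (x a))).det *
        (fromCols S (of fun b a => φ b (x a))).det =
      ∑ σ : Equiv.Perm (ι ⊕ ν), ∑ τ : Equiv.Perm (κ ⊕ ν),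
        ((Equiv.Perm.sign σ : ℂ) * (∏ c, S (σ (Sum.inl c)) c) *
          ((Equiv.Perm.sign τ : ℂ) * ∏ i, R i (τ (Sum.inl i)))) *
        ∏ a, φ (σ (Sum.inr a)) (x a) * ψ (τ (Sum.inr a)) (x a) := by
    intro x
    rw [det_fromRows_eq_sum, det_fromCols_eq_sum, mul_comm, Finset.sum_mul_sum]
    refine Finset.sum_congr rfl fun σ _ => Finset.sum_congr rfl fun τ _ => ?_
    simp only [of_apply, Finset.prod_mul_distrib]
    ring
  simp_rw [hexp]
  rw [integral_finsetSum _ fun σ _ => integrable_finsetSum _ fun τ _ => (hI σ τ).const_mul _,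
    ← sum_sign_mul_det_fromRows]
  refine Finset.sum_congr rfl fun σ _ => ?_
  rw [integral_finsetSum _ fun τ _ => (hI σ τ).const_mul _, det_fromRows_eq_sum, Finset.mul_sum]
  refine Finset.sum_congr rfl fun τ _ => ?_
  rw [integral_const_mul, integral_fintype_prod_eq_prod (μ := fun _ => μ)
    (fun a t => φ (σ (Sum.inr a)) t * ψ (τ (Sum.inr a)) t)]
  simp only [submatrix_apply, of_apply, Function.comp_apply, id]
  ring

end Integral

section FinIndices

theorem coe_finRotate_eq_mod {n : ℕ} (i : Fin n) : (finRotate n i : ℕ) = (i + 1) % n := by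
  cases n with
  | zero => exact i.elim0
  | succ n =>
    rw [finRotate_apply, Fin.val_add, Fin.val_one']
    simp

theorem coe_finRotate_pow {n : ℕ} (m : ℕ) (i : Fin n) :
    ((finRotate n ^ m) i : ℕ) = (i + m) % n := by
  induction m with
  | zero => simp [Nat.mod_eq_of_lt i.isLt]
  | succ m ih =>
    rw [pow_succ', Equiv.Perm.mul_apply, coe_finRotate_eq_mod, ih, Nat.mod_add_mod, add_assoc]

theorem sign_finRotate_add_pow (k l : ℕ) :
    Equiv.Perm.sign (finRotate (l + k) ^ k) = (-1) ^ (k * l) := by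
  rw [map_pow, sign_finRotate, ← pow_mul]
  rcases k with _ | k
  · simp
  · have h : (l + (k + 1) - 1) * (k + 1) = (k + 1) * l + k * (k + 1) := by
      rw [← add_assoc, Nat.add_sub_cancel]; ring
    rw [h, pow_add, (Nat.even_mul_succ_self k).neg_one_pow, mul_one]

/-- The order-preserving equivalence listing the second summand after the first one. -/
def sumFinEquiv (m n : ℕ) : Fin m ⊕ Fin n ≃ Fin (n + m) :=
  finSumFinEquiv.trans (finCongr (Nat.add_comm m n))

@[simp] theorem sumFinEquiv_inl {m n : ℕ} (i : Fin m) :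
    sumFinEquiv m n (Sum.inl i) = ⟨i, by omega⟩ := by
  ext; simp [sumFinEquiv]

@[simp] theorem sumFinEquiv_inr {m n : ℕ} (i : Fin n) :
    sumFinEquiv m n (Sum.inr i) = ⟨m + i, by omega⟩ := by
  ext; simp [sumFinEquiv, Nat.add_comm]

/-- The order-preserving equivalence listing three summands one after the other. -/
def sumSumFinEquiv (l k N : ℕ) : Fin l ⊕ (Fin k ⊕ Fin N) ≃ Fin (k + N + l) :=
  (Equiv.sumCongr (Equiv.refl _) finSumFinEquiv).trans (sumFinEquiv l (k + N))

@[simp] theorem coe_sumSumFinEquiv_inl {l k N : ℕ} (i : Fin l) :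
    (sumSumFinEquiv l k N (Sum.inl i) : ℕ) = i := by simp [sumSumFinEquiv]

@[simp] theorem coe_sumSumFinEquiv_inr_inl {l k N : ℕ} (i : Fin k) :
    (sumSumFinEquiv l k N (Sum.inr (Sum.inl i)) : ℕ) = l + i := by simp [sumSumFinEquiv]

@[simp] theorem coe_sumSumFinEquiv_inr_inr {l k N : ℕ} (a : Fin N) :
    (sumSumFinEquiv l k N (Sum.inr (Sum.inr a)) : ℕ) = l + (k + a) := by simp [sumSumFinEquiv]

/-- The permutation moving the block of the first `l` indices behind the following `k` ones has
sign `(-1) ^ (k * l)`. -/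
theorem exists_perm_swap_blocks (l k N : ℕ) :
    ∃ τ : Equiv.Perm (Fin l ⊕ (Fin k ⊕ Fin N)), Equiv.Perm.sign τ = (-1) ^ (k * l) ∧
      (∀ i, (sumSumFinEquiv l k N (τ (Sum.inl i)) : ℕ) = k + i) ∧
      (∀ i, (sumSumFinEquiv l k N (τ (Sum.inr (Sum.inl i))) : ℕ) = i) ∧
      ∀ a, (sumSumFinEquiv l k N (τ (Sum.inr (Sum.inr a))) : ℕ) = k + (l + a) := by
  let e : Fin (l + k) ⊕ Fin N ≃ Fin l ⊕ (Fin k ⊕ Fin N) :=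
    (Equiv.sumCongr finSumFinEquiv.symm (Equiv.refl _)).trans (Equiv.sumAssoc _ _ _)
  have he : ∀ j, (sumSumFinEquiv l k N (e (Sum.inl j)) : ℕ) = j := by
    intro j
    obtain ⟨j | j, rfl⟩ := finSumFinEquiv.surjective j <;> simp [e]
  let ρ : Equiv.Perm (Fin (l + k) ⊕ Fin N) := Equiv.Perm.sumCongr (finRotate (l + k) ^ k) 1
  refine ⟨e.permCongr ρ, ?_, fun i => ?_, fun i => ?_, fun a => ?_⟩
  · rw [Equiv.Perm.sign_permCongr, Equiv.Perm.sign_sumCongr, sign_finRotate_add_pow]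
    simp
  · have h : e.permCongr ρ (Sum.inl i) =
        e (Sum.inl ((finRotate (l + k) ^ k) (finSumFinEquiv (Sum.inl i)))) := rfl
    rw [h, he, coe_finRotate_pow, finSumFinEquiv_apply_left, Fin.val_castAdd,
      Nat.mod_eq_of_lt (by omega), Nat.add_comm]
  · have h : e.permCongr ρ (Sum.inr (Sum.inl i)) =
        e (Sum.inl ((finRotate (l + k) ^ k) (finSumFinEquiv (Sum.inr i)))) := rfl
    rw [h, he, coe_finRotate_pow]
    have : ((finSumFinEquiv (Sum.inr i) : Fin (l + k)) : ℕ) + k = i + (l + k) := by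
      simp; omega
    rw [this, Nat.add_mod_right, Nat.mod_eq_of_lt (by omega)]
  · have h : e.permCongr ρ (Sum.inr (Sum.inr a)) = Sum.inr (Sum.inr a) := rfl
    rw [h, coe_sumSumFinEquiv_inr_inr, Nat.add_left_comm]

end FinIndices

/-- The generalised Andréief (de Bruijn-type) integration formula, equation (2.14):
the `N`-fold integral of a product of two determinants, each augmented by constant rows
respectively columns, equals a single block determinant of pairwise integrals. -/
theorem statement10
    (N k l : ℕ) (hN : 1 ≤ N)
    (ψ : Fin (N + k) → ℝ → ℂ) (φ : Fin (N + l) → ℝ → ℂ)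
    (hψ : ∀ a, Measurable (ψ a)) (hφ : ∀ b, Measurable (φ b))
    (hint : ∀ a b, IntegrableOn (fun t => ψ a t * φ b t) (Set.Ioi 0))
    (R : Matrix (Fin k) (Fin (N + k)) ℂ) (S : Matrix (Fin (N + l)) (Fin l) ℂ) :
    (∫ x in (Set.univ.pi fun _ : Fin N => Set.Ioi (0 : ℝ)),
        (Matrix.of fun r b : Fin (N + k) =>
          if h : (r : ℕ) < k then R ⟨(r : ℕ), h⟩ b
          else ψ b (x ⟨(r : ℕ) - k, by have := r.isLt; omega⟩)).det
        * (Matrix.of fun b c : Fin (N + l) =>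
          if h : (c : ℕ) < l then S b ⟨(c : ℕ), h⟩
          else φ b (x ⟨(c : ℕ) - l, by have := c.isLt; omega⟩)).det)
    = (-1 : ℂ) ^ (k * l) * (N.factorial : ℂ) *
        (Matrix.of fun r c : Fin (k + N + l) =>
          if hr : (r : ℕ) < k then
            if hc : (c : ℕ) < l then 0
            else R ⟨(r : ℕ), hr⟩ ⟨(c : ℕ) - l, by have := c.isLt; omega⟩
          else
            if hc : (c : ℕ) < l then
              S ⟨(r : ℕ) - k, by have := r.isLt; omega⟩ ⟨(c : ℕ), hc⟩
            else
              ∫ t in Set.Ioi (0 : ℝ),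
                φ ⟨(r : ℕ) - k, by have := r.isLt; omega⟩ t
                  * ψ ⟨(c : ℕ) - l, by have := c.isLt; omega⟩ t).det := by
  set e₁ := sumFinEquiv k N
  set e₂ := sumFinEquiv l N
  let μ : Measure ℝ := volume.restrict (Set.Ioi 0)
  have hμ : (volume : Measure (Fin N → ℝ)).restrict (Set.univ.pi fun _ => Set.Ioi (0 : ℝ)) =
      Measure.pi fun _ => μ := by
    rw [volume_pi, Measure.restrict_pi_pi]
  have key := integral_det_fromRows_mul_det_fromCols μ (fun b => ψ (e₁ b)) (fun b => φ (e₂ b))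
    (fun a b => (hint (e₁ a) (e₂ b)).congr (.of_forall fun t => mul_comm _ _))
    (R.submatrix id e₁) (S.submatrix e₂ id)
  obtain ⟨τ, hτ, hl, hk, hν⟩ := exists_perm_swap_blocks l k N
  rw [hμ]
  refine Eq.trans (integral_congr_ae (Filter.Eventually.of_forall fun x => ?_)) (key.trans ?_)
  · dsimp only
    rw [← det_submatrix_equiv_self e₁, ← det_submatrix_equiv_self e₂]
    congr 2
    · ext (i | a) b <;> simp [e₁]
    · ext b (i | a) <;> simp [e₂]
  · rw [Fintype.card_fin, mul_comm ((-1 : ℂ) ^ (k * l)), mul_assoc,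
      ← det_submatrix_equiv_self (sumSumFinEquiv l k N)]
    congr 1
    have hsgn : (Equiv.Perm.sign τ : ℂ) = (-1) ^ (k * l) := by rw [hτ]; simp
    rw [← hsgn, ← det_permute]
    congr 1
    ext (i | i | i) (j | j | j)
    all_goals simp [bordered, hl, hk, hν, μ, e₁, e₂]
end
end

section
/- Let N ≥ 1 and ν ≥ 0 be integers, M = N+ν. Let p_1,…,p_M be pairwise distinct complex numbers, δ_1,…,δ_N pairwise distinct complex numbers with p_i ≠ δ_k for all i,k, and d_1,…,d_N nonzero complex numbers. Let A be the M×M matrix with entries A_{i,k} = p_i^{k−1} for 1 ≤ k ≤ ν and A_{i,ν+k} = d_k / (p_i − δ_k) for 1 ≤ k ≤ N. Then A is invertible, and for every 1 ≤ l ≤ M and every z ∈ ℂ with z ∉ {δ_1,…,δ_N}, Σ_{k=1}^{ν} z^{k−1} (A^{−1})_{k,l} + Σ_{k=1}^{N} d_k (A^{−1})_{ν+k,l} / (z − δ_k) = ∏_{i≠l} (z − p_i)/(p_l − p_i) · ∏_{k=1}^{N} (p_l − δ_k)/(z − δ_k). -/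
open Matrix Finset

noncomputable section

open Polynomial in
/-- The numerator of `∑ a k * X ^ k + ∑ b k / (X - δ k)` over the common denominator
`∏ (X - δ k)`. -/
def partialFractionNumerator {K : Type*} [Field K] {N ν : ℕ} (δ : Fin N → K)
    (a : Fin ν → K) (b : Fin N → K) : K[X] :=
  (∑ k : Fin ν, C (a k) * X ^ (k : ℕ)) * (∏ k, (X - C (δ k)))
    + ∑ k, C (b k) * ∏ j ∈ univ.erase k, (X - C (δ j))

namespace partialFractionNumerator

open Polynomial

variable {K : Type*} [Field K] {N ν : ℕ} (δ : Fin N → K) (a : Fin ν → K) (b : Fin N → K)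

theorem degree_lt : (partialFractionNumerator δ a b).degree < ((N + ν : ℕ) : WithBot ℕ) := by
  rw [← mem_degreeLT]
  refine Submodule.add_mem _ ?_ (Submodule.sum_mem _ fun k _ => ?_)
  · rw [Finset.sum_mul]
    refine Submodule.sum_mem _ fun k _ => ?_
    rw [mem_degreeLT, degree_mul, degree_prod]
    simp only [degree_X_sub_C, Finset.sum_const, card_univ, Fintype.card_fin, nsmul_eq_mul, mul_one]
    refine (add_le_add_left (degree_C_mul_X_pow_le _ _) _).trans_lt ?_
    have := k.isLt
    norm_cast
    omega
  · rw [mem_degreeLT, degree_mul, degree_prod]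
    simp only [degree_X_sub_C, Finset.sum_const, card_erase_of_mem (mem_univ k), card_univ,
      Fintype.card_fin, nsmul_eq_mul, mul_one]
    refine (add_le_add_left degree_C_le _).trans_lt ?_
    have := k.isLt
    rw [zero_add]
    norm_cast
    omega

theorem eval_of_ne {z : K} (hz : ∀ k, z ≠ δ k) :
    (partialFractionNumerator δ a b).eval z =
      (∑ k : Fin ν, z ^ (k : ℕ) * a k + ∑ k, b k / (z - δ k)) * ∏ k, (z - δ k) := by
  simp only [partialFractionNumerator, eval_add, eval_mul, eval_finsetSum, eval_prod, eval_sub,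
    eval_X, eval_C, eval_pow, add_mul]
  congr 1
  · simp only [mul_comm]
  · rw [Finset.sum_mul]
    refine Finset.sum_congr rfl fun k _ => ?_
    have := sub_ne_zero.mpr (hz k)
    rw [← Finset.mul_prod_erase univ (fun j => z - δ j) (mem_univ k)]
    field_simp

theorem eval_pole (k : Fin N) :
    (partialFractionNumerator δ a b).eval (δ k) = b k * ∏ j ∈ univ.erase k, (δ k - δ j) := by
  simp only [partialFractionNumerator, eval_add, eval_mul, eval_finsetSum, eval_prod, eval_sub,
    eval_X, eval_C]
  rw [Finset.prod_eq_zero (mem_univ k) (sub_self _), mul_zero, zero_add]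
  refine Finset.sum_eq_single k (fun j _ hj => ?_) (by simp)
  rw [Finset.prod_eq_zero (mem_erase.mpr ⟨hj.symm, mem_univ k⟩) (sub_self _), mul_zero]

variable {δ a b}

theorem eq_zero (hδ : Function.Injective δ) (h : partialFractionNumerator δ a b = 0) :
    a = 0 ∧ b = 0 := by
  have hb : b = 0 := by
    funext k
    have hk := eval_pole δ a b k
    rw [h, eval_zero, eq_comm, mul_eq_zero] at hk
    refine hk.resolve_right (Finset.prod_ne_zero_iff.mpr fun j hj => sub_ne_zero.mpr fun e => ?_)
    exact (mem_erase.mp hj).1 (hδ e).symm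
  refine ⟨?_, hb⟩
  have hprod : (∏ k, (X - C (δ k))) ≠ 0 :=
    Finset.prod_ne_zero_iff.mpr fun k _ => X_sub_C_ne_zero _
  have ha : (∑ k : Fin ν, C (a k) * X ^ (k : ℕ)) = 0 := by
    simpa [partialFractionNumerator, hb, hprod] using h
  funext k
  have := congrArg (fun q => q.coeff (k : ℕ)) ha
  simpa [finsetSum_coeff, coeff_X_pow, Fin.val_inj] using this

end partialFractionNumerator

/-- The key lemma in the proofs of Theorems 3.3 and 3.5: the `l`-th column of the
inverse of a mixed Vandermonde–Cauchy matrix is characterised as the coefficients of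
the unique rational function with zeros at the `p_i` (`i ≠ l`), poles at the `δ_k`,
and value `1` at `p_l`. -/
theorem statement11
    (N ν : ℕ) (hN : 1 ≤ N)
    (p : Fin (N + ν) → ℂ) (hp : Function.Injective p)
    (δ : Fin N → ℂ) (hδ : Function.Injective δ)
    (hpδ : ∀ i k, p i ≠ δ k)
    (d : Fin N → ℂ) (hd : ∀ k, d k ≠ 0)
    (A : Matrix (Fin (N + ν)) (Fin (N + ν)) ℂ)
    (hA : ∀ i c, A i c =
      if h : (c : ℕ) < ν then p i ^ (c : ℕ)
      else d ⟨(c : ℕ) - ν, by have := c.isLt; omega⟩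
            / (p i - δ ⟨(c : ℕ) - ν, by have := c.isLt; omega⟩)) :
    IsUnit A.det ∧
    ∀ l : Fin (N + ν), ∀ z : ℂ, (∀ k, z ≠ δ k) →
      (∑ k : Fin ν, z ^ (k : ℕ) * A⁻¹ ⟨(k : ℕ), by have := k.isLt; omega⟩ l)
        + (∑ k : Fin N,
            d k * A⁻¹ ⟨ν + (k : ℕ), by have := k.isLt; omega⟩ l / (z - δ k))
      = (∏ i ∈ Finset.univ.erase l, (z - p i) / (p l - p i))
          * ∏ k : Fin N, (p l - δ k) / (z - δ k) := by
  set a : (Fin (N + ν) → ℂ) → Fin ν → ℂ := fun v k => v ⟨(k : ℕ), by have := k.isLt; omega⟩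
  set b : (Fin (N + ν) → ℂ) → Fin N → ℂ :=
    fun v k => d k * v ⟨ν + (k : ℕ), by have := k.isLt; omega⟩ with hb
  have hmul (v i) : (A *ᵥ v) i =
      ∑ k : Fin ν, p i ^ (k : ℕ) * a v k + ∑ k, b v k / (p i - δ k) := by
    rw [Matrix.mulVec, dotProduct, ← (finCongr (add_comm ν N)).sum_comp, Fin.sum_univ_add]
    congr 1
    · refine Finset.sum_congr rfl fun k _ => ?_
      rw [hA, dif_pos (by simp)]
      rfl
    · refine Finset.sum_congr rfl fun k _ => ?_
      rw [hA, dif_neg (by simp)]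
      simp only [finCongr_apply, Fin.val_cast, Fin.val_natAdd, add_tsub_cancel_left, Fin.eta, hb]
      rw [div_mul_eq_mul_div]
      rfl
  have heval (v i) : (partialFractionNumerator δ (a v) (b v)).eval (p i) =
      (A *ᵥ v) i * ∏ k, (p i - δ k) := by
    rw [partialFractionNumerator.eval_of_ne _ _ _ (hpδ i), hmul]
  have hdet : IsUnit A.det := by
    rw [isUnit_iff_ne_zero]
    intro h0
    obtain ⟨v, hv, hAv⟩ := Matrix.exists_mulVec_eq_zero_iff.mpr h0
    have hP : partialFractionNumerator δ (a v) (b v) = 0 := by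
      refine Polynomial.eq_zero_of_degree_lt_of_eval_index_eq_zero univ hp.injOn ?_ ?_
      · simpa using partialFractionNumerator.degree_lt δ (a v) (b v)
      · intro i _
        rw [heval, hAv, Pi.zero_apply, zero_mul]
    obtain ⟨hav, hbv⟩ := partialFractionNumerator.eq_zero hδ hP
    refine hv (funext fun c => ?_)
    by_cases hc : (c : ℕ) < ν
    · exact congrFun hav ⟨c, hc⟩
    · have hcl := c.isLt
      have h := congrFun hbv ⟨c - ν, by omega⟩
      simpa [hb, hd, Nat.add_sub_cancel' (not_lt.mp hc)] using h
  refine ⟨hdet, fun l z hz => ?_⟩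
  have hcol : A *ᵥ A⁻¹.col l = Pi.single l 1 := by
    funext i
    exact (congrFun (congrFun (Matrix.mul_nonsing_inv A hdet) i) l).trans
      (by simp [Matrix.one_apply, Pi.single_apply])
  have hP : partialFractionNumerator δ (a (A⁻¹.col l)) (b (A⁻¹.col l)) =
      Polynomial.C (∏ k, (p l - δ k)) * Lagrange.basis univ p l := by
    refine Polynomial.eq_of_degrees_lt_of_eval_index_eq univ hp.injOn ?_ ?_ ?_
    · simpa using partialFractionNumerator.degree_lt δ _ _
    · rw [Polynomial.degree_C_mul
        (Finset.prod_ne_zero_iff.mpr fun k _ => sub_ne_zero.mpr (hpδ l k)),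
        Lagrange.degree_basis hp.injOn (mem_univ l)]
      have := l.isLt
      simp only [card_univ, Fintype.card_fin]
      norm_cast
      omega
    · intro i _
      rw [heval, hcol, Polynomial.eval_mul, Polynomial.eval_C]
      rcases eq_or_ne i l with rfl | hi
      · rw [Lagrange.eval_basis_self hp.injOn (mem_univ i), Pi.single_eq_same, mul_comm]
      · rw [Lagrange.eval_basis_of_ne hi.symm (mem_univ i), Pi.single_eq_of_ne hi, mul_zero,
          zero_mul]
  have hz' : ∏ k, (z - δ k) ≠ 0 := Finset.prod_ne_zero_iff.mpr fun k _ => sub_ne_zero.mpr (hz k)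
  have h := partialFractionNumerator.eval_of_ne δ (a (A⁻¹.col l)) (b (A⁻¹.col l)) hz
  rw [hP, Polynomial.eval_mul, Polynomial.eval_C, Lagrange.basis, Polynomial.eval_prod] at h
  simp only [Lagrange.basisDivisor, Polynomial.eval_mul, Polynomial.eval_C, Polynomial.eval_sub,
    Polynomial.eval_X, inv_mul_eq_div] at h
  rw [Finset.prod_div_distrib (f := fun k => p l - δ k), ← mul_div_assoc, eq_div_iff hz',
    mul_comm (∏ i ∈ _, _)]
  exact h.symm
end
end

section
/- Let N ≥ 1 and ν ≥ 0 be integers, M = N+ν. Let p_1,…,p_M be pairwise distinct nonzero complex numbers and c_1,…,c_N nonzero complex numbers. Let A be the M×M matrix with entries A_{i,k} = p_i^{k−1} for 1 ≤ k ≤ ν and A_{i,ν+m} = c_m p_i^{−m} for 1 ≤ m ≤ N. Then A is invertible, and for every 1 ≤ l ≤ M and every z ∈ ℂ with z ≠ 0, Σ_{k=1}^{ν} z^{k−1} (A^{−1})_{k,l} + Σ_{m=1}^{N} c_m z^{−m} (A^{−1})_{ν+m,l} = (p_l/z)^N · ∏_{i≠l} (z − p_i)/(p_l − p_i). -/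
open Matrix Finset

noncomputable section

theorem sub_lt_of_not_lt {N ν : ℕ} (c : Fin (N + ν)) (h : ¬(c : ℕ) < ν) :
    (c : ℕ) - ν < N := by
  have := c.isLt
  omega

theorem val_lt_add_left (N : ℕ) {ν : ℕ} (k : Fin ν) : (k : ℕ) < N + ν := by
  have := k.isLt
  omega

theorem add_val_lt {N : ℕ} (ν : ℕ) (m : Fin N) : ν + (m : ℕ) < N + ν := by
  have := m.isLt
  omega

/-- The power of `z` carried by the `c`-th column after multiplication by `z ^ N`. -/
def mixedExponent (N ν : ℕ) (c : Fin (N + ν)) : ℕ :=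
  if (c : ℕ) < ν then N + c else N - 1 - (c - ν)

/-- The weight of the `c`-th column: `1` on the Vandermonde columns, `cc m` on the others. -/
def mixedWeight {N ν : ℕ} (cc : Fin N → ℂ) (c : Fin (N + ν)) : ℂ :=
  if h : (c : ℕ) < ν then 1 else cc ⟨(c : ℕ) - ν, sub_lt_of_not_lt c h⟩

/-- The polynomial obtained by clearing the pole at the origin in the combination of columns
with coefficients `x`. -/
def mixedPolynomial {N ν : ℕ} (cc : Fin N → ℂ) (x : Fin (N + ν) → ℂ) : Polynomial ℂ :=
  ∑ c, Polynomial.monomial (mixedExponent N ν c) (mixedWeight cc c * x c)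

theorem mixedExponent_lt {N ν : ℕ} (c : Fin (N + ν)) : mixedExponent N ν c < N + ν := by
  have := c.isLt
  unfold mixedExponent
  split_ifs <;> omega

theorem mixedExponent_injective (N ν : ℕ) : Function.Injective (mixedExponent N ν) := by
  intro a b h
  have ha := a.isLt
  have hb := b.isLt
  unfold mixedExponent at h
  ext
  split_ifs at h <;> omega

theorem mixedWeight_ne_zero {N ν : ℕ} {cc : Fin N → ℂ} (hcc : ∀ m, cc m ≠ 0)
    (c : Fin (N + ν)) : mixedWeight cc c ≠ 0 := by
  unfold mixedWeight
  split_ifs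
  · exact one_ne_zero
  · exact hcc _

theorem degree_mixedPolynomial_lt {N ν : ℕ} (cc : Fin N → ℂ) (x : Fin (N + ν) → ℂ) :
    (mixedPolynomial cc x).degree < ((N + ν : ℕ) : WithBot ℕ) := by
  rw [← Polynomial.mem_degreeLT]
  refine Submodule.sum_mem _ fun c _ => ?_
  rw [Polynomial.mem_degreeLT]
  exact (Polynomial.degree_monomial_le _ _).trans_lt (by exact_mod_cast mixedExponent_lt c)

theorem coeff_mixedPolynomial {N ν : ℕ} (cc : Fin N → ℂ) (x : Fin (N + ν) → ℂ)
    (c : Fin (N + ν)) :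
    (mixedPolynomial cc x).coeff (mixedExponent N ν c) = mixedWeight cc c * x c := by
  simp [mixedPolynomial, Polynomial.finsetSum_coeff, Polynomial.coeff_monomial,
    (mixedExponent_injective N ν).eq_iff]

theorem pow_mul_mixed_entry {N ν : ℕ} (cc : Fin N → ℂ) {z : ℂ} (hz : z ≠ 0)
    (c : Fin (N + ν)) :
    z ^ N * (if h : (c : ℕ) < ν then z ^ (c : ℕ)
      else cc ⟨(c : ℕ) - ν, sub_lt_of_not_lt c h⟩
            * z ^ (-(((c : ℕ) - ν : ℕ) + 1 : ℤ)))
      = mixedWeight cc c * z ^ mixedExponent N ν c := by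
  have := c.isLt
  unfold mixedWeight mixedExponent
  split_ifs with h
  · rw [one_mul, pow_add]
  · rw [mul_left_comm, ← zpow_natCast z N, ← zpow_add₀ hz, ← zpow_natCast z (N - 1 - _)]
    congr 2
    omega

theorem eval_mixedPolynomial {N ν : ℕ} (cc : Fin N → ℂ) (x : Fin (N + ν) → ℂ) {z : ℂ}
    (hz : z ≠ 0) :
    (mixedPolynomial cc x).eval z = z ^ N * ∑ c : Fin (N + ν),
      (if h : (c : ℕ) < ν then z ^ (c : ℕ)
      else cc ⟨(c : ℕ) - ν, sub_lt_of_not_lt c h⟩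
            * z ^ (-(((c : ℕ) - ν : ℕ) + 1 : ℤ))) * x c := by
  rw [mixedPolynomial, Polynomial.eval_finsetSum, Finset.mul_sum]
  refine Finset.sum_congr rfl fun c _ => ?_
  rw [Polynomial.eval_monomial, ← mul_assoc, pow_mul_mixed_entry cc hz]
  ring

theorem sum_mixed_entry {N ν : ℕ} (cc : Fin N → ℂ) (x : Fin (N + ν) → ℂ) (z : ℂ) :
    ∑ c : Fin (N + ν),
      (if h : (c : ℕ) < ν then z ^ (c : ℕ)
      else cc ⟨(c : ℕ) - ν, sub_lt_of_not_lt c h⟩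
            * z ^ (-(((c : ℕ) - ν : ℕ) + 1 : ℤ))) * x c
      = (∑ k : Fin ν, z ^ (k : ℕ) * x ⟨(k : ℕ), val_lt_add_left N k⟩)
        + ∑ m : Fin N, cc m * z ^ (-((m : ℕ) + 1 : ℤ))
            * x ⟨ν + (m : ℕ), add_val_lt ν m⟩ := by
  rw [← (finCongr (add_comm ν N)).sum_comp, Fin.sum_univ_add]
  congr 1
  · refine Finset.sum_congr rfl fun k _ => ?_
    simp
    exact Or.inl rfl
  · refine Finset.sum_congr rfl fun m _ => ?_
    simp
    exact Or.inl (congrArg x (Fin.ext (add_comm _ _)))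

/-- The key lemma in the proof of Theorem 3.7: the `l`-th column of the inverse of a
mixed matrix with `ν` Vandermonde columns in `p_i` and `N` columns of weighted negative
powers `c_m p_i^{-m}`. -/
theorem statement13
    (N ν : ℕ) (hN : 1 ≤ N)
    (p : Fin (N + ν) → ℂ) (hp : Function.Injective p) (hp0 : ∀ i, p i ≠ 0)
    (cc : Fin N → ℂ) (hcc : ∀ m, cc m ≠ 0)
    (A : Matrix (Fin (N + ν)) (Fin (N + ν)) ℂ)
    (hA : ∀ i c, A i c =
      if h : (c : ℕ) < ν then p i ^ (c : ℕ)
      else cc ⟨(c : ℕ) - ν, by have := c.isLt; omega⟩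
            * p i ^ (-(((c : ℕ) - ν : ℕ) + 1 : ℤ))) :
    IsUnit A.det ∧
    ∀ l : Fin (N + ν), ∀ z : ℂ, z ≠ 0 →
      (∑ k : Fin ν, z ^ (k : ℕ) * A⁻¹ ⟨(k : ℕ), by have := k.isLt; omega⟩ l)
        + (∑ m : Fin N,
            cc m * z ^ (-((m : ℕ) + 1 : ℤ))
              * A⁻¹ ⟨ν + (m : ℕ), by have := m.isLt; omega⟩ l)
      = (p l / z) ^ N * ∏ i ∈ Finset.univ.erase l, (z - p i) / (p l - p i) := by
  have eval_p : ∀ x i, (mixedPolynomial cc x).eval (p i) = p i ^ N * (A *ᵥ x) i := by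
    intro x i
    rw [eval_mixedPolynomial cc x (hp0 i)]
    simp only [Matrix.mulVec, dotProduct, hA]
  have hdet : IsUnit A.det := by
    rw [isUnit_iff_ne_zero]
    intro h0
    obtain ⟨x, hx, hAx⟩ := Matrix.exists_mulVec_eq_zero_iff.mpr h0
    have hP : mixedPolynomial cc x = 0 := by
      refine Polynomial.eq_zero_of_degree_lt_of_eval_index_eq_zero Finset.univ
        (v := p) hp.injOn ?_ fun i _ => ?_
      · simpa using degree_mixedPolynomial_lt cc x
      · simp [eval_p, hAx]
    refine hx (funext fun c => ?_)
    have hc := coeff_mixedPolynomial cc x c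
    rw [hP, Polynomial.coeff_zero] at hc
    exact (mul_eq_zero.mp hc.symm).resolve_left (mixedWeight_ne_zero hcc c)
  refine ⟨hdet, fun l z hz => ?_⟩
  have hcol : ∀ i, (A *ᵥ fun c => A⁻¹ c l) i = if i = l then 1 else 0 := by
    intro i
    rw [← Matrix.one_apply, ← Matrix.mul_nonsing_inv A hdet]
    rfl
  have hP : mixedPolynomial cc (fun c => A⁻¹ c l)
      = Polynomial.C (p l ^ N) * Lagrange.basis Finset.univ p l := by
    refine Polynomial.eq_of_degrees_lt_of_eval_index_eq Finset.univ (v := p) hp.injOn ?_ ?_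
      fun i _ => ?_
    · simpa using degree_mixedPolynomial_lt cc (fun c => A⁻¹ c l)
    · rw [Polynomial.degree_C_mul (pow_ne_zero _ (hp0 l)),
        Lagrange.degree_basis hp.injOn (Finset.mem_univ l)]
      have := l.isLt
      simp only [Finset.card_univ, Fintype.card_fin]
      exact_mod_cast (by omega : N + ν - 1 < N + ν)
    · rw [eval_p, hcol, Polynomial.eval_mul, Polynomial.eval_C]
      split_ifs with h
      · rw [h, Lagrange.eval_basis_self hp.injOn (Finset.mem_univ l)]
      · rw [Lagrange.eval_basis_of_ne (Ne.symm h) (Finset.mem_univ i)]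
        simp
  have hbasis : (Lagrange.basis Finset.univ p l).eval z
      = ∏ i ∈ Finset.univ.erase l, (z - p i) / (p l - p i) := by
    rw [Lagrange.basis, Polynomial.eval_prod]
    refine Finset.prod_congr rfl fun i _ => ?_
    simp [Lagrange.basisDivisor, div_eq_inv_mul]
  have hev := eval_mixedPolynomial cc (fun c => A⁻¹ c l) hz
  rw [sum_mixed_entry, hP, Polynomial.eval_mul, Polynomial.eval_C, hbasis] at hev
  rw [div_pow, div_mul_eq_mul_div, hev, mul_div_cancel_left₀ _ (pow_ne_zero _ hz)]
end
end

section
/- Let N ≥ 1 and ν ≥ 0 be integers, M = N+ν. Let q_1,…,q_M and σ_1,…,σ_N be complex numbers with q_j + σ_i ≠ 0 for all i,j. Let D be the M×M matrix whose j-th row is (1, q_j, …, q_j^{ν−1}, 1/(q_j + σ_1), …, 1/(q_j + σ_N)). Then det D = (−1)^{Nν} · Δ_N(σ_1,…,σ_N) · Δ_M(q_1,…,q_M) / ∏_{i=1}^{N} ∏_{j=1}^{M} (q_j + σ_i). -/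
open Matrix Finset

noncomputable section

/-- Vandermonde product `Δ_n(x) = ∏_{i<j} (x_j - x_i)` (complex variables). -/
def vdmC {n : ℕ} (x : Fin n → ℂ) : ℂ :=
  ∏ i : Fin n, ∏ j ∈ Finset.Ioi i, (x j - x i)

open Polynomial in
/-- Evaluating `n` polynomials of degree less than `n` at `n` points factors the determinant
through the Vandermonde matrix. -/
lemma det_eval_eq_det_vandermonde_mul {R : Type*} [CommRing R] {n : ℕ} (p : Fin n → R[X])
    (hp : ∀ c, (p c).natDegree < n) (q : Fin n → R) :
    (Matrix.of fun j c => (p c).eval (q j)).det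
      = (vandermonde q).det * (Matrix.of fun i c : Fin n => (p c).coeff i).det := by
  rw [← Matrix.det_mul]
  congr 1
  ext j c
  rw [Matrix.mul_apply, Matrix.of_apply, eval_eq_sum_range' (hp c), Finset.sum_range]
  exact Finset.sum_congr rfl fun i _ => by simp [vandermonde_apply, mul_comm]

lemma det_vandermonde_eq_vdmC {n : ℕ} (x : Fin n → ℂ) : (vandermonde x).det = vdmC x :=
  det_vandermonde x

lemma vdmC_ne_zero {n : ℕ} {x : Fin n → ℂ} (hx : Function.Injective x) : vdmC x ≠ 0 := by
  rw [← det_vandermonde_eq_vdmC]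
  exact det_vandermonde_ne_zero_iff.2 hx

lemma vdmC_eq_prod_ite {n : ℕ} (x : Fin n → ℂ) :
    vdmC x = ∏ i : Fin n, ∏ j : Fin n, if i < j then x j - x i else 1 := by
  refine Finset.prod_congr rfl fun i _ => ?_
  rw [← Finset.prod_filter]
  congr 1
  ext j
  simp

lemma prod_prod_erase_sub_eq_vdmC_mul {n : ℕ} (x : Fin n → ℂ) :
    ∏ k : Fin n, ∏ i ∈ Finset.univ.erase k, (x i - x k) = vdmC x * vdmC (fun i => -x i) := by
  have h : vdmC (fun i => -x i) = ∏ k : Fin n, ∏ i : Fin n, if i < k then x i - x k else 1 := by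
    rw [vdmC_eq_prod_ite, Finset.prod_comm]
    refine Finset.prod_congr rfl fun k _ => Finset.prod_congr rfl fun i _ => ?_
    split_ifs <;> ring
  rw [h, vdmC_eq_prod_ite, ← Finset.prod_mul_distrib]
  refine Finset.prod_congr rfl fun k _ => ?_
  rw [← Finset.prod_mul_distrib, ← Finset.filter_ne', Finset.prod_filter]
  refine Finset.prod_congr rfl fun i _ => ?_
  rcases lt_trichotomy i k with h | h | h
  · simp [h, h.ne, h.not_gt]
  · simp [h]
  · simp [h, h.ne', h.not_gt]

/-- The first `ν` indices of `Fin (N + ν)`, followed by the last `N`. -/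
def finSumFinEquivSwap (N ν : ℕ) : Fin ν ⊕ Fin N ≃ Fin (N + ν) :=
  finSumFinEquiv.trans (finCongr (Nat.add_comm ν N))

@[simp] lemma coe_finSumFinEquivSwap_inl (N ν : ℕ) (a : Fin ν) :
    (finSumFinEquivSwap N ν (Sum.inl a) : ℕ) = a := by
  simp [finSumFinEquivSwap]

@[simp] lemma coe_finSumFinEquivSwap_inr (N ν : ℕ) (k : Fin N) :
    (finSumFinEquivSwap N ν (Sum.inr k) : ℕ) = ν + k := by
  simp [finSumFinEquivSwap, Nat.add_comm]

lemma vdmC_comp_finSumFinEquivSwap_symm {N ν : ℕ} (r : Fin ν → ℂ) (s : Fin N → ℂ) :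
    vdmC (Sum.elim r s ∘ (finSumFinEquivSwap N ν).symm)
      = vdmC r * (∏ a : Fin ν, ∏ k : Fin N, (s k - r a)) * vdmC s := by
  have hll (a b : Fin ν) : finSumFinEquivSwap N ν (Sum.inl a) < finSumFinEquivSwap N ν (Sum.inl b)
      ↔ a < b := by simp only [Fin.lt_def, coe_finSumFinEquivSwap_inl]
  have hlr (a : Fin ν) (k : Fin N) :
      finSumFinEquivSwap N ν (Sum.inl a) < finSumFinEquivSwap N ν (Sum.inr k) := by
    simp only [Fin.lt_def, coe_finSumFinEquivSwap_inl, coe_finSumFinEquivSwap_inr]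
    omega
  have hrr (k l : Fin N) : finSumFinEquivSwap N ν (Sum.inr k) < finSumFinEquivSwap N ν (Sum.inr l)
      ↔ k < l := by simp only [Fin.lt_def, coe_finSumFinEquivSwap_inr, Nat.add_lt_add_iff_left]
  simp_rw [vdmC_eq_prod_ite, ← (finSumFinEquivSwap N ν).prod_comp, Fintype.prod_sum_type,
    Function.comp_apply, Equiv.symm_apply_apply, Sum.elim_inl, Sum.elim_inr, hll, hrr, hlr,
    (hlr _ _).not_gt]
  simp [Finset.prod_mul_distrib]

open Polynomial in
/-- The columns of the generalised Cauchy matrix, cleared of the common denominator. -/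
def cauchyColumn {N ν : ℕ} (σ : Fin N → ℂ) : Fin ν ⊕ Fin N → ℂ[X] :=
  Sum.elim (fun a => X ^ (a : ℕ) * ∏ i, (X + C (σ i)))
    (fun k => ∏ i ∈ Finset.univ.erase k, (X + C (σ i)))

open Polynomial in
lemma natDegree_cauchyColumn_lt {N ν : ℕ} (σ : Fin N → ℂ) (c : Fin ν ⊕ Fin N) :
    (cauchyColumn σ c).natDegree < N + ν := by
  have hdeg (s : Finset (Fin N)) : (∏ i ∈ s, (X + C (σ i))).natDegree = s.card := by
    rw [natDegree_prod_of_monic _ _ fun i _ => monic_X_add_C (σ i)]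
    simp
  rcases c with a | k
  · have := a.isLt
    refine natDegree_mul_le.trans_lt ?_
    rw [hdeg, natDegree_X_pow, Finset.card_univ, Fintype.card_fin]
    omega
  · have := k.isLt
    change (∏ i ∈ Finset.univ.erase k, (X + C (σ i))).natDegree < N + ν
    rw [hdeg, Finset.card_erase_of_mem (Finset.mem_univ k), Finset.card_univ, Fintype.card_fin]
    omega

lemma eval_cauchyColumn_inl {N ν : ℕ} (σ : Fin N → ℂ) (a : Fin ν) (x : ℂ) :
    (cauchyColumn σ (Sum.inl a)).eval x = (∏ i, (x + σ i)) * x ^ (a : ℕ) := by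
  simp [cauchyColumn, Polynomial.eval_prod, mul_comm]

lemma eval_cauchyColumn_inr {N ν : ℕ} (σ : Fin N → ℂ) (k : Fin N) (x : ℂ) :
    (cauchyColumn (ν := ν) σ (Sum.inr k)).eval x = ∏ i ∈ Finset.univ.erase k, (x + σ i) := by
  simp [cauchyColumn, Polynomial.eval_prod]

/-- At the nodes `r, -σ` the matrix of cleared columns is block triangular. -/
lemma det_eval_cauchyColumn_nodes {N ν : ℕ} (σ : Fin N → ℂ) (r : Fin ν → ℂ) :
    (Matrix.of fun j c : Fin ν ⊕ Fin N =>
        (cauchyColumn σ c).eval (Sum.elim r (fun k => -σ k) j)).det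
      = (∏ a, ∏ i, (r a + σ i)) * vdmC r * (vdmC σ * vdmC fun i => -σ i) := by
  have h : (Matrix.of fun j c : Fin ν ⊕ Fin N =>
        (cauchyColumn σ c).eval (Sum.elim r (fun k => -σ k) j))
      = Matrix.fromBlocks (Matrix.diagonal (fun a => ∏ i, (r a + σ i)) * vandermonde r)
          (Matrix.of fun a k => (cauchyColumn (ν := ν) σ (Sum.inr k)).eval (r a)) 0
          (Matrix.diagonal fun k => ∏ i ∈ Finset.univ.erase k, (σ i - σ k)) := by
    ext (a | l) (b | k)
    · simp [eval_cauchyColumn_inl, vandermonde_apply, Matrix.diagonal_mul]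
    · simp
    · simp only [Matrix.of_apply, Sum.elim_inr, eval_cauchyColumn_inl, Matrix.fromBlocks_apply₂₁,
        Matrix.zero_apply]
      rw [Finset.prod_eq_zero (Finset.mem_univ l) (by ring), zero_mul]
    · simp only [Matrix.of_apply, Sum.elim_inr, eval_cauchyColumn_inr, Matrix.fromBlocks_apply₂₂]
      rcases eq_or_ne l k with rfl | hlk
      · rw [Matrix.diagonal_apply_eq]
        exact Finset.prod_congr rfl fun i _ => by ring
      · rw [Matrix.diagonal_apply_ne _ hlk]
        exact Finset.prod_eq_zero (Finset.mem_erase.2 ⟨hlk, Finset.mem_univ l⟩) (by ring)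
  rw [h, Matrix.det_fromBlocks_zero₂₁, Matrix.det_mul, Matrix.det_diagonal, Matrix.det_diagonal,
    det_vandermonde_eq_vdmC, prod_prod_erase_sub_eq_vdmC_mul]

lemma exists_injective_sumElim {α : Type*} [Infinite α] {N : ℕ} (ν : ℕ) {s : Fin N → α}
    (hs : Function.Injective s) : ∃ r : Fin ν → α, Function.Injective (Sum.elim r s) := by
  have hinf : (Set.range s)ᶜ.Infinite := (Set.finite_range s).infinite_compl
  refine ⟨fun a => hinf.natEmbedding _ a, Function.Injective.sumElim ?_ hs fun a k h => ?_⟩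
  · intro a b h
    exact Fin.ext ((hinf.natEmbedding _).injective (Subtype.ext h))
  · exact (hinf.natEmbedding _ a).2 ⟨k, h.symm⟩

/-- The generalised Cauchy determinant with denominators cleared, for distinct `σ`. -/
lemma det_eval_cauchyColumn {N ν : ℕ} {σ : Fin N → ℂ} (hσ : Function.Injective σ)
    (q : Fin (N + ν) → ℂ) :
    (Matrix.of fun j c : Fin (N + ν) =>
        (cauchyColumn σ ((finSumFinEquivSwap N ν).symm c)).eval (q j)).det
      = (-1 : ℂ) ^ (N * ν) * vdmC σ * vdmC q := by
  have hneg : Function.Injective fun k => -σ k := neg_injective.comp hσ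
  obtain ⟨r, hr⟩ := exists_injective_sumElim ν hneg
  set e := finSumFinEquivSwap N ν with he
  set q' : Fin (N + ν) → ℂ := Sum.elim r (fun k => -σ k) ∘ e.symm with hq'
  have hdeg (c : Fin (N + ν)) := natDegree_cauchyColumn_lt σ (e.symm c)
  have h' := det_eval_eq_det_vandermonde_mul _ hdeg q'
  have hnodes : (Matrix.of fun j c : Fin (N + ν) =>
      (cauchyColumn σ (e.symm c)).eval (q' j)).det
        = (∏ a, ∏ i, (r a + σ i)) * vdmC r * (vdmC σ * vdmC fun i => -σ i) := by
    rw [← det_eval_cauchyColumn_nodes, ← Matrix.det_submatrix_equiv_self e.symm]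
    rfl
  have hsign : ∏ a : Fin ν, ∏ k : Fin N, (-σ k - r a)
      = (-1 : ℂ) ^ (N * ν) * ∏ a, ∏ i, (r a + σ i) := by
    have (a : Fin ν) (k : Fin N) : -σ k - r a = -1 * (r a + σ k) := by ring
    simp_rw [this, Finset.prod_mul_distrib]
    simp [pow_mul]
  have hvdm := vdmC_comp_finSumFinEquivSwap_symm r (fun k => -σ k)
  have hne : vdmC q' ≠ 0 := vdmC_ne_zero (hr.comp e.symm.injective)
  have hsq : (-1 : ℂ) ^ (N * ν) * (-1 : ℂ) ^ (N * ν) = 1 := by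
    rw [← mul_pow]
    simp
  rw [hnodes, det_vandermonde_eq_vdmC] at h'
  rw [det_eval_eq_det_vandermonde_mul _ hdeg q, det_vandermonde_eq_vdmC, mul_comm]
  congr 1
  refine mul_left_cancel₀ hne (h'.symm.trans ?_)
  rw [hq', he, hvdm, hsign]
  linear_combination
    -(∏ a, ∏ i, (r a + σ i)) * vdmC r * (vdmC σ * vdmC fun i => -σ i) * hsq

/-- The generalised Cauchy determinant of Basor and Forrester, equation (2.19). -/
theorem statement14
    (N ν : ℕ) (hN : 1 ≤ N)
    (q : Fin (N + ν) → ℂ) (σ : Fin N → ℂ)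
    (hsum : ∀ i j, q j + σ i ≠ 0) :
    (Matrix.of fun j c : Fin (N + ν) =>
        if h : (c : ℕ) < ν then q j ^ (c : ℕ)
        else (q j + σ ⟨(c : ℕ) - ν, by have := c.isLt; omega⟩)⁻¹).det
      = (-1 : ℂ) ^ (N * ν) * vdmC σ * vdmC q
          / ∏ i : Fin N, ∏ j : Fin (N + ν), (q j + σ i) := by
  set e := finSumFinEquivSwap N ν with he
  by_cases hσ : Function.Injective σ
  · have hprod (j : Fin (N + ν)) : ∏ i, (q j + σ i) ≠ 0 :=
      Finset.prod_ne_zero_iff.2 fun i _ => hsum i j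
    rw [eq_div_iff (Finset.prod_ne_zero_iff.2 fun i _ =>
        Finset.prod_ne_zero_iff.2 fun j _ => hsum i j), Finset.prod_comm,
      ← det_eval_cauchyColumn hσ q, mul_comm, ← Matrix.det_mul_column]
    congr 1
    ext j c
    obtain ⟨c, rfl⟩ := e.surjective c
    rw [Matrix.of_apply, Matrix.of_apply, Matrix.of_apply, ← he, Equiv.symm_apply_apply]
    rcases c with a | k
    · rw [dif_pos (by simp [he]), eval_cauchyColumn_inl]
      simp [he]
    · rw [dif_neg (by simp [he]), eval_cauchyColumn_inr,
        ← Finset.mul_prod_erase _ _ (Finset.mem_univ k)]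
      have := hsum k j
      simp only [he, coe_finSumFinEquivSwap_inr, Nat.add_sub_cancel_left, Fin.eta]
      field_simp
  · have hzero : vdmC σ = 0 := by
      by_contra h
      rw [← det_vandermonde_eq_vdmC] at h
      exact hσ (det_vandermonde_ne_zero_iff.1 h)
    rw [hzero, mul_zero, zero_mul, zero_div]
    obtain ⟨k, l, hkl, hne⟩ := Function.not_injective_iff.1 hσ
    refine Matrix.det_zero_of_column_eq (i := e (Sum.inr k)) (j := e (Sum.inr l))
      (fun h => hne (Sum.inr_injective (e.injective h))) fun j => ?_
    simp [he, hkl]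
end
end

section
/- Let N ≥ 1 and ν ≥ 0 be integers, M = N+ν, and let q_1,…,q_M be nonzero complex numbers. Let D be the M×M matrix whose j-th row is (1, q_j, …, q_j^{ν−1}, q_j^{−1}, q_j^{−2}, …, q_j^{−N}). Then det D = (−1)^{Nν + N(N−1)/2} · Δ_M(q_1,…,q_M) · ∏_{j=1}^{M} q_j^{−N}. -/
open Matrix Finset

noncomputable section

/-- The permutation of `Fin (N + ν)` shifting the first `ν` indices up by `N` and reversing the
remaining `N` indices into the first `N` positions. -/
def shiftReversePerm (N ν : ℕ) : Equiv.Perm (Fin (N + ν)) where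
  toFun c := if h : (c : ℕ) < ν then ⟨c + N, by omega⟩ else ⟨N + ν - 1 - c, by omega⟩
  invFun c := if h : (c : ℕ) < N then ⟨N + ν - 1 - c, by omega⟩ else ⟨c - N, by omega⟩
  left_inv c := by
    have := c.isLt
    ext
    by_cases h : (c : ℕ) < ν
    · simp [h]
    · have h' : N + ν - 1 - (c : ℕ) < N := by omega
      simp only [h, h', dite_true, dite_false]
      omega
  right_inv c := by
    have := c.isLt
    ext
    by_cases h : (c : ℕ) < N
    · have h' : ¬ N + ν - 1 - (c : ℕ) < ν := by omega
      simp only [h, h', dite_true, dite_false]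
      omega
    · have h' : (c : ℕ) - N < ν := by omega
      simp only [h, h', dite_true, dite_false]
      omega

theorem shiftReversePerm_val {N ν : ℕ} (c : Fin (N + ν)) :
    (shiftReversePerm N ν c : ℕ) = if (c : ℕ) < ν then (c : ℕ) + N else N + ν - 1 - c := by
  simp only [shiftReversePerm, Equiv.coe_fn_mk]
  split_ifs <;> rfl

theorem sign_shiftReversePerm (N ν : ℕ) :
    Equiv.Perm.sign (shiftReversePerm N ν) = (-1) ^ (N * ν + N * (N - 1) / 2) := by
  have key (j : Fin (N + ν)) :
      (∏ i ∈ Finset.Iio j,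
        if shiftReversePerm N ν i < shiftReversePerm N ν j then (1 : ℤˣ) else -1) =
        if (j : ℕ) < ν then 1 else (-1) ^ (j : ℕ) := by
    split_ifs with hj
    · refine Finset.prod_eq_one fun i hi => if_pos ?_
      have hij : i < j := Finset.mem_Iio.mp hi
      rw [Fin.lt_def] at hij
      rw [Fin.lt_def, shiftReversePerm_val, shiftReversePerm_val]
      split_ifs <;> omega
    · rw [Finset.prod_congr rfl (g := fun _ => (-1 : ℤˣ)), Finset.prod_const, Fin.card_Iio]
      intro i hi
      refine if_neg ?_
      have hij : i < j := Finset.mem_Iio.mp hi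
      have := j.isLt
      rw [Fin.lt_def] at hij
      rw [Fin.lt_def, shiftReversePerm_val, shiftReversePerm_val]
      split_ifs <;> omega
  rw [Equiv.Perm.sign_eq_prod_prod_Iio, Finset.prod_congr rfl fun j _ => key j,
    Fin.prod_univ_eq_prod_range (fun k => if k < ν then (1 : ℤˣ) else (-1) ^ k) (N + ν),
    add_comm N ν, Finset.prod_range_add, Finset.prod_eq_one, one_mul]
  · simp only [Nat.not_lt.mpr (Nat.le_add_right _ _), if_false]
    rw [Finset.prod_pow_eq_pow_sum, Finset.sum_add_distrib, Finset.sum_range_id]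
    simp
  · intro k hk
    exact if_pos (Finset.mem_range.mp hk)

/-- The determinant identity mixing nonnegative and negative powers of the parameters
`q_j`, used in the evaluation of the normalising constant `Z_2` (proof of
Corollary 2.4). -/
theorem statement15
    (N ν : ℕ) (hN : 1 ≤ N)
    (q : Fin (N + ν) → ℂ) (hq : ∀ j, q j ≠ 0) :
    (Matrix.of fun j c : Fin (N + ν) =>
        if h : (c : ℕ) < ν then q j ^ (c : ℕ)
        else q j ^ (-(((c : ℕ) - ν : ℕ) + 1 : ℤ))).det
      = (-1 : ℂ) ^ (N * ν + N * (N - 1) / 2) * vdmC q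
          * ∏ j : Fin (N + ν), q j ^ (-(N : ℤ)) := by
  have hD : (Matrix.of fun j c : Fin (N + ν) =>
      if h : (c : ℕ) < ν then q j ^ (c : ℕ)
      else q j ^ (-(((c : ℕ) - ν : ℕ) + 1 : ℤ))) =
      Matrix.of fun j c => q j ^ (-(N : ℤ)) *
        (Matrix.vandermonde q).submatrix id (shiftReversePerm N ν) j c := by
    ext j c
    simp only [Matrix.of_apply, Matrix.submatrix_apply, id, Matrix.vandermonde_apply,
      shiftReversePerm_val]
    have := c.isLt
    split_ifs with h
    · rw [← zpow_natCast, ← zpow_natCast, ← zpow_add₀ (hq j)]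
      congr 1
      omega
    · rw [← zpow_natCast, ← zpow_add₀ (hq j)]
      congr 1
      omega
  rw [hD, Matrix.det_mul_column, Matrix.det_permute', Matrix.det_vandermonde,
    sign_shiftReversePerm, vdmC]
  push_cast
  ring
end
end

section
/- Let N ≥ 1, let (c_n)_{n≥0} be a sequence of real numbers such that the power series f(x) = Σ_{n=0}^∞ c_n x^n converges for all real x, and let λ_1,…,λ_N be real numbers. Then the function δ ↦ det[f(δ_k λ_l)]_{k,l=1}^N / Δ_N(δ_1,…,δ_N), defined on the set of δ ∈ ℝ^N with pairwise distinct coordinates, tends to (∏_{n=0}^{N−1} c_n) · Δ_N(λ_1,…,λ_N) as δ → 0 along tuples with pairwise distinct coordinates. -/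
open Matrix Finset

noncomputable section

/-- Vandermonde product `Δ_n(x) = ∏_{i<j} (x_j - x_i)`. -/
def vdm {n : ℕ} (x : Fin n → ℝ) : ℝ :=
  ∏ i : Fin n, ∏ j ∈ Finset.Ioi i, (x j - x i)

/-- Coefficient of `∏ i < j, (x - d i)` in the Newton expansion of `x ^ n` with nodes `d`. -/
def newtonCoeff (d : ℕ → ℝ) : ℕ → ℕ → ℝ
  | 0, 0 => 1
  | 0, _ + 1 => 0
  | n + 1, 0 => d 0 * newtonCoeff d n 0
  | n + 1, j + 1 => d (j + 1) * newtonCoeff d n (j + 1) + newtonCoeff d n j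

theorem newtonCoeff_zero_nodes (n j : ℕ) :
    newtonCoeff 0 n j = if n = j then 1 else 0 := by
  induction n generalizing j with
  | zero => cases j <;> simp [newtonCoeff]
  | succ n ih => cases j <;> simp [newtonCoeff, ih]

theorem continuous_newtonCoeff (n j : ℕ) : Continuous fun d => newtonCoeff d n j := by
  induction n generalizing j with
  | zero => cases j <;> simp only [newtonCoeff] <;> fun_prop
  | succ n ih =>
    cases j with
    | zero => exact (continuous_apply 0).mul (ih 0)
    | succ j => exact ((continuous_apply (j + 1)).mul (ih (j + 1))).add (ih j)

theorem abs_newtonCoeff_le {d : ℕ → ℝ} (hd : ∀ i, |d i| ≤ 1) (n j : ℕ) :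
    |newtonCoeff d n j| ≤ 2 ^ n := by
  have step (n i : ℕ) (h : |newtonCoeff d n i| ≤ 2 ^ n) :
      |d i * newtonCoeff d n i| ≤ 2 ^ n := by
    rw [abs_mul]
    exact (mul_le_of_le_one_left (abs_nonneg _) (hd i)).trans h
  induction n generalizing j with
  | zero => cases j <;> simp [newtonCoeff]
  | succ n ih =>
    have hpos : (0 : ℝ) < 2 ^ n := by positivity
    cases j with
    | zero =>
      rw [newtonCoeff, pow_succ]
      linarith [step n 0 (ih 0)]
    | succ j =>
      rw [newtonCoeff, pow_succ]
      linarith [abs_add_le (d (j + 1) * newtonCoeff d n (j + 1)) (newtonCoeff d n j),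
        step n (j + 1) (ih (j + 1)), ih j]

theorem mul_sum_newtonCoeff (d : ℕ → ℝ) (x : ℝ) (n m : ℕ) :
    x * ∑ j ∈ range (m + 1), newtonCoeff d n j * ∏ i ∈ range j, (x - d i) =
      (∑ j ∈ range (m + 1), newtonCoeff d (n + 1) j * ∏ i ∈ range j, (x - d i)) +
        newtonCoeff d n m * ∏ i ∈ range (m + 1), (x - d i) := by
  induction m with
  | zero => simp [newtonCoeff]; ring
  | succ m ih =>
    rw [sum_range_succ, mul_add, ih, sum_range_succ _ (m + 1), newtonCoeff,
      prod_range_succ _ (m + 1)]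
    ring

theorem pow_eq_sum_newtonCoeff (d : ℕ → ℝ) {k N : ℕ} (hk : k < N) (n : ℕ) :
    d k ^ n = ∑ j ∈ range N, newtonCoeff d n j * ∏ i ∈ range j, (d k - d i) := by
  obtain ⟨m, rfl⟩ : ∃ m, N = m + 1 := ⟨N - 1, by omega⟩
  induction n with
  | zero => simp [sum_range_succ', newtonCoeff]
  | succ n ih =>
    have hz : ∏ i ∈ range (m + 1), (d k - d i) = 0 :=
      prod_eq_zero (mem_range.2 hk) (sub_self _)
    rw [pow_succ', ih, mul_sum_newtonCoeff, hz, mul_zero, add_zero]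

/-- The Newton basis polynomials with nodes `d`, evaluated at the first `N` nodes. -/
def newtonMatrix (N : ℕ) (d : ℕ → ℝ) : Matrix (Fin N) (Fin N) ℝ :=
  Matrix.of fun k j => ∏ i ∈ range (j : ℕ), (d k - d i)

theorem det_newtonMatrix (N : ℕ) (d : ℕ → ℝ) :
    (newtonMatrix N d).det = vdm fun k : Fin N => d k := by
  have htri : (newtonMatrix N d).IsLowerTriangular := by
    intro k j hkj
    have hkj : (k : ℕ) < j := hkj
    exact prod_eq_zero (mem_range.2 hkj) (sub_self _)
  rw [det_of_isLowerTriangular _ htri, vdm,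
    prod_comm' (t' := univ) (s' := fun j : Fin N => Iio j) (by simp)]
  refine prod_congr rfl fun k _ => ?_
  rw [newtonMatrix, Matrix.of_apply]
  refine (prod_bij (s := Iio k) (t := range (k : ℕ)) (f := fun i => d k - d i)
    (g := fun i => d k - d i) (fun i _ => (i : ℕ)) ?_ ?_ ?_ ?_).symm
  · intro i hi
    simpa using hi
  · intro i _ j _ h
    exact Fin.ext h
  · intro i hi
    have hi := mem_range.1 hi
    exact ⟨⟨i, hi.trans k.2⟩, by simpa [Fin.lt_def] using hi, rfl⟩
  · intro i _
    rfl

/-- Newton coefficients (divided differences) at nodes `d` of the functions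
`x ↦ ∑ c n * (x * lam l) ^ n`. -/
def newtonSeriesMatrix {N : ℕ} (c : ℕ → ℝ) (lam : Fin N → ℝ) (d : ℕ → ℝ) :
    Matrix (Fin N) (Fin N) ℝ :=
  Matrix.of fun j l => ∑' n : ℕ, c n * lam l ^ n * newtonCoeff d n j

theorem norm_newtonSeries_term_le (c : ℕ → ℝ) (x : ℝ) {d : ℕ → ℝ} (hd : ∀ i, |d i| ≤ 1)
    (n j : ℕ) : ‖c n * x ^ n * newtonCoeff d n j‖ ≤ |c n * (2 * x) ^ n| := by
  rw [Real.norm_eq_abs, abs_mul, mul_pow, mul_left_comm, abs_mul (2 ^ n) _,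
    abs_of_pos (by positivity : (0 : ℝ) < 2 ^ n), mul_comm]
  exact mul_le_mul_of_nonneg_right (abs_newtonCoeff_le hd n j) (abs_nonneg _)

theorem of_tsum_eq_newtonMatrix_mul {N : ℕ} {c : ℕ → ℝ}
    (hconv : ∀ x : ℝ, Summable fun n => c n * x ^ n) (lam : Fin N → ℝ) {d : ℕ → ℝ}
    (hd : ∀ i, |d i| ≤ 1) :
    (Matrix.of fun k l : Fin N => ∑' n : ℕ, c n * (d k * lam l) ^ n) =
      newtonMatrix N d * newtonSeriesMatrix c lam d := by
  ext k l
  have hs (j : Fin N) : Summable fun n => c n * lam l ^ n * newtonCoeff d n j :=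
    .of_norm_bounded (hconv (2 * lam l)).abs fun n => norm_newtonSeries_term_le c _ hd n j
  simp only [Matrix.mul_apply, newtonMatrix, newtonSeriesMatrix, Matrix.of_apply]
  simp only [← tsum_mul_left]
  rw [← Summable.tsum_finsetSum fun j _ => (hs j).mul_left _]
  refine tsum_congr fun n => ?_
  rw [mul_pow, pow_eq_sum_newtonCoeff d k.2 n, ← Fin.sum_univ_eq_sum_range
    (fun j => newtonCoeff d n j * ∏ i ∈ range j, (d k - d i)), sum_mul, mul_sum]
  exact sum_congr rfl fun j _ => by ring

theorem tendsto_newtonSeriesMatrix {N : ℕ} {c : ℕ → ℝ}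
    (hconv : ∀ x : ℝ, Summable fun n => c n * x ^ n) (lam : Fin N → ℝ)
    {α : Type*} {F : Filter α} {d : α → ℕ → ℝ} (hd : Filter.Tendsto d F (nhds 0))
    (hbound : ∀ᶠ a in F, ∀ i, |d a i| ≤ 1) :
    Filter.Tendsto (fun a => newtonSeriesMatrix c lam (d a)) F
      (nhds (Matrix.of fun j l : Fin N => c j * lam l ^ (j : ℕ))) := by
  refine tendsto_pi_nhds.2 fun j => tendsto_pi_nhds.2 fun l => ?_
  have hlim : ∑' n : ℕ, c n * lam l ^ n * newtonCoeff 0 n j = c j * lam l ^ (j : ℕ) := by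
    rw [tsum_eq_single (j : ℕ)]
    · simp [newtonCoeff_zero_nodes]
    · intro n hn
      simp [newtonCoeff_zero_nodes, hn]
  rw [Matrix.of_apply, ← hlim]
  refine tendsto_tsum_of_dominated_convergence (hconv (2 * lam l)).abs (fun n => ?_) ?_
  · exact (((continuous_newtonCoeff n j).tendsto 0).comp hd).const_mul _
  · exact hbound.mono fun a ha n => norm_newtonSeries_term_le c _ ha n j

theorem vdm_eq_det_vandermonde {n : ℕ} (x : Fin n → ℝ) : vdm x = (vandermonde x).det :=
  (det_vandermonde x).symm

theorem det_of_coeff_mul_pow {N : ℕ} (c : ℕ → ℝ) (lam : Fin N → ℝ) :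
    (Matrix.of fun j l : Fin N => c j * lam l ^ (j : ℕ)).det =
      (∏ n ∈ range N, c n) * vdm lam := by
  rw [vdm_eq_det_vandermonde, ← det_transpose (vandermonde lam), ← Fin.prod_univ_eq_prod_range]
  exact det_mul_column (fun j : Fin N => c j) (vandermonde lam)ᵀ

/-- Extend a finite tuple by zero to a sequence. -/
def extendZero {N : ℕ} (δ : Fin N → ℝ) (i : ℕ) : ℝ :=
  if h : i < N then δ ⟨i, h⟩ else 0

theorem extendZero_coe {N : ℕ} (δ : Fin N → ℝ) (k : Fin N) : extendZero δ k = δ k := by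
  simp [extendZero]

theorem tendsto_extendZero (N : ℕ) :
    Filter.Tendsto (extendZero (N := N)) (nhds 0) (nhds 0) := by
  refine tendsto_pi_nhds.2 fun i => ?_
  by_cases h : i < N
  · simpa [extendZero, h] using (continuous_apply (⟨i, h⟩ : Fin N)).tendsto (0 : Fin N → ℝ)
  · simp [extendZero, h]

theorem eventually_abs_extendZero_le (N : ℕ) :
    ∀ᶠ δ : Fin N → ℝ in nhds 0, ∀ i, |extendZero δ i| ≤ 1 := by
  filter_upwards [Metric.closedBall_mem_nhds (0 : Fin N → ℝ) one_pos] with δ hδ i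
  by_cases h : i < N
  · simpa [extendZero, h] using
      (norm_le_pi_norm δ ⟨i, h⟩).trans (mem_closedBall_zero_iff.1 hδ)
  · simp [extendZero, h]

/-- The l'Hôpital-rule degeneration lemma, equation (A.4): fully degenerate limit of
`det[f(δ_k λ_l)] / Δ_N(δ)` as `δ → 0` along tuples with pairwise distinct coordinates,
where `f(x) = Σ c_n x^n` is an everywhere convergent power series. -/
theorem statement16
    (N : ℕ) (hN : 1 ≤ N)
    (c : ℕ → ℝ) (hconv : ∀ x : ℝ, Summable fun n => c n * x ^ n)
    (lam : Fin N → ℝ) :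
    Filter.Tendsto
      (fun δ : Fin N → ℝ =>
        (Matrix.of fun k l : Fin N => ∑' n : ℕ, c n * (δ k * lam l) ^ n).det / vdm δ)
      (nhdsWithin 0 {δ : Fin N → ℝ | Function.Injective δ})
      (nhds ((∏ n ∈ Finset.range N, c n) * vdm lam)) := by
  rw [← det_of_coeff_mul_pow c lam]
  have hlim := ((continuous_id.matrix_det).tendsto _).comp
    (tendsto_newtonSeriesMatrix hconv lam (tendsto_extendZero N) (eventually_abs_extendZero_le N))
  refine (hlim.mono_left nhdsWithin_le_nhds).congr' ?_
  filter_upwards [self_mem_nhdsWithin,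
    nhdsWithin_le_nhds (eventually_abs_extendZero_le N)] with δ hinj hδ
  have hne : vdm δ ≠ 0 := by
    rw [vdm_eq_det_vandermonde]
    exact det_vandermonde_ne_zero_iff.2 hinj
  have hdet := congrArg det (of_tsum_eq_newtonMatrix_mul hconv lam hδ)
  simp only [det_mul, det_newtonMatrix, extendZero_coe] at hdet
  rw [hdet, mul_div_cancel_left₀ _ hne]
  rfl
end
end

section
/- Let n, m ≥ 0 be integers and let u, v, π_1,…,π_n, θ_1,…,θ_m be complex numbers with u ≠ v, v ≠ π_l for all 1 ≤ l ≤ n, and u ≠ θ_k for all 1 ≤ k ≤ m. Then (1/(u−v)) · ∏_{l=1}^{n} (u−π_l)/(v−π_l) · ∏_{k=1}^{m} (v−θ_k)/(u−θ_k) = 1/(u−v) − Σ_{i=1}^{m} [∏_{k=1}^{i−1} (v−θ_k)] / [∏_{k=1}^{i} (u−θ_k)] + Σ_{j=1}^{n} [∏_{l=1}^{j−1} (u−π_l) · ∏_{k=1}^{m} (v−θ_k)] / [∏_{k=1}^{m} (u−θ_k) · ∏_{l=1}^{j} (v−π_l)]. -/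
open Finset

noncomputable section

/-- The Desrosiers–Forrester partial-fraction identity. -/
theorem inv_sub_mul_prod_div {K : Type*} [Field K] {a b : K} (hab : a ≠ b) (P : ℕ → K) (n : ℕ)
    (hP : ∀ l < n, b ≠ P l) :
    (a - b)⁻¹ * ∏ l ∈ Finset.range n, (a - P l) / (b - P l)
      = (a - b)⁻¹ + ∑ j ∈ Finset.range n,
          (∏ l ∈ Finset.range j, (a - P l)) / ∏ l ∈ Finset.range (j + 1), (b - P l) := by
  induction n with
  | zero => simp
  | succ n ih =>
    have hn : b - P n ≠ 0 := sub_ne_zero.mpr (hP n n.lt_succ_self)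
    have hprod : ∏ l ∈ Finset.range n, (b - P l) ≠ 0 := Finset.prod_ne_zero_iff.mpr fun l hl =>
      sub_ne_zero.mpr (hP l ((Finset.mem_range.mp hl).trans n.lt_succ_self))
    have hab' : a - b ≠ 0 := sub_ne_zero.mpr hab
    rw [Finset.sum_range_succ, ← add_assoc, ← ih fun l hl => hP l (hl.trans n.lt_succ_self)]
    simp only [Finset.prod_range_succ, Finset.prod_div_distrib]
    field_simp
    ring

/-- The double partial-fraction identity, equation (4.17), obtained by applying the
Desrosiers–Forrester identity twice. -/
theorem statement17
    (n m : ℕ) (u v : ℂ) (P T : ℕ → ℂ)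
    (huv : u ≠ v) (hvP : ∀ l < n, v ≠ P l) (huT : ∀ k < m, u ≠ T k) :
    (u - v)⁻¹ * (∏ l ∈ Finset.range n, (u - P l) / (v - P l))
        * ∏ k ∈ Finset.range m, (v - T k) / (u - T k)
      = (u - v)⁻¹
        - (∑ i ∈ Finset.range m,
            (∏ k ∈ Finset.range i, (v - T k)) / ∏ k ∈ Finset.range (i + 1), (u - T k))
        + ∑ j ∈ Finset.range n,
            (∏ l ∈ Finset.range j, (u - P l)) * (∏ k ∈ Finset.range m, (v - T k))
              / ((∏ k ∈ Finset.range m, (u - T k))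
                  * ∏ l ∈ Finset.range (j + 1), (v - P l)) := by
  have hT := inv_sub_mul_prod_div huv.symm T m huT
  rw [← neg_sub u v, inv_neg] at hT
  rw [inv_sub_mul_prod_div huv P n hvP, add_mul, Finset.sum_mul]
  congr 1
  · linear_combination -hT
  · refine Finset.sum_congr rfl fun j _ => ?_
    rw [Finset.prod_div_distrib, div_mul_div_comm, mul_comm (∏ l ∈ Finset.range (j + 1), (v - P l))]
end
end

section
/- Let κ ≥ 0 be an integer and let α, q, δ be real numbers with α > 0, q > 0 and 0 ≤ δ < α q. Then ∫_0^∞ E_κ(δ, y) · F_κ(α y, q) dy = 1 / (α^κ (α q − δ)); explicitly, ∫_0^∞ (Σ_{n=0}^∞ δ^n y^{n+κ}/(n!·(n+κ)!)) · (∫_0^∞ t^{−κ−1} exp(−α y/t − q t) dt) dy = 1 / (α^κ (α q − δ)). -/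
open MeasureTheory

noncomputable section

theorem lintegral_pow_mul_exp_neg_mul (n : ℕ) {r : ℝ} (hr : 0 < r) :
    ∫⁻ x in Set.Ioi (0 : ℝ), ENNReal.ofReal (x ^ n * Real.exp (-(r * x)))
      = ENNReal.ofReal (n.factorial / r ^ (n + 1)) := by
  have hn : (0 : ℝ) < (n : ℝ) + 1 := by positivity
  have h := Real.integral_rpow_mul_exp_neg_mul_Ioi hn hr
  simp only [add_sub_cancel_right, Real.rpow_natCast, Real.Gamma_nat_eq_factorial] at h
  have hpos : 0 < (n.factorial : ℝ) / r ^ (n + 1) := by positivity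
  have hval : (1 / r) ^ ((n : ℝ) + 1) * (n.factorial : ℝ) = n.factorial / r ^ (n + 1) := by
    rw [← Nat.cast_succ, Real.rpow_natCast, one_div, inv_pow, Nat.succ_eq_add_one]
    ring
  rw [hval] at h
  rw [← h, ofReal_integral_eq_lintegral_ofReal]
  · refine not_imp_comm.mp integral_undef ?_
    rw [h]
    exact hpos.ne'
  · filter_upwards [ae_restrict_mem measurableSet_Ioi] with x hx
    have : (0 : ℝ) < x := hx
    simp only [Pi.zero_apply]
    positivity

theorem lintegral_term_mul_kernel (κ n : ℕ) {α q δ : ℝ} (hα : 0 < α) (hq : 0 < q)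
    (hδ : 0 ≤ δ) :
    ∫⁻ y in Set.Ioi (0 : ℝ), ∫⁻ t in Set.Ioi (0 : ℝ),
        ENNReal.ofReal (δ ^ n * y ^ (n + κ) / ((n.factorial : ℝ) * ((n + κ).factorial : ℝ))) *
          ENNReal.ofReal (t ^ (-(κ : ℤ) - 1) * Real.exp (-(α * y) / t - q * t))
      = ENNReal.ofReal (1 / (α ^ (κ + 1) * q) * (δ / (α * q)) ^ n) := by
  rw [lintegral_lintegral_swap (by fun_prop)]
  have inner : ∀ t ∈ Set.Ioi (0 : ℝ),
      ∫⁻ y in Set.Ioi (0 : ℝ),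
        ENNReal.ofReal (δ ^ n * y ^ (n + κ) / ((n.factorial : ℝ) * ((n + κ).factorial : ℝ))) *
          ENNReal.ofReal (t ^ (-(κ : ℤ) - 1) * Real.exp (-(α * y) / t - q * t))
      = ENNReal.ofReal (δ ^ n / (n.factorial * α ^ (n + κ + 1))) *
          ENNReal.ofReal (t ^ n * Real.exp (-(q * t))) := by
    intro t ht
    have ht : 0 < t := ht
    have key : ∀ y ∈ Set.Ioi (0 : ℝ),
        ENNReal.ofReal (δ ^ n * y ^ (n + κ) / ((n.factorial : ℝ) * ((n + κ).factorial : ℝ))) *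
          ENNReal.ofReal (t ^ (-(κ : ℤ) - 1) * Real.exp (-(α * y) / t - q * t))
        = ENNReal.ofReal (δ ^ n / ((n.factorial : ℝ) * ((n + κ).factorial : ℝ)) *
            (t ^ (-(κ : ℤ) - 1) * Real.exp (-(q * t)))) *
          ENNReal.ofReal (y ^ (n + κ) * Real.exp (-(α / t * y))) := by
      intro y hy
      have hy : 0 < y := hy
      rw [← ENNReal.ofReal_mul (by positivity), ← ENNReal.ofReal_mul (by positivity)]
      have : -(α * y) / t - q * t = -(q * t) + -(α / t * y) := by ring
      rw [this, Real.exp_add]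
      congr 1
      ring
    rw [setLIntegral_congr_fun measurableSet_Ioi key, lintegral_const_mul _ (by fun_prop),
      lintegral_pow_mul_exp_neg_mul _ (by positivity), ← ENNReal.ofReal_mul (by positivity),
      ← ENNReal.ofReal_mul (by positivity)]
    congr 1
    have hz : t ^ (-(κ : ℤ) - 1) = (t ^ (κ + 1))⁻¹ := by
      rw [← zpow_natCast, ← zpow_neg]
      congr 1
      push_cast
      ring
    rw [hz, div_pow]
    field_simp
    ring
  rw [setLIntegral_congr_fun measurableSet_Ioi inner, lintegral_const_mul _ (by fun_prop),
    lintegral_pow_mul_exp_neg_mul _ hq, ← ENNReal.ofReal_mul (by positivity)]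
  congr 1
  rw [div_pow, mul_pow]
  field_simp
  ring

/-- Equation (2.32): the Gram-matrix entry of the coupled ensemble,
`∫_0^∞ E_κ(δ,y) F_κ(αy,q) dy = 1/(α^κ (αq − δ))`. -/
theorem statement18
    (κ : ℕ) (α q δ : ℝ) (hα : 0 < α) (hq : 0 < q)
    (hδ0 : 0 ≤ δ) (hδ : δ < α * q) :
    ∫ y in Set.Ioi (0 : ℝ), Ebes κ δ y * Fbes κ (α * y) q
      = 1 / (α ^ κ * (α * q - δ)) := by
  set e : ℕ → ℝ → ENNReal := fun n y => ENNReal.ofReal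
    (δ ^ n * y ^ (n + κ) / ((n.factorial : ℝ) * ((n + κ).factorial : ℝ)))
  set k : ℝ → ℝ → ENNReal := fun y t => ENNReal.ofReal
    (t ^ (-(κ : ℤ) - 1) * Real.exp (-(α * y) / t - q * t)) with hk
  have hem : ∀ n, Measurable (e n) := fun n => by fun_prop
  have hkm : Measurable (Function.uncurry k) := by
    simp only [hk, Function.uncurry_def]
    fun_prop
  have hK : Measurable fun y => ∫⁻ t in Set.Ioi (0 : ℝ), k y t := hkm.lintegral_prod_right'
  have hEF : ∀ y ∈ Set.Ioi (0 : ℝ), Ebes κ δ y * Fbes κ (α * y) q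
      = ((∑' n, e n y) * ∫⁻ t in Set.Ioi (0 : ℝ), k y t).toReal := by
    intro y hy
    have hy : 0 < y := hy
    rw [ENNReal.toReal_mul, ENNReal.tsum_toReal_eq fun n => ENNReal.ofReal_ne_top]
    congr 1
    · refine tsum_congr fun n => (ENNReal.toReal_ofReal ?_).symm
      positivity
    · refine integral_eq_lintegral_of_nonneg_ae ?_ ?_
      · filter_upwards [ae_restrict_mem measurableSet_Ioi] with t ht
        have : (0 : ℝ) < t := ht
        simp only [Pi.zero_apply]
        positivity
      · exact Measurable.aestronglyMeasurable (by fun_prop)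
  have hr0 : 0 ≤ δ / (α * q) := by positivity
  have hr1 : δ / (α * q) < 1 := (div_lt_one (by positivity)).mpr hδ
  have hL : ∫⁻ y in Set.Ioi (0 : ℝ), (∑' n, e n y) * ∫⁻ t in Set.Ioi (0 : ℝ), k y t
      = ENNReal.ofReal (1 / (α ^ κ * (α * q - δ))) := by
    simp_rw [← ENNReal.tsum_mul_right]
    rw [lintegral_tsum (f := fun n y => e n y * ∫⁻ t in Set.Ioi (0 : ℝ), k y t)
      fun n => ((hem n).mul hK).aemeasurable]
    have hterm : ∀ n, ∫⁻ y in Set.Ioi (0 : ℝ), e n y * ∫⁻ t in Set.Ioi (0 : ℝ), k y t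
        = ENNReal.ofReal (1 / (α ^ (κ + 1) * q) * (δ / (α * q)) ^ n) := by
      intro n
      rw [← lintegral_term_mul_kernel κ n hα hq hδ0]
      refine lintegral_congr fun y => ?_
      exact (lintegral_const_mul _ (hkm.comp measurable_prodMk_left)).symm
    simp_rw [hterm]
    rw [← ENNReal.ofReal_tsum_of_nonneg (fun n => by positivity)
      ((summable_geometric_of_lt_one hr0 hr1).mul_left _), tsum_mul_left,
      tsum_geometric_of_lt_one hr0 hr1]
    congr 1
    have h1 : α * q - δ ≠ 0 := (sub_pos.mpr hδ).ne'
    have h2 : 1 - δ / (α * q) = (α * q - δ) / (α * q) := by field_simp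
    rw [h2]
    field_simp
    ring
  have hm : Measurable fun y => (∑' n, e n y) * ∫⁻ t in Set.Ioi (0 : ℝ), k y t :=
    (Measurable.tsum hem).mul hK
  rw [setIntegral_congr_fun measurableSet_Ioi hEF, integral_toReal hm.aemeasurable
    (ae_lt_top hm (by rw [hL]; exact ENNReal.ofReal_ne_top)), hL, ENNReal.toReal_ofReal]
  have := sub_pos.mpr hδ
  positivity
end
end
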